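/- arXiv:math/9804008 — 5 statements merged into one kernel-verified Lean document; each statement's English description precedes it below -/
import Mathlib

section
/- Let n ≥ 2 be a natural number, let 0 ≤ q ≤ n, let b_1,…,b_q and c_1,…,c_q be real numbers with b_j > c_j ≥ 0 for every j, and let δ > 0. Define ρ₁ : ℂⁿ → ℝ by ρ₁(z) = Σ_{j=1}^q ( b_j (Re z_j)² − c_j (Im z_j)² ) + δ Σ_{j=q+1}^n |z_j|², and set D⁺ = { z ∈ ℂⁿ : ‖z‖ < 1 and ρ₁(z) > 0 }. Then for every function f : ℂⁿ → ℂ holomorphic on D⁺ there exist an open neighborhood U of the origin and a function F holomorphic on U such that F = f on U ∩ D⁺. (In the paper's language: the envelope of holomorphy of D⁺ contains the origin.) -/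
section

open Metric Set Function Filter MeasureTheory
open scoped Topology Real

theorem differentiableOn_circleIntegral_param {E : Type*} [NormedAddCommGroup E] [NormedSpace ℂ E]
    [FiniteDimensional ℂ E] {U : Set E} (hU : IsOpen U) {R : ℝ} (hR : 0 ≤ R) {H : E → ℂ → ℂ}
    (hcont : ContinuousOn (uncurry H) (U ×ˢ sphere 0 R))
    (hdiff : ∀ ζ ∈ sphere (0 : ℂ) R, DifferentiableOn ℂ (H · ζ) U) :
    DifferentiableOn ℂ (fun z => ∮ ζ in C(0, R), H z ζ) U := by
  have : ProperSpace E := FiniteDimensional.proper ℂ E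
  intro x₀ hx₀
  obtain ⟨r, hr, hrU⟩ : ∃ r > 0, closedBall x₀ (r + r) ⊆ U := by
    obtain ⟨ε, hε, h⟩ := nhds_basis_closedBall.mem_iff.1 (hU.mem_nhds hx₀)
    exact ⟨ε / 2, half_pos hε, by simpa using h⟩
  have hball : ∀ x ∈ ball x₀ r, ball x r ⊆ closedBall x₀ (r + r) := fun x hx =>
    (ball_subset_ball' (by rw [mem_ball] at hx; linarith)).trans ball_subset_closedBall
  have hcomp : IsCompact (closedBall x₀ (r + r) ×ˢ sphere (0 : ℂ) R) :=
    (isCompact_closedBall _ _).prod (isCompact_sphere _ _)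
  obtain ⟨M, hM⟩ := hcomp.exists_bound_of_continuousOn
    (hcont.mono (prod_mono hrU subset_rfl))
  have hmem : ∀ θ, circleMap 0 R θ ∈ sphere (0 : ℂ) R := circleMap_mem_sphere 0 hR
  have hcontθ : ∀ x ∈ U, Continuous fun θ : ℝ => H x (circleMap 0 R θ) := fun x hx =>
    hcont.comp_continuous (f := fun θ : ℝ => (x, circleMap 0 R θ)) (by fun_prop)
      fun θ => ⟨hx, hmem θ⟩
  have hfd : ∀ ζ ∈ sphere (0 : ℂ) R, ∀ x ∈ U, DifferentiableAt ℂ (H · ζ) x := fun ζ hζ x hx =>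
    (hdiff ζ hζ).differentiableAt (hU.mem_nhds hx)
  have hbound : ∀ ζ ∈ sphere (0 : ℂ) R, ∀ x ∈ ball x₀ r, ‖fderiv ℂ (H · ζ) x‖ ≤ 2 * M / r := by
    intro ζ hζ x hx
    refine Complex.norm_fderiv_le_div_of_mapsTo_ball
      ((hdiff ζ hζ).mono ((hball x hx).trans hrU)) (fun y hy => ?_) hr
    have h1 := hM (y, ζ) ⟨hball x hx hy, hζ⟩
    have h2 := hM (x, ζ) ⟨hball x hx (mem_ball_self hr), hζ⟩
    rw [mem_closedBall, dist_eq_norm]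
    exact (norm_sub_le _ _).trans (by simpa [two_mul] using add_le_add h1 h2)
  have hcf : ContinuousOn (fun ζ => fderiv ℂ (H · ζ) x₀) (sphere (0 : ℂ) R) := by
    intro ζ₀ hζ₀
    rw [ContinuousWithinAt, Metric.tendsto_nhds]
    intro ε hε
    have hsw : ContinuousOn (uncurry fun ζ x => H x ζ)
        (sphere (0 : ℂ) R ×ˢ closedBall x₀ (r + r)) :=
      (hcont.mono (prod_mono hrU subset_rfl)).comp continuous_swap.continuousOn
        fun p hp => ⟨hp.2, hp.1⟩
    obtain ⟨v, hv, hvu⟩ := (isCompact_closedBall x₀ (r + r)).mem_uniformity_of_prod hsw hζ₀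
      (dist_mem_uniformity (show 0 < r * ε / 4 by positivity))
    filter_upwards [hv, self_mem_nhdsWithin] with ζ hζv hζ
    have hsub : ball x₀ r ⊆ closedBall x₀ (r + r) := hball x₀ (mem_ball_self hr)
    rw [dist_eq_norm, ← fderiv_fun_sub (hfd ζ hζ x₀ hx₀) (hfd ζ₀ hζ₀ x₀ hx₀)]
    have := Complex.norm_fderiv_le_div_of_mapsTo_ball (c := x₀) (R₁ := r) (R₂ := r * ε / 2)
      (f := fun x => H x ζ - H x ζ₀)
      (((hdiff ζ hζ).sub (hdiff ζ₀ hζ₀)).mono (hsub.trans hrU)) (fun y hy => ?_) hr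
    · refine this.trans_lt ?_
      rw [div_lt_iff₀ hr]; nlinarith
    · have h1 : dist _ _ < _ := hvu ζ hζv y (hsub hy)
      have h2 : dist _ _ < _ := hvu ζ hζv x₀ (hsub (mem_ball_self hr))
      rw [dist_eq_norm] at h1 h2
      rw [mem_closedBall, dist_eq_norm]
      refine (norm_sub_le _ _).trans ?_
      linarith
  have hcd : Continuous fun θ => deriv (circleMap 0 R) θ := by
    simp only [deriv_circleMap]; fun_prop
  have key := intervalIntegral.hasFDerivAt_integral_of_dominated_of_fderiv_le (𝕜 := ℂ)
    (μ := volume) (a := 0) (b := 2 * π)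
    (F := fun x θ => deriv (circleMap 0 R) θ • H x (circleMap 0 R θ))
    (F' := fun x θ => deriv (circleMap 0 R) θ • fderiv ℂ (H · (circleMap 0 R θ)) x)
    (x₀ := x₀) (s := ball x₀ r) (bound := fun _ => R * (2 * M / r)) (ball_mem_nhds _ hr)
    (by
      filter_upwards [hU.mem_nhds hx₀] with x hx
      exact (hcd.smul (hcontθ x hx)).aestronglyMeasurable)
    ((hcd.smul (hcontθ x₀ hx₀)).intervalIntegrable _ _)
    (hcd.smul (hcf.comp_continuous (continuous_circleMap 0 R) hmem)).aestronglyMeasurable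
    (Eventually.of_forall fun θ _ x hx => by
      rw [norm_smul]
      refine mul_le_mul (by simp [abs_of_nonneg hR]) (hbound _ (hmem θ) x hx) (norm_nonneg _) hR)
    intervalIntegrable_const
    (Eventually.of_forall fun θ _ x hx =>
      ((hfd _ (hmem θ) x (hrU (hball x hx (mem_ball_self hr)))).hasFDerivAt).fun_const_smul _)
  exact key.differentiableAt.differentiableWithinAt

theorem circleIntegral_comp_div {R : ℝ} (hR : 0 < R) {s : ℂ} (hs : s ≠ 0) (g : ℂ → ℂ) :
    (∮ ζ in C(0, ‖s‖ / R), g ζ) = ∮ ζ in C(0, R), s / ζ ^ 2 * g (s / ζ) := by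
  have hinv : ∀ θ : ℝ, circleMap 0 (‖s‖ / R) (s.arg - θ) = s / circleMap 0 R θ := by
    intro θ
    have hR' : (R : ℂ) ≠ 0 := by exact_mod_cast hR.ne'
    conv_rhs => rw [← Complex.norm_mul_exp_arg_mul_I s]
    simp only [circleMap, zero_add, Complex.ofReal_div, Complex.ofReal_sub, sub_mul,
      Complex.exp_sub]
    field_simp
  set k : ℝ → ℂ := fun θ => circleMap 0 (‖s‖ / R) θ * Complex.I * g (circleMap 0 (‖s‖ / R) θ)
  have hper : Periodic k (2 * π) := fun θ => by
    simp only [k, periodic_circleMap 0 (‖s‖ / R) θ]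
  have h1 : (∮ ζ in C(0, ‖s‖ / R), g ζ) = ∫ θ in (0 : ℝ)..2 * π, k θ := by
    simp [circleIntegral, k]
  have h2 : ∫ θ in (0 : ℝ)..2 * π, k (s.arg - θ) = ∫ θ in (0 : ℝ)..2 * π, k θ := by
    rw [intervalIntegral.integral_comp_sub_left k]
    have := hper.intervalIntegral_add_eq (s.arg - 2 * π) 0
    simpa using this
  rw [h1, ← h2, circleIntegral]
  congr 1
  ext θ
  have hc : circleMap 0 R θ ≠ 0 := circleMap_ne_center hR.ne'
  simp only [k, hinv, deriv_circleMap, smul_eq_mul]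
  field_simp

theorem laurent_cauchy_formula {R : ℝ} {g : ℂ → ℂ} {u w : ℂ} (hu0 : u ≠ 0) (hw0 : w ≠ 0)
    (hu : ‖u‖ < R) (hw : ‖w‖ < R)
    (hg : ∀ ζ, ‖u * w‖ / R ≤ ‖ζ‖ → ‖ζ‖ ≤ R → DifferentiableAt ℂ g ζ) :
    (∮ ζ in C(0, R), g ζ / (ζ - u)) + (∮ ζ in C(0, R), g (u * w / ζ) * (w / (ζ * (ζ - w)))) =
      2 * π * Complex.I * g u := by
  have hR : 0 < R := (norm_nonneg u).trans_lt hu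
  have hs : u * w ≠ 0 := mul_ne_zero hu0 hw0
  set r := ‖u * w‖ / R with hr
  have hr0 : 0 < r := by positivity
  have hru : r < ‖u‖ := by
    rw [hr, norm_mul, div_lt_iff₀ hR]
    exact mul_lt_mul_of_pos_left hw (norm_pos_iff.2 hu0)
  have hdu : DifferentiableAt ℂ g u := hg u hru.le hu.le
  have hds : ∀ ζ, r ≤ ‖ζ‖ → ‖ζ‖ ≤ R → DifferentiableAt ℂ (dslope g u) ζ := by
    intro ζ h1 h2
    rcases eq_or_ne ζ u with rfl | hne
    · have hO : IsOpen {x : ℂ | r < ‖x‖ ∧ ‖x‖ < R} :=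
        (isOpen_lt continuous_const continuous_norm).inter
          (isOpen_lt continuous_norm continuous_const)
      have hn := hO.mem_nhds (show ζ ∈ _ from ⟨hru, hu⟩)
      refine DifferentiableOn.differentiableAt ?_ hn
      rw [Complex.differentiableOn_dslope hn]
      exact fun x hx => (hg x hx.1.le hx.2.le).differentiableWithinAt
    · exact (differentiableAt_dslope_of_ne hne).2 (hg ζ h1 h2)
  have hann := Complex.circleIntegral_eq_of_differentiable_on_annulus_off_countable (c := 0) hr0
    (hru.trans hu).le (f := dslope g u) countable_empty
    (fun ζ hζ => (hds ζ (by simpa using hζ.2) (by simpa using hζ.1)).continuousAt.continuousWithinAt)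
    (fun ζ hζ => hds ζ (by simpa using (le_of_not_ge (by simpa using hζ.1.2)))
      (by simpa using (mem_ball.1 hζ.1.1).le))
  have hsplit : ∀ t, r ≤ t → t ≤ R → t ≠ ‖u‖ → (∮ ζ in C(0, t), dslope g u ζ) =
      (∮ ζ in C(0, t), g ζ / (ζ - u)) - g u * ∮ ζ in C(0, t), (ζ - u)⁻¹ := by
    intro t ht1 ht2 htu
    have ht0 : 0 ≤ t := hr0.le.trans ht1
    have hne : ∀ ζ ∈ sphere (0 : ℂ) t, ζ - u ≠ 0 := by
      intro ζ hζ h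
      rw [sub_eq_zero] at h
      exact htu (by simpa [h] using hζ.symm)
    have hi : ContinuousOn (fun ζ : ℂ => (ζ - u)⁻¹) (sphere 0 t) :=
      ContinuousOn.inv₀ (by fun_prop) hne
    have hgc : ContinuousOn g (sphere 0 t) := fun ζ hζ =>
      (hg ζ (by simpa [mem_sphere_zero_iff_norm.1 hζ] using ht1)
        (by simpa [mem_sphere_zero_iff_norm.1 hζ] using ht2)).continuousAt.continuousWithinAt
    rw [← circleIntegral.integral_const_mul, ← circleIntegral.integral_sub]
    · refine circleIntegral.integral_congr ht0 fun ζ hζ => ?_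
      have := hne ζ hζ
      rw [dslope_of_ne _ (sub_ne_zero.1 this), slope_def_field]
      field_simp
    · exact ContinuousOn.circleIntegrable ht0 (by simp only [div_eq_mul_inv]; exact hgc.mul hi)
    · exact ContinuousOn.circleIntegrable ht0 (continuousOn_const.mul hi)
  have hzero : ∮ ζ in C(0, r), (ζ - u)⁻¹ = 0 := by
    have hd : ∀ ζ : ℂ, ‖ζ‖ ≤ r → DifferentiableAt ℂ (fun ζ : ℂ => (ζ - u)⁻¹) ζ := fun ζ hζ =>
      (differentiableAt_id.sub_const u).inv (sub_ne_zero.2 (by rintro rfl; exact hζ.not_gt hru))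
    exact Complex.circleIntegral_eq_zero_of_differentiable_on_off_countable hr0.le countable_empty
      (fun ζ hζ => (hd ζ (by simpa using hζ)).continuousAt.continuousWithinAt)
      (fun ζ hζ => hd ζ (by simpa using (mem_ball.1 hζ.1).le))
  rw [hsplit R (hru.trans hu).le le_rfl hu.ne', hsplit r le_rfl (hru.trans hu).le hru.ne, hzero,
    circleIntegral.integral_sub_inv_of_mem_ball (by simpa using hu),
    circleIntegral_comp_div hR hs] at hann
  have hlast : (∮ ζ in C(0, R), u * w / ζ ^ 2 * (g (u * w / ζ) / (u * w / ζ - u))) =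
      -∮ ζ in C(0, R), g (u * w / ζ) * (w / (ζ * (ζ - w))) := by
    rw [← neg_one_mul, ← circleIntegral.integral_const_mul]
    refine circleIntegral.integral_congr hR.le fun ζ hζ => ?_
    have hζ0 : ζ ≠ 0 := by rintro rfl; simp at hζ; exact hR.ne hζ
    have hζw : ζ - w ≠ 0 := by
      rw [sub_ne_zero]; rintro rfl; simp at hζ; exact hw.ne hζ
    have h3 : u * w / ζ - u = -(u * (ζ - w)) / ζ := by field_simp; ring
    simp only [h3]
    field_simp
  rw [hlast] at hann
  linear_combination hann

/-- The conics `ζ * η = u z * w z` sweep out a neighbourhood of the origin. Cauchy's formula on the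
two boundary circles of each conic extends `f` across the origin. -/
theorem exists_extension_of_conic_fibration {E : Type*} [NormedAddCommGroup E] [NormedSpace ℂ E]
    [FiniteDimensional ℂ E] {u w : E →L[ℂ] ℂ} {A B : E} {Q : E → ℂ} {a : ℝ} {D : Set E} {f : E → ℂ}
    (huA : u A = 1) (huB : u B = 0) (hwA : w A = 0) (hwB : w B = 1)
    (hQ : Continuous Q) (hQ0 : Q 0 = 0)
    (hQinv : ∀ z ζ η, ζ * η = u z * w z → Q (z + (ζ - u z) • A + (η - w z) • B) = Q z)
    (ha : 0 < a) (hDo : IsOpen D)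
    (hD : ∀ z, ‖z‖ < 1 → 0 < a * ‖z‖ ^ 2 + (Q z).re → z ∈ D) (hf : DifferentiableOn ℂ f D) :
    ∃ V : Set E, IsOpen V ∧ 0 ∈ V ∧ ∃ F : E → ℂ, DifferentiableOn ℂ F V ∧
      ∀ z ∈ V, u z ≠ 0 → w z ≠ 0 → 0 < (Q z).re → F z = f z := by
  set P : E → ℂ → ℂ → E := fun z ζ η => z + (ζ - u z) • A + (η - w z) • B
  have huP : ∀ z ζ η, u (P z ζ η) = ζ := by intro z ζ η; simp [P, huA, huB]
  have hwP : ∀ z ζ η, w (P z ζ η) = η := by intro z ζ η; simp [P, hwA, hwB]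
  have hPself : ∀ z, P z (u z) (w z) = z := by intro z; simp [P]
  set R : ℝ := 1 / (2 * (‖A‖ + ‖B‖ + 1)) with hRdef
  have hR : 0 < R := by positivity
  have hRAB : R * (‖A‖ + ‖B‖) ≤ 1 / 2 := by
    rw [hRdef, div_mul_eq_mul_div, div_le_iff₀ (by positivity)]
    linarith
  set C : ℝ := ‖u‖ + ‖w‖ + 1 with hCdef
  have hC : 0 < C := by positivity
  set V : Set E := {z | ‖u z‖ < R ∧ ‖w z‖ < R ∧ ‖z - u z • A - w z • B‖ < 1 / 2 ∧
    ‖Q z‖ < a * (R / C) ^ 2}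
  have hVo : IsOpen V := by
    refine IsOpen.and ?_ (IsOpen.and ?_ (IsOpen.and ?_ ?_)) <;>
      exact isOpen_lt (by fun_prop) continuous_const
  have hV0 : (0 : E) ∈ V := by
    refine ⟨by simpa, by simpa, by simp, ?_⟩
    rw [hQ0, norm_zero]
    positivity
  have hPnorm : ∀ z ∈ V, ∀ ζ η, ‖ζ‖ ≤ R → ‖η‖ ≤ R → ‖P z ζ η‖ < 1 := by
    intro z hz ζ η hζ hη
    have h1 : P z ζ η = (z - u z • A - w z • B) + (ζ • A + η • B) := by
      simp only [P, sub_smul]; abel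
    have h2 : ‖ζ • A + η • B‖ ≤ R * (‖A‖ + ‖B‖) := by
      refine (norm_add_le _ _).trans ?_
      rw [norm_smul, norm_smul, mul_add]
      gcongr
    rw [h1]
    refine (norm_add_le _ _).trans_lt ?_
    linarith [hz.2.2.1]
  have hPD : ∀ z ∈ V, ∀ ζ η, ζ * η = u z * w z → ‖ζ‖ ≤ R → ‖η‖ ≤ R →
      (‖ζ‖ = R ∨ ‖η‖ = R ∨ 0 < (Q z).re) → P z ζ η ∈ D := by
    intro z hz ζ η hs hζ hη h
    refine hD _ (hPnorm z hz ζ η hζ hη) ?_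
    rw [hQinv z ζ η hs]
    have hbig : R ≤ C * ‖P z ζ η‖ → 0 < a * ‖P z ζ η‖ ^ 2 + (Q z).re := by
      intro h
      have h1 : R / C ≤ ‖P z ζ η‖ := by rwa [div_le_iff₀' hC]
      have h2 : a * (R / C) ^ 2 ≤ a * ‖P z ζ η‖ ^ 2 := by gcongr
      have h3 := (abs_le.1 (Complex.abs_re_le_norm (Q z))).1
      linarith [hz.2.2.2]
    rcases h with h | h | h
    · refine hbig ?_
      calc R = ‖u (P z ζ η)‖ := by rw [huP, h]
        _ ≤ ‖u‖ * ‖P z ζ η‖ := u.le_opNorm _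
        _ ≤ C * ‖P z ζ η‖ := by gcongr; rw [hCdef]; linarith [norm_nonneg w]
    · refine hbig ?_
      calc R = ‖w (P z ζ η)‖ := by rw [hwP, h]
        _ ≤ ‖w‖ * ‖P z ζ η‖ := w.le_opNorm _
        _ ≤ C * ‖P z ζ η‖ := by gcongr; rw [hCdef]; linarith [norm_nonneg u]
    · positivity
  have hsR : ∀ z ∈ V, ∀ ζ : ℂ, ‖ζ‖ = R → ‖u z * w z / ζ‖ ≤ R := by
    intro z hz ζ hζ
    rw [norm_div, norm_mul, hζ, div_le_iff₀ hR]
    exact mul_le_mul hz.1.le hz.2.1.le (norm_nonneg _) hR.le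
  have hne0 : ∀ ζ ∈ sphere (0 : ℂ) R, ζ ≠ 0 := fun ζ hζ => ne_of_mem_sphere hζ hR.ne'
  have hneR : ∀ {x : ℂ}, ‖x‖ < R → ∀ ζ ∈ sphere (0 : ℂ) R, ζ - x ≠ 0 := by
    intro x hx ζ hζ h
    rw [sub_eq_zero] at h
    rw [mem_sphere_zero_iff_norm, h] at hζ
    exact hx.ne hζ
  have hPD1 : ∀ z ∈ V, ∀ ζ ∈ sphere (0 : ℂ) R, P z ζ (u z * w z / ζ) ∈ D := fun z hz ζ hζ =>
    hPD z hz _ _ (mul_div_cancel₀ _ (hne0 ζ hζ)) (mem_sphere_zero_iff_norm.1 hζ).le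
      (hsR z hz ζ (mem_sphere_zero_iff_norm.1 hζ)) (Or.inl (mem_sphere_zero_iff_norm.1 hζ))
  have hPD2 : ∀ z ∈ V, ∀ ζ ∈ sphere (0 : ℂ) R, P z (u z * w z / ζ) ζ ∈ D := fun z hz ζ hζ =>
    hPD z hz _ _ (div_mul_cancel₀ _ (hne0 ζ hζ)) (hsR z hz ζ (mem_sphere_zero_iff_norm.1 hζ))
      (mem_sphere_zero_iff_norm.1 hζ).le (Or.inr (Or.inl (mem_sphere_zero_iff_norm.1 hζ)))
  have hcs : ContinuousOn (fun p : E × ℂ => u p.1 * w p.1 / p.2) (V ×ˢ sphere 0 R) :=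
    ContinuousOn.div (by fun_prop) (by fun_prop) fun p hp => hne0 _ hp.2
  have hF1 : DifferentiableOn ℂ
      (fun z => ∮ ζ in C(0, R), f (P z ζ (u z * w z / ζ)) / (ζ - u z)) V := by
    refine differentiableOn_circleIntegral_param hVo hR.le
      (H := fun z ζ => f (P z ζ (u z * w z / ζ)) / (ζ - u z)) ?_ fun ζ hζ => ?_
    · refine ContinuousOn.div (hf.continuousOn.comp (t := D) ?_ fun p hp => hPD1 p.1 hp.1 p.2 hp.2)
        (by fun_prop) fun p hp => hneR hp.1.1 _ hp.2
      exact ContinuousOn.add (by fun_prop) ((hcs.sub (by fun_prop)).smul (by fun_prop))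
    · have hP : DifferentiableOn ℂ (fun z => P z ζ (u z * w z / ζ)) V := by
        simp only [P, div_eq_mul_inv]
        fun_prop
      have hk : DifferentiableOn ℂ (fun z => (ζ - u z)⁻¹) V :=
        DifferentiableOn.fun_inv (by fun_prop) fun z hz => hneR hz.1 _ hζ
      simp only [div_eq_mul_inv] at hP ⊢
      exact (hf.comp hP fun z hz => hPD1 z hz ζ hζ).mul hk
  have hF2 : DifferentiableOn ℂ (fun z => ∮ ζ in C(0, R),
      f (P z (u z * w z / ζ) ζ) * (w z / (ζ * (ζ - w z)))) V := by
    refine differentiableOn_circleIntegral_param hVo hR.le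
      (H := fun z ζ => f (P z (u z * w z / ζ) ζ) * (w z / (ζ * (ζ - w z)))) ?_ fun ζ hζ => ?_
    · refine ContinuousOn.mul (hf.continuousOn.comp (t := D) ?_ fun p hp => hPD2 p.1 hp.1 p.2 hp.2)
        (ContinuousOn.div (by fun_prop) (by fun_prop) fun p hp =>
          mul_ne_zero (hne0 _ hp.2) (hneR hp.1.2.1 _ hp.2))
      exact ContinuousOn.add (ContinuousOn.add (by fun_prop)
        ((hcs.sub (by fun_prop)).smul (by fun_prop))) (by fun_prop)
    · have hP : DifferentiableOn ℂ (fun z => P z (u z * w z / ζ) ζ) V := by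
        simp only [P, div_eq_mul_inv]
        fun_prop
      have hk : DifferentiableOn ℂ (fun z => (ζ * (ζ - w z))⁻¹) V :=
        DifferentiableOn.fun_inv (by fun_prop) fun z hz =>
          mul_ne_zero (hne0 _ hζ) (hneR hz.2.1 _ hζ)
      have hkw : DifferentiableOn ℂ (fun z => w z * (ζ * (ζ - w z))⁻¹) V :=
        w.differentiable.differentiableOn.mul hk
      exact (hf.comp hP fun z hz => hPD2 z hz ζ hζ).mul hkw
  refine ⟨V, hVo, hV0, _, (hF1.add hF2).const_mul (2 * π * Complex.I)⁻¹, ?_⟩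
  intro z hz hu hw hQz
  have hlaurent := laurent_cauchy_formula (g := fun ζ => f (P z ζ (u z * w z / ζ))) hu hw
    hz.1 hz.2.1 fun ζ h1 h2 => by
      have hζ : 0 < ‖ζ‖ := 
        (div_pos (norm_pos_iff.2 (mul_ne_zero hu hw)) hR).trans_le h1
      have hζ0 : ζ ≠ 0 := norm_pos_iff.1 hζ
      have hmem : P z ζ (u z * w z / ζ) ∈ D := by
        refine hPD z hz _ _ (mul_div_cancel₀ _ hζ0) h2 ?_ (Or.inr (Or.inr hQz))
        rw [norm_div, div_le_iff₀ hζ]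
        rwa [div_le_iff₀ hR, mul_comm ‖ζ‖] at h1
      refine DifferentiableAt.comp ζ (hf.differentiableAt (hDo.mem_nhds hmem)) ?_
      have hd : DifferentiableAt ℂ (fun ζ => u z * w z / ζ) ζ :=
        (differentiableAt_const _).div differentiableAt_id hζ0
      simp only [P]
      fun_prop
  have hsecond : (∮ ζ in C(0, R), f (P z (u z * w z / ζ) ζ) * (w z / (ζ * (ζ - w z)))) =
      ∮ ζ in C(0, R), f (P z (u z * w z / ζ) (u z * w z / (u z * w z / ζ))) *
        (w z / (ζ * (ζ - w z))) := by
    refine circleIntegral.integral_congr hR.le fun ζ hζ => ?_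
    have := hne0 ζ hζ
    simp only [div_div_cancel₀ (mul_ne_zero hu hw)]
  simp only [mul_div_cancel_left₀ _ hu, hPself] at hlaurent
  simp only [Pi.add_apply, hsecond]
  rw [hlaurent, inv_mul_cancel_left₀ Complex.two_pi_I_ne_zero]

theorem exists_extension_of_quadratic_superlevel {n : ℕ} {b c : Fin n → ℝ} {i₀ i₁ : Fin n}
    (hi : i₀ ≠ i₁) (hb : ∀ j, 0 < b j) (hcb : ∀ j, c j < b j)
    {f : EuclideanSpace ℂ (Fin n) → ℂ} {D : Set (EuclideanSpace ℂ (Fin n))}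
    (hD : D = {z | ‖z‖ < 1 ∧ 0 < ∑ j, (b j * (z j).re ^ 2 - c j * (z j).im ^ 2)})
    (hf : DifferentiableOn ℂ f D) :
    ∃ U : Set (EuclideanSpace ℂ (Fin n)), IsOpen U ∧ 0 ∈ U ∧
      ∃ F : EuclideanSpace ℂ (Fin n) → ℂ, DifferentiableOn ℂ F U ∧ EqOn F f (U ∩ D) := by
  have hcoord : ∀ j, Continuous fun z : EuclideanSpace ℂ (Fin n) => z j := fun j => by fun_prop
  have hDo : IsOpen D := by
    rw [hD]
    refine IsOpen.and (isOpen_lt continuous_norm continuous_const)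
      (isOpen_lt continuous_const (continuous_finsetSum _ fun j _ => ?_))
    have := hcoord j
    fun_prop
  set β : Fin n → ℝ := fun j => (b j + max (c j) 0) / 2
  have hβ0 : ∀ j, 0 < β j := fun j => by
    have := hb j
    have := le_max_right (c j) 0
    simp only [β]
    linarith
  obtain ⟨a, ha, hα⟩ : ∃ a > 0, ∀ j, a ≤ (b j - max (c j) 0) / 2 := by
    obtain ⟨m, -, hm⟩ := Finset.exists_min_image Finset.univ
      (fun j => (b j - max (c j) 0) / 2) ⟨i₀, Finset.mem_univ _⟩
    exact ⟨_, by have := max_lt (hcb m) (hb m); linarith, fun j => hm j (Finset.mem_univ j)⟩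
  set Q : EuclideanSpace ℂ (Fin n) → ℂ := fun z => ∑ j, (β j : ℂ) * z j ^ 2
  have hQc : Continuous Q := continuous_finsetSum _ fun j _ => by
    have := hcoord j
    fun_prop
  have hQre : ∀ z, (Q z).re = ∑ j, β j * ((z j).re ^ 2 - (z j).im ^ 2) := by
    intro z
    simp only [Q, Complex.re_sum, Complex.re_ofReal_mul]
    refine Finset.sum_congr rfl fun j _ => ?_
    rw [sq (z j), Complex.mul_re, sq, sq]
  have hDmem : ∀ z : EuclideanSpace ℂ (Fin n), ‖z‖ < 1 → 0 < a * ‖z‖ ^ 2 + (Q z).re → z ∈ D := by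
    intro z hz h
    rw [hD]
    refine ⟨hz, h.trans_le ?_⟩
    rw [hQre, EuclideanSpace.norm_sq_eq, Finset.mul_sum, ← Finset.sum_add_distrib]
    refine Finset.sum_le_sum fun j _ => ?_
    rw [Complex.sq_norm, Complex.normSq_apply]
    simp only [β]
    nlinarith [hα j, mul_le_mul_of_nonneg_right (hα j) (sq_nonneg (z j).re),
      mul_le_mul_of_nonneg_right (hα j) (sq_nonneg (z j).im),
      mul_le_mul_of_nonneg_right (le_max_left (c j) 0) (sq_nonneg (z j).im)]
  set r₀ : ℝ := √(β i₀)
  set r₁ : ℝ := √(β i₁)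
  have hr₀0 : (r₀ : ℂ) ≠ 0 := by exact_mod_cast (Real.sqrt_pos.2 (hβ0 i₀)).ne'
  have hr₁0 : (r₁ : ℂ) ≠ 0 := by exact_mod_cast (Real.sqrt_pos.2 (hβ0 i₁)).ne'
  have hr₀β : (β i₀ : ℂ) = r₀ ^ 2 := by exact_mod_cast (Real.sq_sqrt (hβ0 i₀).le).symm
  have hr₁β : (β i₁ : ℂ) = r₁ ^ 2 := by exact_mod_cast (Real.sq_sqrt (hβ0 i₁).le).symm
  set π₀ : EuclideanSpace ℂ (Fin n) →L[ℂ] ℂ := EuclideanSpace.proj i₀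
  set π₁ : EuclideanSpace ℂ (Fin n) →L[ℂ] ℂ := EuclideanSpace.proj i₁
  set u : EuclideanSpace ℂ (Fin n) →L[ℂ] ℂ := (r₀ : ℂ) • π₀ + (Complex.I * r₁) • π₁
  set w : EuclideanSpace ℂ (Fin n) →L[ℂ] ℂ := (r₀ : ℂ) • π₀ - (Complex.I * r₁) • π₁
  have hu : ∀ z, u z = r₀ * z i₀ + Complex.I * r₁ * z i₁ := fun z => rfl
  have hw : ∀ z, w z = r₀ * z i₀ - Complex.I * r₁ * z i₁ := fun z => rfl
  set A : EuclideanSpace ℂ (Fin n) := EuclideanSpace.single i₀ (1 / (2 * r₀ : ℂ)) +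
    EuclideanSpace.single i₁ (1 / (2 * Complex.I * r₁))
  set B : EuclideanSpace ℂ (Fin n) := EuclideanSpace.single i₀ (1 / (2 * r₀ : ℂ)) -
    EuclideanSpace.single i₁ (1 / (2 * Complex.I * r₁))
  have hA0 : A i₀ = 1 / (2 * r₀) := by simp [A, hi]
  have hA1 : A i₁ = 1 / (2 * Complex.I * r₁) := by simp [A, hi.symm]
  have hB0 : B i₀ = 1 / (2 * r₀) := by simp [B, hi]
  have hB1 : B i₁ = -(1 / (2 * Complex.I * r₁)) := by simp [B, hi.symm]
  have hAj : ∀ j, j ≠ i₀ ∧ j ≠ i₁ → A j = 0 := fun j hj => by simp [A, hj.1, hj.2]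
  have hBj : ∀ j, j ≠ i₀ ∧ j ≠ i₁ → B j = 0 := fun j hj => by simp [B, hj.1, hj.2]
  have hQinv : ∀ z ζ η, ζ * η = u z * w z →
      Q (z + (ζ - u z) • A + (η - w z) • B) = Q z := by
    intro z ζ η h
    rw [← sub_eq_zero]
    simp only [Q]
    rw [← Finset.sum_sub_distrib, Fintype.sum_eq_add i₀ i₁ hi]
    · simp only [PiLp.add_apply, PiLp.smul_apply, smul_eq_mul, hA0, hA1, hB0, hB1, hr₀β, hr₁β]
      have e0 : z i₀ + (ζ - u z) * (1 / (2 * r₀)) + (η - w z) * (1 / (2 * r₀)) =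
          (ζ + η) / (2 * r₀) := by
        rw [hu, hw]; field_simp; ring
      have e1 : z i₁ + (ζ - u z) * (1 / (2 * Complex.I * r₁)) +
          (η - w z) * -(1 / (2 * Complex.I * r₁)) = (ζ - η) / (2 * Complex.I * r₁) := by
        rw [hu, hw]; field_simp; ring
      have s0 : (r₀ : ℂ) ^ 2 * ((ζ + η) / (2 * r₀)) ^ 2 = (ζ + η) ^ 2 / 4 := by
        field_simp; norm_num
      have s1 : (r₁ : ℂ) ^ 2 * ((ζ - η) / (2 * Complex.I * r₁)) ^ 2 = -(ζ - η) ^ 2 / 4 := by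
        rw [div_pow, mul_pow, mul_pow, Complex.I_sq]; field_simp; norm_num
      rw [e0, e1, s0, s1]
      rw [hu, hw] at h
      linear_combination h - (r₁ : ℂ) ^ 2 * z i₁ ^ 2 * Complex.I_sq
    · intro j hj
      simp [hAj j hj, hBj j hj]
  obtain ⟨V, hVo, hV0, F, hF, hFf⟩ := exists_extension_of_conic_fibration (u := u) (w := w)
    (A := A) (B := B) (Q := Q) (f := f)
    (by rw [hu, hA0, hA1]; field_simp; norm_num) (by rw [hu, hB0, hB1]; field_simp; norm_num)
    (by rw [hw, hA0, hA1]; field_simp; norm_num) (by rw [hw, hB0, hB1]; field_simp; norm_num)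
    hQc (by simp [Q]) hQinv ha hDo hDmem hf
  obtain ⟨r, hr, hrV⟩ := Metric.isOpen_iff.1 hVo 0 hV0
  have hreal : ∀ z ∈ ball 0 r ∩ D, (z i₀).re ≠ 0 → F z = f z := by
    intro z hz hz0
    set x : EuclideanSpace ℂ (Fin n) := WithLp.toLp 2 fun j => ((z j).re : ℂ)
    set y : EuclideanSpace ℂ (Fin n) := WithLp.toLp 2 fun j => ((z j).im : ℂ) * Complex.I
    set γ : ℂ → EuclideanSpace ℂ (Fin n) := fun t => x + t • y
    have hγd : Differentiable ℂ γ := by fun_prop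
    have hγre : ∀ (t : ℝ) j, (γ t j).re = (z j).re := by intro t j; simp [γ, x, y]
    have hγim : ∀ (t : ℝ) j, (γ t j).im = t * (z j).im := by intro t j; simp [γ, x, y]
    have hγ1 : γ 1 = z := by ext j; simp [γ, x, y, Complex.re_add_im]
    have hbx : 0 < ∑ j, b j * (z j).re ^ 2 :=
      Finset.sum_pos' (fun j _ => mul_nonneg (hb j).le (sq_nonneg _))
        ⟨i₀, Finset.mem_univ _, mul_pos (hb i₀) (by positivity)⟩
    have hseg : ∀ t ∈ Icc (0 : ℝ) 1, γ t ∈ ball 0 r ∩ D := by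
      intro t ht
      have ht2 : t ^ 2 ≤ 1 := pow_le_one₀ ht.1 ht.2
      have hnorm : ‖γ t‖ ≤ ‖z‖ := by
        refine le_of_sq_le_sq ?_ (norm_nonneg z)
        rw [EuclideanSpace.norm_sq_eq, EuclideanSpace.norm_sq_eq]
        refine Finset.sum_le_sum fun j _ => ?_
        rw [Complex.sq_norm, Complex.normSq_apply, Complex.sq_norm, Complex.normSq_apply,
          hγre, hγim]
        nlinarith [mul_le_mul_of_nonneg_right ht2 (sq_nonneg (z j).im)]
      have hzD := hz.2
      rw [hD] at hzD ⊢
      refine ⟨by simpa using hnorm.trans_lt (by simpa using hz.1), hnorm.trans_lt hzD.1, ?_⟩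
      have hsum : ∑ j, (b j * (γ t j).re ^ 2 - c j * (γ t j).im ^ 2) =
          (1 - t ^ 2) * ∑ j, b j * (z j).re ^ 2 +
            t ^ 2 * ∑ j, (b j * (z j).re ^ 2 - c j * (z j).im ^ 2) := by
        rw [Finset.mul_sum, Finset.mul_sum, ← Finset.sum_add_distrib]
        refine Finset.sum_congr rfl fun j _ => ?_
        rw [hγre, hγim]
        ring
      rw [hsum]
      rcases ht2.eq_or_lt with h | h
      · simpa [h] using hzD.2
      · have := hzD.2
        have : 0 < 1 - t ^ 2 := by linarith
        positivity
    set S : Set ℂ := (fun t : ℝ => (t : ℂ)) '' Icc 0 1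
    have hSpre : IsPreconnected S :=
      isPreconnected_Icc.image _ Complex.continuous_ofReal.continuousOn
    have hΩ : IsOpen (γ ⁻¹' (ball 0 r ∩ D)) :=
      (isOpen_ball.inter hDo).preimage hγd.continuous
    have hSΩ : S ⊆ γ ⁻¹' (ball 0 r ∩ D) := by
      rintro _ ⟨t, ht, rfl⟩
      exact hseg t ht
    have hFa : AnalyticOnNhd ℂ (F ∘ γ) S :=
      (((hF.mono hrV).comp hγd.differentiableOn fun t ht => ht.1).analyticOnNhd hΩ).mono hSΩ
    have hfa : AnalyticOnNhd ℂ (f ∘ γ) S :=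
      ((hf.comp hγd.differentiableOn fun t ht => ht.2).analyticOnNhd hΩ).mono hSΩ
    have hγ0 : γ 0 = x := by simp [γ]
    have hx0 : (x i₀).re = (z i₀).re := rfl
    have hux : u x ≠ 0 := fun h => by
      have := congrArg Complex.re h
      rw [hu] at this
      have hr : r₀ ≠ 0 := by exact_mod_cast hr₀0
      simp [x, hz0, hr] at this
    have hwx : w x ≠ 0 := fun h => by
      have := congrArg Complex.re h
      rw [hw] at this
      have hr : r₀ ≠ 0 := by exact_mod_cast hr₀0
      simp [x, hz0, hr] at this
    have hQx : 0 < (Q x).re := by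
      rw [hQre]
      refine Finset.sum_pos' (fun j _ => ?_) ⟨i₀, Finset.mem_univ _, ?_⟩
      · simpa [x] using mul_nonneg (hβ0 j).le (sq_nonneg (z j).re)
      · have hpos : 0 < β i₀ * (z i₀).re ^ 2 := mul_pos (hβ0 i₀) (by positivity)
        simpa [x] using hpos
    have hev : F ∘ γ =ᶠ[𝓝 0] f ∘ γ := by
      have hxV : x ∈ V := by
        have := hseg 0 ⟨le_rfl, zero_le_one⟩
        rw [Complex.ofReal_zero, hγ0] at this
        exact hrV this.1
      have h1 : ∀ᶠ p in 𝓝 x, p ∈ V ∧ u p ≠ 0 ∧ w p ≠ 0 ∧ 0 < (Q p).re :=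
        (hVo.eventually_mem hxV).and <| (u.continuous.continuousAt.eventually_ne hux).and <|
          (w.continuous.continuousAt.eventually_ne hwx).and <|
            continuousAt_const.eventually_lt (Complex.continuous_re.comp hQc).continuousAt hQx
      have h2 : Tendsto γ (𝓝 0) (𝓝 x) := hγ0 ▸ hγd.continuous.tendsto 0
      filter_upwards [h2.eventually h1] with t ht
      exact hFf _ ht.1 ht.2.1 ht.2.2.1 ht.2.2.2
    have := hFa.eqOn_of_preconnected_of_eventuallyEq hfa hSpre
      (show (0 : ℂ) ∈ S from ⟨0, by simp, by simp⟩) hev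
      (show (1 : ℂ) ∈ S from ⟨1, by simp, by simp⟩)
    simpa [hγ1] using this
  refine ⟨ball 0 r, isOpen_ball, mem_ball_self hr, F, hF.mono hrV, fun z hz => ?_⟩
  by_cases hz0 : (z i₀).re = 0
  · set g : ℝ → EuclideanSpace ℂ (Fin n) :=
      fun t => z + (t : ℂ) • EuclideanSpace.single i₀ (1 : ℂ)
    have hgc : Continuous g := by fun_prop
    have hg0 : g 0 = z := by simp [g]
    have hgt : Tendsto g (𝓝[≠] 0) (𝓝 z) :=
      (hg0 ▸ hgc.tendsto 0 : Tendsto g (𝓝 0) (𝓝 z)).mono_left nhdsWithin_le_nhds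
    have hFz := (hF.continuousOn.continuousAt (hVo.mem_nhds (hrV hz.1))).tendsto.comp hgt
    have hfz := (hf.continuousOn.continuousAt (hDo.mem_nhds hz.2)).tendsto.comp hgt
    refine tendsto_nhds_unique_of_eventuallyEq hFz hfz ?_
    filter_upwards [hgt.eventually ((isOpen_ball.inter hDo).mem_nhds hz), self_mem_nhdsWithin]
      with t ht ht0
    exact hreal _ ht (by simpa [g, hz0] using ht0)
  · exact hreal z hz hz0

theorem sum_fin_eq_sum_castLE_add {M : Type*} [AddCommMonoid M] {n q : ℕ} (hq : q ≤ n)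
    (g : Fin n → M) :
    ∑ j, g j = ∑ j : Fin q, g (Fin.castLE hq j) +
      ∑ j ∈ Finset.univ.filter (fun j : Fin n => q ≤ (j : ℕ)), g j := by
  obtain ⟨m, rfl⟩ := Nat.exists_eq_add_of_le hq
  rw [Fin.sum_univ_add, Finset.sum_filter, Fin.sum_univ_add]
  have hlt : ∀ j : Fin q, ¬ q ≤ (j : ℕ) := fun j => j.isLt.not_ge
  simp [hlt]
  rfl

end


/-- Lemma 2.2 of the paper: the envelope of holomorphy of the quadratic model
domain `D⁺ = { z ∈ ℂⁿ : ‖z‖ < 1, ρ₁(z) > 0 }`, where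
`ρ₁(z) = Σ_{j=1}^q (b_j (Re z_j)² − c_j (Im z_j)²) + δ Σ_{j=q+1}^n |z_j|²`,
contains the origin. -/
theorem stmt_0 (n q : ℕ) (hn : 2 ≤ n) (hq : q ≤ n)
    (b c : Fin q → ℝ) (hc : ∀ j, 0 ≤ c j) (hbc : ∀ j, c j < b j)
    (δ : ℝ) (hδ : 0 < δ)
    (ρ₁ : EuclideanSpace ℂ (Fin n) → ℝ)
    (hρ : ∀ z : EuclideanSpace ℂ (Fin n), ρ₁ z =
      (∑ j : Fin q, (b j * ((z (Fin.castLE hq j)).re) ^ 2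
                    - c j * ((z (Fin.castLE hq j)).im) ^ 2))
      + δ * ∑ j ∈ Finset.univ.filter (fun j : Fin n => q ≤ (j : ℕ)), ‖z j‖ ^ 2)
    (D : Set (EuclideanSpace ℂ (Fin n)))
    (hD : D = {z | ‖z‖ < 1 ∧ 0 < ρ₁ z}) :
    ∀ f : EuclideanSpace ℂ (Fin n) → ℂ, DifferentiableOn ℂ f D →
      ∃ U : Set (EuclideanSpace ℂ (Fin n)), IsOpen U ∧
        (0 : EuclideanSpace ℂ (Fin n)) ∈ U ∧
        ∃ F : EuclideanSpace ℂ (Fin n) → ℂ, DifferentiableOn ℂ F U ∧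
          Set.EqOn F f (U ∩ D) := by
  intro f hf
  set b' : Fin n → ℝ := fun j => if h : (j : ℕ) < q then b ⟨j, h⟩ else δ
  set c' : Fin n → ℝ := fun j => if h : (j : ℕ) < q then c ⟨j, h⟩ else -δ
  have hρ' : ∀ z : EuclideanSpace ℂ (Fin n),
      ρ₁ z = ∑ j, (b' j * (z j).re ^ 2 - c' j * (z j).im ^ 2) := by
    intro z
    rw [hρ, sum_fin_eq_sum_castLE_add hq, Finset.mul_sum]
    congr 1
    · refine Finset.sum_congr rfl fun j _ => ?_
      simp [b', c']
    · refine Finset.sum_congr rfl fun j hj => ?_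
      have hj' : ¬ (j : ℕ) < q := by simpa using hj
      simp only [b', c', hj', dite_false]
      rw [Complex.sq_norm, Complex.normSq_apply]
      ring
  refine exists_extension_of_quadratic_superlevel (b := b') (c := c')
    (i₀ := ⟨0, by omega⟩) (i₁ := ⟨1, by omega⟩) (by simp) (fun j => ?_) (fun j => ?_)
    (by simpa only [hρ'] using hD) hf
  · by_cases h : (j : ℕ) < q
    · simpa [b', h] using (hc _).trans_lt (hbc ⟨j, h⟩)
    · simpa [b', h] using hδ
  · by_cases h : (j : ℕ) < q
    · simpa [b', c', h] using hbc ⟨j, h⟩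
    · simp only [b', c', h, dite_false]
      linarith
end

section
/- Let n ≥ 2 and let 0 < δ₀ < 1. Set D₁⁺ = { z ∈ ℂⁿ : ‖z‖ < 1 and Σ_{j=1}^n (Re z_j)² > δ₀ · Σ_{j=1}^n (Im z_j)² }. Then for every function f : ℂⁿ → ℂ holomorphic on D₁⁺ there exist an open neighborhood U of the origin and a function F holomorphic on U such that F = f on U ∩ D₁⁺. -/
open Metric Filter Topology Complex in
theorem differentiableAt_circleIntegral_of_eventually {E : Type*} [NormedAddCommGroup E]
    [NormedSpace ℂ E] [FiniteDimensional ℂ E] {G : E × ℂ → ℂ} {x₀ : E} {c : ℂ} {r : ℝ}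
    (hr : 0 ≤ r) (hG : ∀ t ∈ sphere c r, ∀ᶠ p in 𝓝 (x₀, t), DifferentiableAt ℂ G p) :
    DifferentiableAt ℂ (fun x => ∮ t in C(c, r), G (x, t)) x₀ := by
  obtain ⟨M, hM⟩ : ∃ M, ∀ t ∈ sphere c r, ‖G (x₀, t)‖ < M := by
    have hc : ContinuousOn (fun t => ‖G (x₀, t)‖) (sphere c r) := fun t ht => by
      have h1 : ContinuousAt G (x₀, t) := (hG t ht).self_of_nhds.continuousAt
      have h2 : ContinuousAt (fun t : ℂ => (x₀, t)) t := by fun_prop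
      exact (ContinuousAt.comp (f := fun t : ℂ => (x₀, t)) h1 h2).norm.continuousWithinAt
    obtain ⟨M, hM⟩ := (isCompact_sphere c r).bddAbove_image hc
    exact ⟨M + 1, fun t ht => (hM (Set.mem_image_of_mem _ ht)).trans_lt (lt_add_one M)⟩
  let Ω : Set (E × ℂ) := {p | ∀ᶠ q in 𝓝 p, DifferentiableAt ℂ G q ∧ ‖G q‖ < M}
  have hΩ : IsOpen Ω := isOpen_setOfPred_eventually_nhds
  have hsub : ({x₀} : Set E) ×ˢ sphere c r ⊆ Ω := by
    rintro ⟨x, t⟩ ⟨hx, ht⟩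
    obtain rfl : x = x₀ := hx
    exact (hG t ht).and ((hG t ht).self_of_nhds.continuousAt.norm.eventually_lt_const (hM t ht))
  obtain ⟨u, v, hu, -, hxu, hv, huv⟩ :=
    generalized_tube_lemma isCompact_singleton (isCompact_sphere c r) hΩ hsub
  obtain ⟨ε, hε, hεu⟩ := Metric.isOpen_iff.1 hu x₀ (hxu rfl)
  have key : ∀ x ∈ ball x₀ ε, ∀ t ∈ sphere c r, DifferentiableAt ℂ G (x, t) ∧ ‖G (x, t)‖ < M :=
    fun x hx t ht => (huv ⟨hεu hx, hv ht⟩ : (x, t) ∈ Ω).self_of_nhds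
  have hslice : ∀ x ∈ ball x₀ ε, ∀ t ∈ sphere c r,
      HasFDerivAt (fun x => G (x, t)) ((fderiv ℂ G (x, t)).comp (.inl ℂ E ℂ)) x :=
    fun x hx t ht => (key x hx t ht).1.hasFDerivAt.comp x (hasFDerivAt_prodMk_left x t)
  have hmem : ∀ θ, circleMap c r θ ∈ sphere c r := circleMap_mem_sphere c hr
  have hcont : ∀ x ∈ ball x₀ ε,
      Continuous fun θ => deriv (circleMap c r) θ • G (x, circleMap c r θ) := by
    intro x hx
    simp only [deriv_circleMap]
    refine ((continuous_circleMap 0 r).mul continuous_const).smul (continuous_iff_continuousAt.2 fun θ => ?_)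
    have h1 := (key x hx _ (hmem θ)).1.continuousAt
    have h2 : ContinuousAt (fun θ : ℝ => (x, circleMap c r θ)) θ := by fun_prop
    exact ContinuousAt.comp (f := fun θ : ℝ => (x, circleMap c r θ)) h1 h2
  have hx₀ : x₀ ∈ ball x₀ ε := mem_ball_self hε
  refine (intervalIntegral.hasFDerivAt_integral_of_dominated_of_fderiv_le
    (F' := fun x θ => deriv (circleMap c r) θ •
      (fderiv ℂ G (x, circleMap c r θ)).comp (.inl ℂ E ℂ))
    (bound := fun _ => r * (2 * M / (ε / 2)))
    (ball_mem_nhds x₀ (half_pos hε)) ?_ ?_ ?_ ?_ ?_ ?_).differentiableAt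
  · filter_upwards [ball_mem_nhds x₀ hε] with x hx
    exact (hcont x hx).aestronglyMeasurable
  · exact (hcont x₀ hx₀).intervalIntegrable _ _
  · borelize (E × ℂ)
    borelize (E × ℂ →L[ℂ] ℂ)
    have h1 : Measurable fun θ => fderiv ℂ G (x₀, circleMap c r θ) :=
      (measurable_fderiv ℂ G).comp (by fun_prop : Continuous _).measurable
    have h2 : Continuous fun L : E × ℂ →L[ℂ] ℂ => L.comp (.inl ℂ E ℂ) := by fun_prop
    have h3 : Continuous (deriv (circleMap c r)) := by
      simp only [funext (deriv_circleMap c r)]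
      fun_prop
    exact h3.aestronglyMeasurable.smul
      (h2.comp_aestronglyMeasurable h1.aestronglyMeasurable)
  · refine Eventually.of_forall fun θ _ x hx => ?_
    rw [norm_smul, deriv_circleMap, norm_mul, norm_circleMap_zero, norm_I, mul_one, abs_of_nonneg hr]
    gcongr
    have hb : ball x (ε / 2) ⊆ ball x₀ ε := ball_subset_ball' (by
      rw [mem_ball] at hx; linarith)
    rw [← (hslice x (hb (mem_ball_self (half_pos hε))) _ (hmem θ)).fderiv]
    refine norm_fderiv_le_div_of_mapsTo_ball
      (fun y hy => (hslice y (hb hy) _ (hmem θ)).differentiableAt.differentiableWithinAt)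
      (fun y hy => ?_) (half_pos hε)
    have h1 := (key y (hb hy) _ (hmem θ)).2
    have h2 := (key x (hb (mem_ball_self (half_pos hε))) _ (hmem θ)).2
    rw [mem_closedBall, dist_eq_norm]
    exact (norm_sub_le _ _).trans (by linarith)
  · exact intervalIntegrable_const
  · exact Eventually.of_forall fun θ _ x hx =>
      (hslice x (ball_subset_ball (half_le_self hε.le) hx) _ (hmem θ)).const_smul
        (deriv (circleMap c r) θ)

open Complex Real in
theorem circleIntegral_div_eq (h : ℂ → ℂ) {a : ℂ} (ha : a ≠ 0) {R : ℝ} (hR : 0 < R) :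
    (∮ z in C(0, ‖a‖ / R), h z) = ∮ t in C(0, R), h (a / t) * (a / t ^ 2) := by
  let g : ℝ → ℂ := fun θ => deriv (circleMap 0 (‖a‖ / R)) θ • h (circleMap 0 (‖a‖ / R) θ)
  have hg : Function.Periodic g (2 * π) := fun θ => by
    simp only [g, deriv_circleMap, periodic_circleMap 0 _ θ]
  have h1 := hg.intervalIntegral_add_eq 0 (arg a - 2 * π)
  have h2 := intervalIntegral.integral_comp_sub_left (a := 0) (b := 2 * π) g (arg a)
  simp only [zero_add, sub_add_cancel, sub_zero] at h1 h2
  change ∫ θ in 0..2 * π, g θ = _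
  rw [h1, ← h2]
  refine intervalIntegral.integral_congr fun θ _ => ?_
  have e : circleMap 0 (‖a‖ / R) (arg a - θ) = a / circleMap 0 R θ := by
    simp only [circleMap, zero_add]
    conv_rhs => rw [← norm_mul_exp_arg_mul_I a]
    rw [ofReal_sub, sub_mul, Complex.exp_sub, ofReal_div, mul_div_mul_comm]
  have hne : circleMap 0 R θ ≠ 0 := circleMap_ne_center hR.ne'
  simp only [g, deriv_circleMap, e, smul_eq_mul]
  field_simp

open Metric Complex in
/-- Cauchy's formula on the annulus `‖a‖ / R ≤ ‖z‖ ≤ R`, with the integral over the inner circle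
moved to the outer one by `t ↦ a / t`. -/
theorem two_pi_I_mul_eq_circleIntegral_add {g : ℂ → ℂ} {a w v : ℂ} {R : ℝ} (ha : a ≠ 0)
    (hwv : w * v = a) (hw : ‖w‖ < R) (hv : ‖v‖ < R)
    (hg : ∀ z, ‖a‖ / R ≤ ‖z‖ → ‖z‖ ≤ R → DifferentiableAt ℂ g z) :
    2 * Real.pi * I * g w = (∮ t in C(0, R), g t / (t - w)) +
      ∮ t in C(0, R), g (a / t) * (v / (t * (t - v))) := by
  have hw0 : w ≠ 0 := by rintro rfl; simp_all
  have hv0 : v ≠ 0 := by rintro rfl; simp_all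
  have hR : 0 < R := (norm_nonneg w).trans_lt hw
  have hρ : 0 < ‖a‖ / R := by positivity
  have hρw : ‖a‖ / R < ‖w‖ := by
    rw [div_lt_iff₀ hR, ← hwv, norm_mul]
    exact mul_lt_mul_of_pos_left hv (norm_pos_iff.2 hw0)
  have hρR := hρw.trans hw
  have hgw := hg w hρw.le hw.le
  have h1 : (∮ t in C(0, R), dslope g w t) = ∮ t in C(0, ‖a‖ / R), dslope g w t := by
    refine circleIntegral_eq_of_differentiable_on_annulus_off_countable hρ hρR.le
      (Set.countable_singleton w) (fun z hz => ?_) (fun z hz => ?_)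
    · simp only [Set.mem_sdiff, mem_closedBall_zero_iff, mem_ball_zero_iff, not_lt] at hz
      obtain rfl | hne := eq_or_ne z w
      · exact (continuousAt_dslope_same.2 hgw).continuousWithinAt
      · exact ((continuousAt_dslope_of_ne hne).2
          (hg z hz.2 hz.1).continuousAt).continuousWithinAt
    · simp only [Set.mem_sdiff, mem_closedBall_zero_iff, mem_ball_zero_iff, not_le,
        Set.mem_singleton_iff] at hz
      exact (differentiableAt_dslope_of_ne hz.2).2 (hg z hz.1.2.le hz.1.1.le)
  have hcg : ∀ ρ, ‖a‖ / R ≤ ρ → ρ ≤ R → ρ ≠ ‖w‖ →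
      (∮ t in C(0, ρ), dslope g w t) =
        (∮ t in C(0, ρ), g t / (t - w)) - g w * ∮ t in C(0, ρ), (t - w)⁻¹ := by
    intro ρ h1 h2 h3
    have hρ0 : 0 ≤ ρ := hρ.le.trans h1
    have hne : ∀ t ∈ sphere (0 : ℂ) ρ, t - w ≠ 0 := by
      intro t ht h
      rw [mem_sphere_zero_iff_norm, sub_eq_zero.1 h] at ht
      exact h3 ht.symm
    have hinv : ContinuousOn (fun t : ℂ => (t - w)⁻¹) (sphere 0 ρ) :=
      ContinuousOn.inv₀ (by fun_prop) hne
    have hgc : ContinuousOn g (sphere 0 ρ) := fun t ht => by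
      rw [mem_sphere_zero_iff_norm] at ht
      exact (hg t (ht ▸ h1) (ht ▸ h2)).continuousAt.continuousWithinAt
    rw [← circleIntegral.integral_const_mul, ← circleIntegral.integral_sub]
    · refine circleIntegral.integral_congr hρ0 fun t ht => ?_
      rw [dslope_of_ne _ (sub_ne_zero.1 (hne t ht)), slope_def_field]
      ring
    · simp only [div_eq_mul_inv]
      exact (hgc.mul hinv).circleIntegrable hρ0
    · exact (continuousOn_const.mul hinv).circleIntegrable hρ0
  have h2 : (∮ t in C(0, R), (t - w)⁻¹) = 2 * Real.pi * I :=
    circleIntegral.integral_sub_inv_of_mem_ball (mem_ball_zero_iff.2 hw)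
  have h3 : (∮ t in C(0, ‖a‖ / R), (t - w)⁻¹) = 0 := by
    refine circleIntegral_eq_zero_of_differentiable_on_off_countable hρ.le Set.countable_empty ?_ ?_
    · refine ContinuousOn.inv₀ (by fun_prop) fun t ht h => ?_
      rw [mem_closedBall_zero_iff, sub_eq_zero.1 h] at ht
      exact ht.not_gt hρw
    · intro t ht
      refine DifferentiableAt.inv (by fun_prop) fun h => ?_
      have ht := ht.1
      rw [mem_ball_zero_iff, sub_eq_zero.1 h] at ht
      exact ht.not_gt hρw
  have h4 : (∮ t in C(0, ‖a‖ / R), g t / (t - w)) =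
      -∮ t in C(0, R), g (a / t) * (v / (t * (t - v))) := by
    rw [circleIntegral_div_eq _ ha hR, neg_eq_neg_one_mul, ← circleIntegral.integral_const_mul]
    refine circleIntegral.integral_congr hR.le fun t ht => ?_
    rw [mem_sphere_zero_iff_norm] at ht
    have ht0 : t ≠ 0 := by rintro rfl; simp at ht; exact hR.ne ht
    have htv : t - v ≠ 0 := fun h => by rw [sub_eq_zero.1 h] at ht; exact hv.ne ht
    have htv' : v - t ≠ 0 := fun h => htv (by rw [← neg_sub, h, neg_zero])
    rw [← hwv, ← neg_sub v t]
    field_simp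
  rw [hcg R hρR.le le_rfl hw.ne', hcg _ le_rfl hρR.le hρw.ne, h2, h3, h4] at h1
  linear_combination -h1

/-- The point of `ℂᵐ⁺²` that agrees with `z` except in its first two coordinates `z₀`, `z₁`, which
are chosen such that `z₀ + i z₁ = p` and `z₀ - i z₁ = s`. -/
noncomputable def isotropicReplace {m : ℕ} (p s : ℂ) (z : EuclideanSpace ℂ (Fin (m + 2))) :
    EuclideanSpace ℂ (Fin (m + 2)) :=
  z + ((p + s) / 2 - z 0) • EuclideanSpace.single 0 1 +
    (-(Complex.I * (p - s)) / 2 - z 1) • EuclideanSpace.single 1 1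

section isotropicReplace

variable {m : ℕ} (p s : ℂ) (z : EuclideanSpace ℂ (Fin (m + 2)))

@[simp]
theorem isotropicReplace_zero : isotropicReplace p s z 0 = (p + s) / 2 := by
  simp [isotropicReplace]

@[simp]
theorem isotropicReplace_one : isotropicReplace p s z 1 = -(Complex.I * (p - s)) / 2 := by
  simp [isotropicReplace]

@[simp]
theorem isotropicReplace_succ_succ (j : Fin m) :
    isotropicReplace p s z j.succ.succ = z j.succ.succ := by
  have h : j.succ.succ ≠ 1 := by simp [Fin.ext_iff]
  simp [isotropicReplace, h]

theorem isotropicReplace_self :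
    isotropicReplace (z 0 + Complex.I * z 1) (z 0 - Complex.I * z 1) z = z := by
  ext j
  refine Fin.cases ?_ (Fin.cases ?_ fun j => ?_) j
  · simp
  · simp only [Fin.succ_zero_eq_one, isotropicReplace_one]
    linear_combination (-z 1) * Complex.I_sq
  · simp

theorem sum_isotropicReplace_sub (h : p * s = z 0 ^ 2 + z 1 ^ 2) :
    (∑ j, (isotropicReplace p s z j).re ^ 2) - ∑ j, (isotropicReplace p s z j).im ^ 2 =
      (∑ j, (z j).re ^ 2) - ∑ j, (z j).im ^ 2 := by
  have h := congrArg Complex.re h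
  simp only [Fin.sum_univ_succ, Fin.succ_zero_eq_one, isotropicReplace_zero, isotropicReplace_one,
    isotropicReplace_succ_succ]
  simp [pow_two] at h ⊢
  linarith

theorem norm_isotropicReplace_sq_add :
    ‖isotropicReplace p s z‖ ^ 2 + ‖z 0‖ ^ 2 + ‖z 1‖ ^ 2 =
      (‖p‖ ^ 2 + ‖s‖ ^ 2) / 2 + ‖z‖ ^ 2 := by
  simp only [EuclideanSpace.norm_sq_eq, Fin.sum_univ_succ, Fin.succ_zero_eq_one,
    isotropicReplace_zero, isotropicReplace_one, isotropicReplace_succ_succ]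
  simp only [norm_div, norm_neg, norm_mul, Complex.norm_I, one_mul, Complex.norm_ofNat]
  linarith [parallelogram_law_with_norm ℝ p s]

end isotropicReplace

theorem EuclideanSpace.norm_sq_eq_sum_re_add_sum_im {ι : Type*} [Fintype ι]
    (z : EuclideanSpace ℂ ι) : ‖z‖ ^ 2 = (∑ j, (z j).re ^ 2) + ∑ j, (z j).im ^ 2 := by
  rw [EuclideanSpace.norm_sq_eq, ← Finset.sum_add_distrib]
  refine Finset.sum_congr rfl fun j _ => ?_
  rw [← Complex.normSq_eq_norm_sq, Complex.normSq_apply]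
  ring

theorem norm_sq_zero_add_norm_sq_one_le {m : ℕ} (z : EuclideanSpace ℂ (Fin (m + 2))) :
    ‖z 0‖ ^ 2 + ‖z 1‖ ^ 2 ≤ ‖z‖ ^ 2 := by
  simp only [EuclideanSpace.norm_sq_eq, Fin.sum_univ_succ, Fin.succ_zero_eq_one, ← add_assoc]
  exact le_add_of_nonneg_right (by positivity)

/-- The part of the unit ball where `δ ‖Im z‖² < ‖Re z‖²`. -/
def coneDomain (ι : Type*) [Fintype ι] (δ : ℝ) : Set (EuclideanSpace ℂ ι) :=
  {z | ‖z‖ < 1 ∧ δ * ∑ j, (z j).im ^ 2 < ∑ j, (z j).re ^ 2}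

theorem isOpen_setOf_mul_sum_im_lt_sum_re (ι : Type*) [Fintype ι] (δ : ℝ) :
    IsOpen {z : EuclideanSpace ℂ ι | δ * ∑ j, (z j).im ^ 2 < ∑ j, (z j).re ^ 2} := by
  have h : ∀ j : ι, Continuous fun z : EuclideanSpace ℂ ι => z j := fun j => by fun_prop
  exact isOpen_lt
    (continuous_const.mul (continuous_finsetSum _ fun j _ =>
      (Complex.continuous_im.comp (h j)).pow 2))
    (continuous_finsetSum _ fun j _ => (Complex.continuous_re.comp (h j)).pow 2)

theorem isOpen_setOf_sum_im_lt_sum_re (ι : Type*) [Fintype ι] :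
    IsOpen {z : EuclideanSpace ℂ ι | ∑ j, (z j).im ^ 2 < ∑ j, (z j).re ^ 2} := by
  simpa only [one_mul] using isOpen_setOf_mul_sum_im_lt_sum_re ι 1

theorem isOpen_coneDomain (ι : Type*) [Fintype ι] (δ : ℝ) : IsOpen (coneDomain ι δ) :=
  (isOpen_lt continuous_norm continuous_const).inter (isOpen_setOf_mul_sum_im_lt_sum_re ι δ)

section

variable {m : ℕ} {δ : ℝ} {p s : ℂ} {z : EuclideanSpace ℂ (Fin (m + 2))}

theorem norm_isotropicReplace_lt_one (hδ : 0 < δ) (hδ' : δ < 1) (hz : ‖z‖ < (1 - δ) / 4)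
    (hp : ‖p‖ ≤ 1 / 2) (hs : ‖s‖ ≤ 1 / 2) : ‖isotropicReplace p s z‖ < 1 := by
  have h := norm_isotropicReplace_sq_add p s z
  have h1 : ‖p‖ ^ 2 ≤ (1 / 2) ^ 2 := by gcongr
  have h2 : ‖s‖ ^ 2 ≤ (1 / 2) ^ 2 := by gcongr
  have h3 : ‖z‖ ^ 2 ≤ (1 / 4) ^ 2 := by gcongr; linarith
  refine lt_of_pow_lt_pow_left₀ 2 zero_le_one ?_
  nlinarith [sq_nonneg ‖z 0‖, sq_nonneg ‖z 1‖]

theorem isotropicReplace_mem_coneDomain_of_lt (hδ : 0 < δ) (hδ' : δ < 1) (hz : ‖z‖ < (1 - δ) / 4)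
    (hz' : ∑ j, (z j).im ^ 2 < ∑ j, (z j).re ^ 2)
    (hps : p * s = z 0 ^ 2 + z 1 ^ 2) (hp : ‖p‖ ≤ 1 / 2) (hs : ‖s‖ ≤ 1 / 2) :
    isotropicReplace p s z ∈ coneDomain (Fin (m + 2)) δ := by
  refine ⟨norm_isotropicReplace_lt_one hδ hδ' hz hp hs, ?_⟩
  have h := sum_isotropicReplace_sub p s z hps
  have h0 : 0 ≤ ∑ j, (isotropicReplace p s z j).im ^ 2 := by positivity
  nlinarith

theorem isotropicReplace_mem_coneDomain (hδ : 0 < δ) (hδ' : δ < 1) (hz : ‖z‖ < (1 - δ) / 4)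
    (hps : p * s = z 0 ^ 2 + z 1 ^ 2) (hp : ‖p‖ ≤ 1 / 2) (hs : ‖s‖ ≤ 1 / 2)
    (h : 1 / 4 ≤ ‖p‖ ^ 2 + ‖s‖ ^ 2) :
    isotropicReplace p s z ∈ coneDomain (Fin (m + 2)) δ := by
  refine ⟨norm_isotropicReplace_lt_one hδ hδ' hz hp hs, ?_⟩
  have h1 := sum_isotropicReplace_sub p s z hps
  have h2 := norm_isotropicReplace_sq_add p s z
  have h3 := norm_sq_zero_add_norm_sq_one_le z
  have h4 := EuclideanSpace.norm_sq_eq_sum_re_add_sum_im z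
  have h5 : ‖z‖ ^ 2 < ((1 - δ) / 4) ^ 2 := by gcongr
  rw [EuclideanSpace.norm_sq_eq_sum_re_add_sum_im (isotropicReplace p s z)] at h2
  have h6 : 0 ≤ ∑ j, (z j).re ^ 2 := by positivity
  have h7 : 0 ≤ ∑ j, (isotropicReplace p s z j).im ^ 2 := by positivity
  by_contra! h8
  generalize ∑ j, (isotropicReplace p s z j).im ^ 2 = b at *
  generalize ∑ j, (isotropicReplace p s z j).re ^ 2 = a at *
  have h9 : 1 / 16 ≤ b := by nlinarith
  nlinarith

theorem norm_zero_add_I_mul_one_lt (hδ : 0 < δ) (hz : ‖z‖ < (1 - δ) / 4) :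
    ‖z 0 + Complex.I * z 1‖ < 1 / 2 ∧ ‖z 0 - Complex.I * z 1‖ < 1 / 2 := by
  have h0 := PiLp.norm_apply_le z 0
  have h1 := PiLp.norm_apply_le z 1
  have h2 := norm_add_le (z 0) (Complex.I * z 1)
  have h3 := norm_sub_le (z 0) (Complex.I * z 1)
  rw [norm_mul, Complex.norm_I, one_mul] at h2 h3
  constructor <;> linarith

theorem norm_sq_add_sq_le (hδ : 0 < δ) (hz : ‖z‖ < (1 - δ) / 4) :
    ‖z 0 ^ 2 + z 1 ^ 2‖ ≤ 1 / 16 := by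
  have h := norm_add_le (z 0 ^ 2) (z 1 ^ 2)
  rw [norm_pow, norm_pow] at h
  have h3 : ‖z‖ ^ 2 ≤ (1 / 4) ^ 2 := by gcongr; linarith
  linarith [norm_sq_zero_add_norm_sq_one_le z]

end

section extension

open Metric Filter Topology Complex

/-- A two-term Cauchy integral over the fibres of `z₀² + z₁²` that extends holomorphic functions on
`coneDomain` to a neighbourhood of the origin. -/
noncomputable def coneExtension {m : ℕ} (f : EuclideanSpace ℂ (Fin (m + 2)) → ℂ)
    (z : EuclideanSpace ℂ (Fin (m + 2))) : ℂ :=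
  (2 * Real.pi * I)⁻¹ *
    ((∮ t in C(0, 1 / 2), f (isotropicReplace t ((z 0 ^ 2 + z 1 ^ 2) / t) z) /
        (t - (z 0 + I * z 1))) +
      ∮ t in C(0, 1 / 2), f (isotropicReplace ((z 0 ^ 2 + z 1 ^ 2) / t) t z) *
        ((z 0 - I * z 1) / (t * (t - (z 0 - I * z 1)))))

variable {m : ℕ} {δ : ℝ} {f : EuclideanSpace ℂ (Fin (m + 2)) → ℂ}
  {z : EuclideanSpace ℂ (Fin (m + 2))}

theorem DifferentiableAt.isotropicReplace {E : Type*} [NormedAddCommGroup E] [NormedSpace ℂ E]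
    {p s : E → ℂ} {g : E → EuclideanSpace ℂ (Fin (m + 2))} {x : E}
    (hp : DifferentiableAt ℂ p x) (hs : DifferentiableAt ℂ s x) (hg : DifferentiableAt ℂ g x) :
    DifferentiableAt ℂ (fun x => isotropicReplace (p x) (s x) (g x)) x := by
  unfold _root_.isotropicReplace
  fun_prop

theorem differentiableAt_coneExtension (hδ : 0 < δ) (hδ' : δ < 1)
    (hf : DifferentiableOn ℂ f (coneDomain (Fin (m + 2)) δ)) (hz : ‖z‖ < (1 - δ) / 4) :
    DifferentiableAt ℂ (coneExtension f) z := by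
  have hD : ∀ w ∈ coneDomain (Fin (m + 2)) δ, ∀ᶠ w' in 𝓝 w, DifferentiableAt ℂ f w' :=
    fun w hw => hf.eventually_differentiableAt ((isOpen_coneDomain _ δ).mem_nhds hw)
  obtain ⟨hu, hv⟩ := norm_zero_add_I_mul_one_lt hδ hz
  have hε := norm_sq_add_sq_le hδ hz
  have hmain : ∀ t ∈ sphere (0 : ℂ) (1 / 2), t ≠ 0 ∧ t - (z 0 + I * z 1) ≠ 0 ∧
      t - (z 0 - I * z 1) ≠ 0 ∧
      isotropicReplace t ((z 0 ^ 2 + z 1 ^ 2) / t) z ∈ coneDomain (Fin (m + 2)) δ ∧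
      isotropicReplace ((z 0 ^ 2 + z 1 ^ 2) / t) t z ∈ coneDomain (Fin (m + 2)) δ := by
    intro t ht
    rw [mem_sphere_zero_iff_norm] at ht
    have ht0 : t ≠ 0 := by rintro rfl; norm_num at ht
    have hd : ‖(z 0 ^ 2 + z 1 ^ 2) / t‖ ≤ 1 / 2 := by
      rw [norm_div, ht]; linarith
    refine ⟨ht0, fun h => ?_, fun h => ?_, ?_, ?_⟩
    · rw [← sub_eq_zero.1 h] at hu; exact hu.ne ht
    · rw [← sub_eq_zero.1 h] at hv; exact hv.ne ht
    · exact isotropicReplace_mem_coneDomain hδ hδ' hz (mul_div_cancel₀ _ ht0) ht.le hd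
        (by rw [ht]; nlinarith [sq_nonneg ‖(z 0 ^ 2 + z 1 ^ 2) / t‖])
    · exact isotropicReplace_mem_coneDomain hδ hδ' hz (div_mul_cancel₀ _ ht0) hd ht.le
        (by rw [ht]; nlinarith [sq_nonneg ‖(z 0 ^ 2 + z 1 ^ 2) / t‖])
  have hε_diff : ∀ q : EuclideanSpace ℂ (Fin (m + 2)) × ℂ, q.2 ≠ 0 →
      DifferentiableAt ℂ (fun q : EuclideanSpace ℂ (Fin (m + 2)) × ℂ =>
        (q.1 0 ^ 2 + q.1 1 ^ 2) / q.2) q := fun q hq => by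
    fun_prop (disch := assumption)
  refine DifferentiableAt.const_mul (DifferentiableAt.add ?_ ?_) _
  · refine differentiableAt_circleIntegral_of_eventually
      (G := fun q : EuclideanSpace ℂ (Fin (m + 2)) × ℂ =>
        f (isotropicReplace q.2 ((q.1 0 ^ 2 + q.1 1 ^ 2) / q.2) q.1) /
        (q.2 - (q.1 0 + I * q.1 1))) (by norm_num) fun t ht => ?_
    obtain ⟨ht0, htu, -, hmem, -⟩ := hmain t ht
    have hφ : ∀ q : EuclideanSpace ℂ (Fin (m + 2)) × ℂ, q.2 ≠ 0 → DifferentiableAt ℂ (fun q =>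
        isotropicReplace q.2 ((q.1 0 ^ 2 + q.1 1 ^ 2) / q.2) q.1) q := fun q hq =>
      .isotropicReplace (by fun_prop) (hε_diff q hq) (by fun_prop)
    have h1 := (hφ (z, t) ht0).continuousAt.eventually (hD _ hmem)
    have h2 : ∀ᶠ q : EuclideanSpace ℂ (Fin (m + 2)) × ℂ in 𝓝 (z, t), q.2 ≠ 0 :=
      ContinuousAt.eventually_ne (by fun_prop) ht0
    have h3 : ∀ᶠ q : EuclideanSpace ℂ (Fin (m + 2)) × ℂ in 𝓝 (z, t),
        q.2 - (q.1 0 + I * q.1 1) ≠ 0 :=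
      ContinuousAt.eventually_ne (by fun_prop) htu
    filter_upwards [h1, h2, h3] with q hq1 hq2 hq3
    have hfφ := hq1.comp q (hφ q hq2)
    simp only [Function.comp_def] at hfφ
    fun_prop (disch := assumption)
  · refine differentiableAt_circleIntegral_of_eventually
      (G := fun q : EuclideanSpace ℂ (Fin (m + 2)) × ℂ =>
        f (isotropicReplace ((q.1 0 ^ 2 + q.1 1 ^ 2) / q.2) q.2 q.1) *
        ((q.1 0 - I * q.1 1) / (q.2 * (q.2 - (q.1 0 - I * q.1 1))))) (by norm_num) fun t ht => ?_
    obtain ⟨ht0, -, htv, -, hmem⟩ := hmain t ht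
    have hφ : ∀ q : EuclideanSpace ℂ (Fin (m + 2)) × ℂ, q.2 ≠ 0 → DifferentiableAt ℂ (fun q =>
        isotropicReplace ((q.1 0 ^ 2 + q.1 1 ^ 2) / q.2) q.2 q.1) q := fun q hq =>
      .isotropicReplace (hε_diff q hq) (by fun_prop) (by fun_prop)
    have h1 := (hφ (z, t) ht0).continuousAt.eventually (hD _ hmem)
    have h2 : ∀ᶠ q : EuclideanSpace ℂ (Fin (m + 2)) × ℂ in 𝓝 (z, t), q.2 ≠ 0 :=
      ContinuousAt.eventually_ne (by fun_prop) ht0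
    have h3 : ∀ᶠ q : EuclideanSpace ℂ (Fin (m + 2)) × ℂ in 𝓝 (z, t),
        q.2 - (q.1 0 - I * q.1 1) ≠ 0 :=
      ContinuousAt.eventually_ne (by fun_prop) htv
    filter_upwards [h1, h2, h3] with q hq1 hq2 hq3
    have hfφ := hq1.comp q (hφ q hq2)
    simp only [Function.comp_def] at hfφ
    have hq4 := mul_ne_zero hq2 hq3
    fun_prop (disch := assumption)

theorem mem_coneDomain_of_lt (hδ' : δ < 1) (hz : ‖z‖ < 1)
    (hz' : ∑ j, (z j).im ^ 2 < ∑ j, (z j).re ^ 2) : z ∈ coneDomain (Fin (m + 2)) δ := by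
  have h0 : 0 ≤ ∑ j, (z j).im ^ 2 := by positivity
  exact ⟨hz, by nlinarith⟩

theorem coneExtension_eq_of_ne_zero (hδ : 0 < δ) (hδ' : δ < 1)
    (hf : DifferentiableOn ℂ f (coneDomain (Fin (m + 2)) δ)) (hz : ‖z‖ < (1 - δ) / 4)
    (hz' : ∑ j, (z j).im ^ 2 < ∑ j, (z j).re ^ 2) (h0 : z 0 ^ 2 + z 1 ^ 2 ≠ 0) :
    coneExtension f z = f z := by
  obtain ⟨hu, hv⟩ := norm_zero_add_I_mul_one_lt hδ hz
  have h := two_pi_I_mul_eq_circleIntegral_add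
    (g := fun t => f (isotropicReplace t ((z 0 ^ 2 + z 1 ^ 2) / t) z)) h0
    (by linear_combination (-z 1 ^ 2) * I_sq) hu hv fun t ht ht' => ?_
  · have hu0 : z 0 + I * z 1 ≠ 0 := fun h => h0 (by
      linear_combination (z 0 - I * z 1) * h + (z 1 ^ 2) * I_sq)
    have e : (z 0 ^ 2 + z 1 ^ 2) / (z 0 + I * z 1) = z 0 - I * z 1 := by
      rw [div_eq_iff hu0]
      linear_combination (z 1 ^ 2) * I_sq
    simp only [div_div_cancel₀ h0, e, isotropicReplace_self] at h
    rw [coneExtension, ← h, inv_mul_cancel_left₀ two_pi_I_ne_zero]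
  · have ht0 : t ≠ 0 := by
      rintro rfl
      have : 0 < ‖z 0 ^ 2 + z 1 ^ 2‖ / (1 / 2) := by positivity
      rw [norm_zero] at ht
      exact ht.not_gt this
    have hmem := isotropicReplace_mem_coneDomain_of_lt hδ hδ' hz hz'
      (mul_div_cancel₀ (z 0 ^ 2 + z 1 ^ 2) ht0) ht' (by
        rw [norm_div, div_le_iff₀ (norm_pos_iff.2 ht0)]
        rw [div_le_iff₀ (by norm_num)] at ht
        linarith)
    exact ((hf.differentiableAt ((isOpen_coneDomain _ δ).mem_nhds hmem)).comp t
      (.isotropicReplace (by fun_prop) (DifferentiableAt.fun_div (by fun_prop) (by fun_prop) ht0)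
        (by fun_prop)))

theorem coneExtension_eq_of_lt (hδ : 0 < δ) (hδ' : δ < 1)
    (hf : DifferentiableOn ℂ f (coneDomain (Fin (m + 2)) δ)) (hz : ‖z‖ < (1 - δ) / 4)
    (hz' : ∑ j, (z j).im ^ 2 < ∑ j, (z j).re ^ 2) :
    coneExtension f z = f z := by
  have hmem : z ∈ coneDomain (Fin (m + 2)) δ := mem_coneDomain_of_lt hδ' (by linarith) hz'
  by_cases h0 : z 0 ^ 2 + z 1 ^ 2 = 0
  swap
  · exact coneExtension_eq_of_ne_zero hδ hδ' hf hz hz' h0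
  let γ : ℂ → EuclideanSpace ℂ (Fin (m + 2)) := fun t => z + t • EuclideanSpace.single 0 1
  have hγ : ContinuousAt γ 0 := by fun_prop
  have hγ0 : γ 0 = z := by simp [γ]
  have hγz : Tendsto γ (𝓝[≠] 0) (𝓝 z) := by
    simpa only [hγ0] using hγ.tendsto.mono_left nhdsWithin_le_nhds
  have h1 : Tendsto (fun t => coneExtension f (γ t)) (𝓝[≠] 0) (𝓝 (coneExtension f z)) :=
    (differentiableAt_coneExtension hδ hδ' hf hz).continuousAt.tendsto.comp hγz
  have h2 : Tendsto (fun t => f (γ t)) (𝓝[≠] 0) (𝓝 (f z)) :=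
    (hf.differentiableAt ((isOpen_coneDomain _ δ).mem_nhds hmem)).continuousAt.tendsto.comp hγz
  refine tendsto_nhds_unique (h1.congr' ?_) h2
  have hne : ∀ᶠ t in 𝓝[≠] (0 : ℂ), 2 * z 0 + t ≠ 0 := by
    by_cases h : z 0 = 0
    · filter_upwards [self_mem_nhdsWithin] with t ht
      simpa [h] using ht
    · exact eventually_nhdsWithin_of_eventually_nhds
        (ContinuousAt.eventually_ne (by fun_prop) (by simpa using h))
  filter_upwards [hγz.eventually ((isOpen_setOf_sum_im_lt_sum_re _).mem_nhds hz'),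
    hγz.norm.eventually_lt_const hz, self_mem_nhdsWithin,
    hne] with t ht1 ht2 ht3 ht4
  refine coneExtension_eq_of_ne_zero hδ hδ' hf ht2 ht1 fun h => mul_ne_zero ht3 ht4 ?_
  simp [γ] at h
  linear_combination h - h0

theorem coneExtension_eqOn (hδ : 0 < δ) (hδ' : δ < 1)
    (hf : DifferentiableOn ℂ f (coneDomain (Fin (m + 2)) δ)) :
    Set.EqOn (coneExtension f) f (ball 0 ((1 - δ) / 4) ∩ coneDomain (Fin (m + 2)) δ) := by
  rintro z ⟨hz, hzD⟩
  rw [mem_ball_zero_iff] at hz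
  let γ : ℂ → EuclideanSpace ℂ (Fin (m + 2)) := fun ζ =>
    WithLp.toLp 2 fun j => ((z j).re : ℂ) + ζ * (I * (z j).im)
  have hγd : Differentiable ℂ γ := by
    refine differentiable_euclidean.2 fun j => ?_
    simp only [γ]
    fun_prop
  have hre : ∀ (a : ℝ) j, (γ a j).re = (z j).re := by simp [γ]
  have him : ∀ (a : ℝ) j, (γ a j).im = a * (z j).im := by simp [γ]
  have hγ1 : γ 1 = z := by
    ext j
    simp only [γ, one_mul]
    rw [mul_comm, re_add_im]
  have hT : 0 ≤ ∑ j, (z j).im ^ 2 := by positivity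
  have hγmem : ∀ a ∈ Set.Icc (0 : ℝ) 1,
      ‖γ a‖ < (1 - δ) / 4 ∧ γ a ∈ coneDomain (Fin (m + 2)) δ := by
    intro a ha
    have ha2 : a ^ 2 ≤ 1 := pow_le_one₀ ha.1 ha.2
    have h1 : ‖γ a‖ ≤ ‖z‖ := by
      refine le_of_sq_le_sq ?_ (norm_nonneg _)
      simp only [EuclideanSpace.norm_sq_eq_sum_re_add_sum_im, hre, him, mul_pow,
        ← Finset.mul_sum]
      nlinarith
    refine ⟨h1.trans_lt hz, h1.trans_lt hzD.1, ?_⟩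
    simp only [hre, him, mul_pow, ← Finset.mul_sum]
    refine lt_of_le_of_lt ?_ hzD.2
    gcongr
    nlinarith
  let K : Set ℂ := (fun a : ℝ => (a : ℂ)) '' Set.Icc 0 1
  have hK : IsPreconnected K := isPreconnected_Icc.image _ continuous_ofReal.continuousOn
  have hF : AnalyticOnNhd ℂ (fun ζ => coneExtension f (γ ζ)) K := by
    rintro _ ⟨a, ha, rfl⟩
    refine analyticAt_iff_eventually_differentiableAt.2 ?_
    filter_upwards [(hγd a).continuousAt.norm.eventually_lt_const (hγmem a ha).1] with ζ hζ
    exact (differentiableAt_coneExtension hδ hδ' hf hζ).comp ζ (hγd ζ)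
  have hf' : AnalyticOnNhd ℂ (fun ζ => f (γ ζ)) K := by
    rintro _ ⟨a, ha, rfl⟩
    refine analyticAt_iff_eventually_differentiableAt.2 ?_
    filter_upwards [(hγd a).continuousAt.eventually
      (hf.eventually_differentiableAt ((isOpen_coneDomain _ δ).mem_nhds (hγmem a ha).2))] with ζ hζ
    exact hζ.comp ζ (hγd ζ)
  have h0K : (0 : ℂ) ∈ K := ⟨0, by simp, by simp⟩
  have h1K : (1 : ℂ) ∈ K := ⟨1, by simp, by simp⟩
  have h0 := hγmem 0 (by simp)
  rw [ofReal_zero] at h0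
  have h := hF.eqOn_of_preconnected_of_eventuallyEq hf' hK h0K (by
    have hlt : ∑ j, (γ 0 j).im ^ 2 < ∑ j, (γ 0 j).re ^ 2 := by
      rw [← ofReal_zero]
      simp only [hre, him]
      simpa using (mul_nonneg hδ.le hT).trans_lt hzD.2
    filter_upwards [(hγd 0).continuousAt.norm.eventually_lt_const h0.1,
      (hγd 0).continuousAt.eventually ((isOpen_setOf_sum_im_lt_sum_re _).mem_nhds hlt)]
      with ζ hζ hζ'
    exact coneExtension_eq_of_lt hδ hδ' hf hζ hζ') h1K
  simpa only [hγ1] using h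

end extension

/-- Case 2 (q = n) of Lemma 2.2 of the paper, after reduction (2.7)–(2.8):
the envelope of holomorphy of the cone-type domain
`D₁⁺ = { z ∈ ℂⁿ : ‖z‖ < 1, Σ (Re z_j)² > δ₀ Σ (Im z_j)² }`
contains the origin. -/
theorem stmt_1 (n : ℕ) (hn : 2 ≤ n) (δ₀ : ℝ) (hδ₀ : 0 < δ₀) (hδ₀' : δ₀ < 1)
    (D : Set (EuclideanSpace ℂ (Fin n)))
    (hD : D = {z | ‖z‖ < 1 ∧
      δ₀ * ∑ j : Fin n, ((z j).im) ^ 2 < ∑ j : Fin n, ((z j).re) ^ 2}) :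
    ∀ f : EuclideanSpace ℂ (Fin n) → ℂ, DifferentiableOn ℂ f D →
      ∃ U : Set (EuclideanSpace ℂ (Fin n)), IsOpen U ∧
        (0 : EuclideanSpace ℂ (Fin n)) ∈ U ∧
        ∃ F : EuclideanSpace ℂ (Fin n) → ℂ, DifferentiableOn ℂ F U ∧
          Set.EqOn F f (U ∩ D) := by
  obtain ⟨m, rfl⟩ := Nat.exists_eq_add_of_le' hn
  subst hD
  intro f hf
  exact ⟨Metric.ball 0 ((1 - δ₀) / 4), Metric.isOpen_ball,
    Metric.mem_ball_self (by linarith), coneExtension f,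
    fun z hz => (differentiableAt_coneExtension hδ₀ hδ₀' hf
      (mem_ball_zero_iff.1 hz)).differentiableWithinAt, coneExtension_eqOn hδ₀ hδ₀' hf⟩
end

section
/- Let n ≥ 2 and η > 1, and let T = { z ∈ ℂⁿ : Σ_{j=1}^n (Re z_j)² = 1 and Σ_{j=1}^n (Im z_j)² ≤ η² } (a compact 'tube torus'). Then for every open set Ω ⊆ ℂⁿ containing T and every function f holomorphic on Ω, there exist a connected open set W ⊆ ℂⁿ with T ∪ {0} ⊆ W and a function F holomorphic on W such that F = f on some nonempty open subset of W ∩ Ω. (The envelope of holomorphy of T contains the origin; it is obtained by sweeping with the family of complex quadrics C_t = { z : z_1² + ⋯ + z_n² = t }.) -/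
open Metric Set Filter Topology Real

theorem eventually_differentiableAt_circleAverage {E : Type*} [NormedAddCommGroup E]
    [NormedSpace ℂ E] [ProperSpace E] {G : E → ℂ → ℂ} {z₀ : E}
    (hG : ∀ w ∈ sphere (0 : ℂ) 1, ∀ᶠ p in 𝓝 (z₀, w), DifferentiableAt ℂ (Function.uncurry G) p) :
    ∀ᶠ z in 𝓝 z₀, DifferentiableAt ℂ (fun z ↦ circleAverage (G z) 0 1) z := by
  have hK : IsCompact (sphere (0 : ℂ) 1) := isCompact_sphere _ _
  have h1 : ∀ᶠ z in 𝓝 z₀, ∀ w ∈ sphere (0 : ℂ) 1,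
      DifferentiableAt ℂ (Function.uncurry G) (z, w) :=
    hK.eventually_forall_of_forall_eventually hG
  obtain ⟨r, hr, h2⟩ := Metric.eventually_nhds_iff_ball.1 h1
  filter_upwards [ball_mem_nhds z₀ hr] with z hz
  obtain ⟨ρ, hρ, hρz⟩ : ∃ ρ > 0, closedBall z ρ ⊆ ball z₀ r :=
    nhds_basis_closedBall.mem_iff.1 (isOpen_ball.mem_nhds hz)
  have hcont : ContinuousOn (Function.uncurry G) (closedBall z ρ ×ˢ sphere (0 : ℂ) 1) :=
    fun p hp ↦ (h2 p.1 (hρz hp.1) p.2 hp.2).continuousAt.continuousWithinAt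
  have hcpt : IsCompact (closedBall z ρ ×ˢ sphere (0 : ℂ) 1) := (isCompact_closedBall z ρ).prod hK
  obtain ⟨M, hM⟩ := hcpt.exists_bound_of_continuousOn hcont
  have hdiff : ∀ w ∈ sphere (0 : ℂ) 1, ∀ x ∈ closedBall z ρ,
      DifferentiableAt ℂ (fun y ↦ G y w) x := fun w hw x hx ↦
    (h2 x (hρz hx) w hw).comp (f := fun y ↦ (y, w)) x (by fun_prop)
  have hcirc : ∀ θ : ℝ, circleMap 0 1 θ ∈ sphere (0 : ℂ) 1 :=
    fun θ ↦ circleMap_mem_sphere 0 zero_le_one θ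
  have hslice : ∀ x ∈ closedBall z ρ, Continuous fun θ : ℝ ↦ G x (circleMap 0 1 θ) := by
    intro x hx
    exact hcont.comp_continuous (f := fun θ : ℝ ↦ (x, circleMap 0 1 θ)) (by fun_prop)
      fun θ ↦ ⟨hx, hcirc θ⟩
  have hF' : Continuous fun θ : ℝ ↦ fderiv ℂ (fun y ↦ G y (circleMap 0 1 θ)) z := by
    rw [Metric.continuous_iff']
    intro θ₀ ε hε
    have huc := hcpt.uniformContinuousOn_of_continuous hcont
    obtain ⟨δ, hδ, hδ'⟩ := Metric.uniformContinuousOn_iff.1 huc (ε * ρ / 4) (by positivity)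
    have hc : Continuous fun θ : ℝ ↦ circleMap (0 : ℂ) 1 θ := by fun_prop
    filter_upwards [Metric.continuous_iff'.1 hc θ₀ δ hδ] with θ hθ
    have hsub : ∀ x ∈ closedBall z ρ,
        ‖G x (circleMap 0 1 θ) - G x (circleMap 0 1 θ₀)‖ ≤ ε * ρ / 4 := by
      intro x hx
      have := hδ' (x, circleMap 0 1 θ) ⟨hx, hcirc θ⟩ (x, circleMap 0 1 θ₀) ⟨hx, hcirc θ₀⟩
        (by simpa [Prod.dist_eq] using hθ)
      simpa [dist_eq_norm] using this.le
    have hz' : z ∈ closedBall z ρ := mem_closedBall_self hρ.le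
    rw [dist_eq_norm, ← fderiv_fun_sub (hdiff _ (hcirc θ) z hz') (hdiff _ (hcirc θ₀) z hz')]
    have := Complex.norm_fderiv_le_div_of_mapsTo_ball (c := z) (R₁ := ρ) (R₂ := ε * ρ / 2)
      (f := fun y ↦ G y (circleMap 0 1 θ) - G y (circleMap 0 1 θ₀))
      (fun x hx ↦ ((hdiff _ (hcirc θ) x (ball_subset_closedBall hx)).sub
        (hdiff _ (hcirc θ₀) x (ball_subset_closedBall hx))).differentiableWithinAt)
      (fun x hx ↦ by
        rw [mem_closedBall, dist_eq_norm]
        refine (norm_sub_le _ _).trans ?_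
        linarith [hsub x (ball_subset_closedBall hx), hsub z hz']) hρ
    calc _ ≤ _ := this
      _ = ε / 2 := by field_simp
      _ < ε := by linarith
  have key := intervalIntegral.hasFDerivAt_integral_of_dominated_of_fderiv_le (𝕜 := ℂ)
    (μ := MeasureTheory.volume) (a := 0) (b := 2 * π) (bound := fun _ ↦ 2 * M / (ρ / 2))
    (F := fun x (θ : ℝ) ↦ G x (circleMap 0 1 θ)) (x₀ := z) (s := ball z (ρ / 2))
    (F' := fun x (θ : ℝ) ↦ fderiv ℂ (fun y ↦ G y (circleMap 0 1 θ)) x)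
    (ball_mem_nhds z (by positivity)) ?_ ?_ hF'.aestronglyMeasurable ?_ (by simp) ?_
  · simp only [circleAverage_def]
    exact key.differentiableAt.const_smul _
  · filter_upwards [closedBall_mem_nhds z hρ] with x hx
    exact (hslice x hx).aestronglyMeasurable
  · exact (hslice z (mem_closedBall_self hρ.le)).intervalIntegrable _ _
  · refine .of_forall fun θ _ x hx ↦ ?_
    have hsub : ball x (ρ / 2) ⊆ closedBall z ρ := fun y hy ↦ by
      rw [mem_ball] at hx hy
      rw [mem_closedBall]
      linarith [dist_triangle y x z]
    refine Complex.norm_fderiv_le_div_of_mapsTo_ball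
      (fun y hy ↦ (hdiff _ (hcirc θ) y (hsub hy)).differentiableWithinAt) (fun y hy ↦ ?_)
      (by positivity)
    rw [mem_closedBall, dist_eq_norm]
    refine (norm_sub_le _ _).trans ?_
    have h3 : ‖G y (circleMap 0 1 θ)‖ ≤ M := hM (y, _) ⟨hsub hy, hcirc θ⟩
    have h4 : ‖G x (circleMap 0 1 θ)‖ ≤ M := hM (x, _) ⟨hsub (mem_ball_self (by positivity)), hcirc θ⟩
    linarith
  · refine .of_forall fun θ _ x hx ↦ (hdiff _ (hcirc θ) x ?_).hasFDerivAt
    exact ball_subset_closedBall (ball_subset_ball (by linarith) hx)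

theorem circleAverage_comp_mul_left (k : ℂ → ℂ) (c : ℂ) :
    circleAverage (fun w ↦ k (c * w)) 0 1 = circleAverage k 0 ‖c‖ := by
  rw [circleAverage_eq_integral_add (f := k) c.arg, circleAverage_def]
  congr 2 with θ
  conv_lhs => rw [← Complex.norm_mul_exp_arg_mul_I c]
  simp only [circleMap, Complex.ofReal_add, add_mul, Complex.exp_add, Complex.ofReal_one]
  congr 1
  ring

theorem circleAverage_sub_circleAverage_eq {g : ℂ → ℂ} {u : ℂ} {r R : ℝ} (hr : 0 < r)
    (hru : r < ‖u‖) (huR : ‖u‖ < R)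
    (hg : ∀ ζ : ℂ, r ≤ ‖ζ‖ → ‖ζ‖ ≤ R → DifferentiableAt ℂ g ζ) :
    circleAverage (fun ζ ↦ g ζ * (ζ / (ζ - u))) 0 R
      - circleAverage (fun ζ ↦ g ζ * (ζ / (ζ - u))) 0 r = g u := by
  have hR : 0 < R := by linarith
  have hgu := hg u hru.le huR.le
  have hcd : ∀ ζ : ℂ, r ≤ ‖ζ‖ → ‖ζ‖ ≤ R → ContinuousAt (dslope g u) ζ := by
    intro ζ h1 h2
    rcases eq_or_ne ζ u with rfl | hne
    · exact continuousAt_dslope_same.2 hgu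
    · exact ((differentiableAt_dslope_of_ne hne).2 (hg ζ h1 h2)).continuousAt
  have hsplit : ∀ ρ : ℝ, r ≤ ρ → ρ ≤ R → ρ ≠ ‖u‖ →
      circleAverage (fun ζ ↦ g ζ * (ζ / (ζ - u))) 0 ρ =
        circleAverage (fun ζ ↦ ζ * dslope g u ζ) 0 ρ
          + g u * ((2 * π * Complex.I)⁻¹ * ∮ ζ in C(0, ρ), (ζ - u)⁻¹) := by
    intro ρ h1 h2 h3
    have hρ : 0 < ρ := by linarith
    have hne : ∀ ζ ∈ sphere (0 : ℂ) ρ, ζ - u ≠ 0 := fun ζ hζ h ↦ h3 <| by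
      rw [sub_eq_zero.1 h] at hζ; simpa using hζ.symm
    have hne0 : ∀ ζ ∈ sphere (0 : ℂ) ρ, ζ ≠ 0 := fun ζ hζ h ↦ by
      simp [h] at hζ; linarith
    have e1 : circleAverage (fun ζ ↦ ζ / (ζ - u)) 0 ρ
        = (2 * π * Complex.I)⁻¹ * ∮ ζ in C(0, ρ), (ζ - u)⁻¹ := by
      rw [circleAverage_eq_circleIntegral hρ.ne', smul_eq_mul]
      congr 1
      refine circleIntegral.integral_congr hρ.le fun ζ hζ ↦ ?_
      have := hne0 ζ hζ
      simp only [smul_eq_mul, sub_zero]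
      field_simp
    rw [← e1, ← smul_eq_mul (g u), ← circleAverage_fun_smul, ← circleAverage_fun_add]
    · refine circleAverage_congr_sphere fun ζ hζ ↦ ?_
      rw [abs_of_pos hρ] at hζ
      have h4 := hne ζ hζ
      simp only [smul_eq_mul]
      rw [dslope_of_ne _ (sub_ne_zero.1 h4), slope_def_field]
      field_simp
      ring
    · refine ContinuousOn.circleIntegrable hρ.le fun ζ hζ ↦ ContinuousAt.continuousWithinAt ?_
      rw [mem_sphere_zero_iff_norm] at hζ
      exact continuousAt_id.mul (hcd ζ (hζ ▸ h1) (hζ ▸ h2))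
    · refine ContinuousOn.circleIntegrable hρ.le fun ζ hζ ↦ ContinuousAt.continuousWithinAt ?_
      have := hne ζ hζ
      simp only [smul_eq_mul]
      fun_prop (disch := assumption)
  have hsame : circleAverage (fun ζ ↦ ζ * dslope g u ζ) 0 R
      = circleAverage (fun ζ ↦ ζ * dslope g u ζ) 0 r := by
    rw [circleAverage_eq_circleIntegral hR.ne', circleAverage_eq_circleIntegral hr.ne']
    congr 1
    refine Complex.circleIntegral_sub_center_inv_smul_eq_of_differentiable_on_annulus_off_countable
      hr (by linarith) (countable_singleton u) (fun ζ hζ ↦ ?_) (fun ζ hζ ↦ ?_)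
    · simp only [Set.mem_sdiff, mem_closedBall, mem_ball, dist_zero_right, not_lt] at hζ
      exact (continuousAt_id.mul (hcd ζ hζ.2 hζ.1)).continuousWithinAt
    · simp only [Set.mem_sdiff, mem_closedBall, mem_ball, dist_zero_right, not_le,
        mem_singleton_iff] at hζ
      exact differentiableAt_id.mul
        ((differentiableAt_dslope_of_ne hζ.2).2 (hg ζ hζ.1.2.le hζ.1.1.le))
  rw [hsplit R (by linarith) le_rfl huR.ne', hsplit r le_rfl (by linarith) hru.ne, hsame,
    circleIntegral.integral_sub_inv_of_mem_ball (by simpa using huR),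
    Complex.circleIntegral_eq_zero_of_differentiable_on_off_countable hr.le countable_empty]
  · have := Complex.two_pi_I_ne_zero
    field_simp
    ring
  · refine ContinuousOn.inv₀ (by fun_prop) fun ζ hζ h ↦ ?_
    rw [sub_eq_zero.1 h] at hζ; simp at hζ; linarith
  · intro ζ hζ
    have : ζ - u ≠ 0 := fun h ↦ by
      rw [sub_eq_zero.1 h] at hζ; simp at hζ; linarith
    fun_prop (disch := assumption)

theorem isConnected_thickening {E : Type*} [NormedAddCommGroup E] [NormedSpace ℝ E] {s : Set E}
    (hs : IsConnected s) {r : ℝ} (hr : 0 < r) : IsConnected (thickening r s) := by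
  have h : (fun p : E × E ↦ p.1 + p.2) '' (s ×ˢ ball 0 r) = thickening r s := by
    rw [← add_ball_zero, ← Set.image2_add, Set.image_prod]
  rw [← h]
  exact (hs.prod ((convex_ball 0 r).isConnected ⟨0, mem_ball_self hr⟩)).image _
    (by fun_prop)

section

variable {n : ℕ}

theorem isCompact_and_isConnected_sphereTube (hn : 2 ≤ n) {η : ℝ} (hη : 0 ≤ η) :
    IsCompact {z : EuclideanSpace ℂ (Fin n) |
        (∑ j : Fin n, ((z j).re) ^ 2 = 1) ∧ ∑ j : Fin n, ((z j).im) ^ 2 ≤ η ^ 2} ∧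
      IsConnected {z : EuclideanSpace ℂ (Fin n) |
        (∑ j : Fin n, ((z j).re) ^ 2 = 1) ∧ ∑ j : Fin n, ((z j).im) ^ 2 ≤ η ^ 2} := by
  set Φ : EuclideanSpace ℝ (Fin n) × EuclideanSpace ℝ (Fin n) → EuclideanSpace ℂ (Fin n) :=
    fun p ↦ WithLp.toLp 2 fun j ↦ (p.1 j : ℂ) + (p.2 j : ℂ) * Complex.I with hΦ
  have hΦc : Continuous Φ := by fun_prop
  have hS : {z : EuclideanSpace ℂ (Fin n) |
        (∑ j : Fin n, ((z j).re) ^ 2 = 1) ∧ ∑ j : Fin n, ((z j).im) ^ 2 ≤ η ^ 2} =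
      Φ '' (sphere 0 1 ×ˢ closedBall 0 η) := by
    ext z
    constructor
    · rintro ⟨h1, h2⟩
      refine ⟨(WithLp.toLp 2 fun j ↦ (z j).re, WithLp.toLp 2 fun j ↦ (z j).im), ⟨?_, ?_⟩, ?_⟩
      · simp [EuclideanSpace.norm_eq, h1]
      · simp only [mem_closedBall_zero_iff, EuclideanSpace.norm_eq, Real.norm_eq_abs, sq_abs]
        exact Real.sqrt_le_iff.2 ⟨hη, h2⟩
      · ext j
        simp [hΦ, Complex.re_add_im]
    · rintro ⟨⟨x, y⟩, ⟨h1, h2⟩, rfl⟩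
      simp only [mem_closedBall_zero_iff, mem_sphere_zero_iff_norm] at h1 h2
      have h1' := EuclideanSpace.real_norm_sq_eq x
      have h2' := EuclideanSpace.real_norm_sq_eq y
      simp only [mem_ofPred_eq, hΦ, Complex.add_re, Complex.ofReal_re, Complex.mul_re,
        Complex.ofReal_im, Complex.I_re, Complex.I_im, Complex.add_im, Complex.mul_im]
      simp only [mul_zero, sub_zero, add_zero, zero_add, mul_one]
      rw [← h1', ← h2', h1]
      exact ⟨by norm_num, by gcongr⟩
  rw [hS]
  refine ⟨((isCompact_sphere 0 1).prod (isCompact_closedBall 0 η)).image hΦc, ?_⟩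
  refine ((isConnected_sphere ?_ 0 zero_le_one).prod
    ((convex_closedBall 0 η).isConnected ⟨0, mem_closedBall_self hη⟩)).image _ hΦc.continuousOn
  rw [rank_eq_card_basis (EuclideanSpace.basisFun (Fin n) ℝ).toBasis]
  simp only [Fintype.card_fin]
  exact_mod_cast hn

open Complex (I)

/-- The point of `ℂⁿ` obtained from `z` by replacing the coordinates `i` and `j` with the solution
of `zᵢ + I zⱼ = a`, `zᵢ - I zⱼ = b`. -/
noncomputable def quadricPoint (i j : Fin n) (z : EuclideanSpace ℂ (Fin n)) (a b : ℂ) :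
    EuclideanSpace ℂ (Fin n) :=
  z + ((a + b) / 2 - z i) • EuclideanSpace.single i (1 : ℂ)
    + ((a - b) / (2 * I) - z j) • EuclideanSpace.single j (1 : ℂ)

theorem quadricPoint_self (i j : Fin n) (z : EuclideanSpace ℂ (Fin n)) :
    quadricPoint i j z (z i + I * z j) (z i - I * z j) = z := by
  have h1 : (z i + I * z j + (z i - I * z j)) / 2 - z i = 0 := by ring
  have h2 : (z i + I * z j - (z i - I * z j)) / (2 * I) - z j = 0 := by
    field_simp [Complex.I_ne_zero]
    ring
  rw [quadricPoint, h1, h2]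
  simp

theorem DifferentiableAt.quadricPoint {E : Type*} [NormedAddCommGroup E] [NormedSpace ℂ E]
    (i j : Fin n) {z : E → EuclideanSpace ℂ (Fin n)} {a b : E → ℂ} {x : E}
    (hz : DifferentiableAt ℂ z x) (ha : DifferentiableAt ℂ a x) (hb : DifferentiableAt ℂ b x) :
    DifferentiableAt ℂ (fun y ↦ quadricPoint i j (z y) (a y) (b y)) x := by
  unfold _root_.quadricPoint
  have hi : DifferentiableAt ℂ (fun y ↦ z y i) x :=
    (EuclideanSpace.proj (𝕜 := ℂ) i).differentiableAt.comp x hz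
  have hj : DifferentiableAt ℂ (fun y ↦ z y j) x :=
    (EuclideanSpace.proj (𝕜 := ℂ) j).differentiableAt.comp x hz
  fun_prop

theorem quadricPoint_mem_sphereTube {i j : Fin n} (hij : i ≠ j) {η : ℝ} (q s : ℝ)
    (hq : q ^ 2 ≤ η ^ 2) {w : ℂ} (hw : w ∈ sphere (0 : ℂ) 1) :
    quadricPoint i j (EuclideanSpace.single i (s : ℂ)) ((1 + q) * w) ((1 - q) * w⁻¹) ∈
      {z : EuclideanSpace ℂ (Fin n) |
        (∑ k : Fin n, ((z k).re) ^ 2 = 1) ∧ ∑ k : Fin n, ((z k).im) ^ 2 ≤ η ^ 2} := by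
  rw [mem_sphere_zero_iff_norm] at hw
  have hab : w.re ^ 2 + w.im ^ 2 = 1 := by
    have := Complex.sq_norm w
    rw [hw, Complex.normSq_apply] at this
    linarith
  have hinv : w⁻¹ = (starRingEnd ℂ) w := Complex.inv_eq_conj hw
  set z := quadricPoint i j (EuclideanSpace.single i (s : ℂ)) ((1 + q) * w) ((1 - q) * w⁻¹) with hz
  have hzi : z i = ⟨w.re, q * w.im⟩ := by
    have : z i = ((1 + q) * w + (1 - q) * w⁻¹) / 2 := by simp [hz, quadricPoint, hij]
    rw [this, hinv]
    apply Complex.ext <;> simp <;> ring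
  have hzj : z j = ⟨w.im, -q * w.re⟩ := by
    have : z j = ((1 + q) * w - (1 - q) * w⁻¹) * (-I / 2) := by
      have h : (2 * I)⁻¹ = -I / 2 := by rw [mul_inv, Complex.inv_I]; ring
      simp [hz, quadricPoint, hij.symm, div_eq_mul_inv, h, -mul_inv_rev]
    rw [this, hinv]
    apply Complex.ext <;> simp <;> ring
  have hzk : ∀ k, k ≠ i ∧ k ≠ j → z k = 0 := fun k hk ↦ by
    simp [hz, quadricPoint, hk.1, hk.2]
  constructor
  · rw [Fintype.sum_eq_add i j hij fun k hk ↦ by simp [hzk k hk], hzi, hzj]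
    exact hab
  · rw [Fintype.sum_eq_add i j hij fun k hk ↦ by simp [hzk k hk], hzi, hzj]
    simp only
    calc _ = q ^ 2 * (w.re ^ 2 + w.im ^ 2) := by ring
      _ ≤ η ^ 2 := by rw [hab, mul_one]; exact hq

/-- The half-difference `q` of the radii `1 ± q` bounding the annulus that the complex plane
through `z` parallel to the axes `i` and `j` cuts out of the quadric through `z`. -/
noncomputable def quadricRadius (i j : Fin n) (z : EuclideanSpace ℂ (Fin n)) : ℂ :=
  (1 - (z i + I * z j) * (z i - I * z j)) ^ (((2 : ℕ) : ℂ)⁻¹)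

theorem quadricRadius_sq (i j : Fin n) (z : EuclideanSpace ℂ (Fin n)) :
    (z i + I * z j) * (z i - I * z j) = (1 + quadricRadius i j z) * (1 - quadricRadius i j z) := by
  have : quadricRadius i j z ^ 2 = 1 - (z i + I * z j) * (z i - I * z j) :=
    Complex.cpow_nat_inv_pow _ two_ne_zero
  linear_combination this

theorem coord_add_mul_coord_sub_single {i j : Fin n} (hij : i ≠ j) (s : ℝ) :
    (1 : ℂ) - (EuclideanSpace.single i (s : ℂ) i + I * EuclideanSpace.single i (s : ℂ) j) *
      (EuclideanSpace.single i (s : ℂ) i - I * EuclideanSpace.single i (s : ℂ) j) =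
      ((1 - s ^ 2 : ℝ) : ℂ) := by
  simp [hij.symm]; ring

theorem quadricRadius_single {i j : Fin n} (hij : i ≠ j) {s : ℝ} (hs : s ^ 2 < 1) :
    quadricRadius i j (EuclideanSpace.single i (s : ℂ)) = (√(1 - s ^ 2) : ℝ) := by
  rw [quadricRadius, coord_add_mul_coord_sub_single hij, Real.sqrt_eq_rpow,
    Complex.ofReal_cpow (by linarith)]
  norm_num

theorem eventually_differentiableAt_quadricRadius {i j : Fin n} (hij : i ≠ j) {s : ℝ}
    (hs : s ^ 2 < 1) :
    ∀ᶠ z in 𝓝 (EuclideanSpace.single i (s : ℂ)), DifferentiableAt ℂ (quadricRadius i j) z := by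
  unfold quadricRadius
  have hmem : (1 : ℂ) - (EuclideanSpace.single i (s : ℂ) i +
      I * EuclideanSpace.single i (s : ℂ) j) * (EuclideanSpace.single i (s : ℂ) i -
      I * EuclideanSpace.single i (s : ℂ) j) ∈ Complex.slitPlane := by
    rw [coord_add_mul_coord_sub_single hij, Complex.ofReal_mem_slitPlane]
    linarith
  have hcont : Continuous fun z : EuclideanSpace ℂ (Fin n) ↦
      1 - (z i + I * z j) * (z i - I * z j) := by fun_prop
  filter_upwards [hcont.continuousAt.eventually_mem (Complex.isOpen_slitPlane.mem_nhds hmem)]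
    with z hz
  have h : ∀ k : Fin n, Differentiable ℂ fun z : EuclideanSpace ℂ (Fin n) ↦ z k :=
    fun k ↦ (EuclideanSpace.proj (𝕜 := ℂ) k).differentiable
  have hi := h i
  have hj := h j
  exact DifferentiableAt.cpow_const (by fun_prop) hz

/-- The Cauchy kernel for the annulus cut out of the quadric through `z`, with both boundary
circles parametrized by the unit circle. -/
noncomputable def quadricKernel (i j : Fin n) (f : EuclideanSpace ℂ (Fin n) → ℂ)
    (z : EuclideanSpace ℂ (Fin n)) (w : ℂ) : ℂ :=
  f (quadricPoint i j z ((1 + quadricRadius i j z) * w) ((1 - quadricRadius i j z) * w⁻¹)) *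
      ((1 + quadricRadius i j z) * w / ((1 + quadricRadius i j z) * w - (z i + I * z j))) +
    f (quadricPoint i j z ((1 - quadricRadius i j z) * w⁻¹) ((1 + quadricRadius i j z) * w)) *
      ((z i - I * z j) / ((1 + quadricRadius i j z) * w - (z i - I * z j)))

theorem circleAverage_quadricKernel {i j : Fin n} {f : EuclideanSpace ℂ (Fin n) → ℂ}
    {z : EuclideanSpace ℂ (Fin n)} (hq : quadricRadius i j z ≠ 1)
    (h₁ : ‖1 - quadricRadius i j z‖ < ‖z i + I * z j‖)
    (h₂ : ‖z i + I * z j‖ < ‖1 + quadricRadius i j z‖)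
    (hf : ∀ ζ : ℂ, ‖1 - quadricRadius i j z‖ ≤ ‖ζ‖ → ‖ζ‖ ≤ ‖1 + quadricRadius i j z‖ →
      DifferentiableAt ℂ f (quadricPoint i j z ζ ((z i + I * z j) * (z i - I * z j) / ζ))) :
    circleAverage (quadricKernel i j f z) 0 1 = f z := by
  have huv := quadricRadius_sq i j z
  have hself := quadricPoint_self i j z
  unfold quadricKernel
  set q := quadricRadius i j z
  set u := z i + I * z j
  set v := z i - I * z j
  have hr : 0 < ‖1 - q‖ := norm_pos_iff.2 (sub_ne_zero.2 hq.symm)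
  have hu0 : u ≠ 0 := norm_pos_iff.1 (hr.trans h₁)
  have hR0 : 1 + q ≠ 0 := norm_pos_iff.1 (hr.trans (h₁.trans h₂))
  have hr0 : 1 - q ≠ 0 := norm_pos_iff.1 hr
  set g : ℂ → ℂ := fun ζ ↦ f (quadricPoint i j z ζ (u * v / ζ)) with hgdef
  have hg : ∀ ζ : ℂ, ‖1 - q‖ ≤ ‖ζ‖ → ‖ζ‖ ≤ ‖1 + q‖ → DifferentiableAt ℂ g ζ := by
    intro ζ hζ1 hζ2
    have hζ0 : ζ ≠ 0 := norm_pos_iff.1 (hr.trans_le hζ1)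
    exact (hf ζ hζ1 hζ2).comp ζ (.quadricPoint i j (by fun_prop) (by fun_prop)
      (by fun_prop (disch := assumption)))
  set k : ℂ → ℂ := fun ζ ↦ g ζ * (ζ / (ζ - u)) with hkdef
  have hk : ∀ ζ : ℂ, ‖1 - q‖ ≤ ‖ζ‖ → ‖ζ‖ ≤ ‖1 + q‖ → ζ ≠ u → ContinuousAt k ζ := by
    intro ζ hζ1 hζ2 hne
    have := sub_ne_zero.2 hne
    have := (hg ζ hζ1 hζ2).continuousAt
    fun_prop (disch := assumption)
  have hle : ‖1 - q‖ ≤ ‖1 + q‖ := (h₁.trans h₂).le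
  have houter : ∀ w ∈ sphere (0 : ℂ) 1, (1 + q) * w ≠ u := fun w hw h ↦ by
    rw [mem_sphere_zero_iff_norm] at hw
    rw [← h, norm_mul, hw, mul_one] at h₂
    exact h₂.false
  have hinner : ∀ w ∈ sphere (0 : ℂ) 1, (1 - q) * w ≠ u := fun w hw h ↦ by
    rw [mem_sphere_zero_iff_norm] at hw
    rw [← h, norm_mul, hw, mul_one] at h₁
    exact h₁.false
  have hA : CircleIntegrable (fun w ↦ k ((1 + q) * w)) 0 1 := by
    refine ContinuousOn.circleIntegrable zero_le_one fun w hw ↦ ContinuousAt.continuousWithinAt ?_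
    have hn : ‖(1 + q) * w‖ = ‖1 + q‖ := by
      rw [norm_mul, mem_sphere_zero_iff_norm.1 hw, mul_one]
    exact (hk _ (hn ▸ hle) hn.le (houter w hw)).comp (f := fun w ↦ (1 + q) * w) (by fun_prop)
  have hB : CircleIntegrable (fun w ↦ k ((1 - q) * w⁻¹)) 0 1 := by
    refine ContinuousOn.circleIntegrable zero_le_one fun w hw ↦ ContinuousAt.continuousWithinAt ?_
    have hw0 : w ≠ 0 := ne_zero_of_mem_unit_sphere ⟨w, hw⟩
    have hw' : w⁻¹ ∈ sphere (0 : ℂ) 1 := by simpa using hw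
    have hn : ‖(1 - q) * w⁻¹‖ = ‖1 - q‖ := by
      rw [norm_mul, mem_sphere_zero_iff_norm.1 hw', mul_one]
    exact (hk _ hn.ge (hn ▸ hle) (hinner _ hw')).comp (f := fun w ↦ (1 - q) * w⁻¹)
      (by fun_prop (disch := assumption))
  have hcongr : circleAverage (fun w ↦ f (quadricPoint i j z ((1 + q) * w) ((1 - q) * w⁻¹)) *
      ((1 + q) * w / ((1 + q) * w - u)) +
      f (quadricPoint i j z ((1 - q) * w⁻¹) ((1 + q) * w)) * (v / ((1 + q) * w - v))) 0 1 =
      circleAverage (fun w ↦ k ((1 + q) * w) - k ((1 - q) * w⁻¹)) 0 1 := by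
    refine circleAverage_congr_sphere fun w hw ↦ ?_
    rw [abs_one] at hw
    have hw0 : w ≠ 0 := ne_zero_of_mem_unit_sphere ⟨w, hw⟩
    have hw' : w⁻¹ ∈ sphere (0 : ℂ) 1 := by simpa using hw
    have e1 : u * v / ((1 + q) * w) = (1 - q) * w⁻¹ := by rw [huv]; field_simp
    have e2 : u * v / ((1 - q) * w⁻¹) = (1 + q) * w := by rw [huv]; field_simp
    have hne := sub_ne_zero.2 (hinner _ hw')
    have e3 : v / ((1 + q) * w - v) = -((1 - q) * w⁻¹ / ((1 - q) * w⁻¹ - u)) := by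
      have hv : v = (1 + q) * (1 - q) / u := by rw [← huv]; field_simp
      have h3 : (1 + q) * w - v = -((1 + q) * w * ((1 - q) * w⁻¹ - u) / u) := by
        rw [hv]; field_simp; ring
      rw [h3, hv]
      field_simp
    simp only [hkdef, hgdef, e1, e2, e3]
    ring
  rw [hcongr, circleAverage_fun_sub hA hB, circleAverage_comp_mul_left,
    ← circleAverage_zero_one_congr_inv (f := fun w ↦ k ((1 - q) * w⁻¹))]
  simp only [inv_inv]
  rw [circleAverage_comp_mul_left, circleAverage_sub_circleAverage_eq hr h₁ h₂ hg]
  simp only [hgdef, mul_div_cancel_left₀ v hu0, hself]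

theorem continuous_single_ofReal (i : Fin n) : Continuous fun t : ℝ ↦
    (EuclideanSpace.single i (t : ℂ) : EuclideanSpace ℂ (Fin n)) := by
  have h : (fun t : ℝ ↦ (EuclideanSpace.single i (t : ℂ) : EuclideanSpace ℂ (Fin n))) =
      fun t : ℝ ↦ (t : ℂ) • EuclideanSpace.single i (1 : ℂ) := by
    ext t
    simp
  rw [h]
  fun_prop

theorem eventually_differentiableAt_quadricKernel {i j : Fin n} (hij : i ≠ j) {s η : ℝ}
    (hs₀ : 0 ≤ s) (hs₁ : s < 1) (hη : 1 ≤ η) {Ω : Set (EuclideanSpace ℂ (Fin n))}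
    (hΩ : IsOpen Ω) (hTΩ : {z : EuclideanSpace ℂ (Fin n) | (∑ k : Fin n, ((z k).re) ^ 2 = 1) ∧
      ∑ k : Fin n, ((z k).im) ^ 2 ≤ η ^ 2} ⊆ Ω)
    {f : EuclideanSpace ℂ (Fin n) → ℂ} (hf : DifferentiableOn ℂ f Ω) {w : ℂ}
    (hw : w ∈ sphere (0 : ℂ) 1) :
    ∀ᶠ p in 𝓝 (EuclideanSpace.single i (s : ℂ), w),
      DifferentiableAt ℂ (Function.uncurry (quadricKernel i j f)) p := by
  have hs2 : s ^ 2 < 1 := by nlinarith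
  set z₀ : EuclideanSpace ℂ (Fin n) := EuclideanSpace.single i (s : ℂ) with hz₀
  set r : ℝ := √(1 - s ^ 2) with hr
  have hr0 : 0 < r := Real.sqrt_pos.2 (by linarith)
  have hr2 : r ^ 2 = 1 - s ^ 2 := Real.sq_sqrt (by linarith)
  have hw0 : w ≠ 0 := ne_zero_of_mem_unit_sphere ⟨w, hw⟩
  have hw1 : ‖w‖ = 1 := mem_sphere_zero_iff_norm.1 hw
  have hq : quadricRadius i j z₀ = r := quadricRadius_single hij hs2
  have hcoord : ∀ k : Fin n, Differentiable ℂ fun p : EuclideanSpace ℂ (Fin n) × ℂ ↦ p.1 k :=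
    fun k ↦ (EuclideanSpace.proj (𝕜 := ℂ) k).differentiable.comp differentiable_fst
  have hi := hcoord i
  have hj := hcoord j
  have hQ : ∀ᶠ p in 𝓝 (z₀, w), DifferentiableAt ℂ
      (fun p : EuclideanSpace ℂ (Fin n) × ℂ ↦ quadricRadius i j p.1) p := by
    filter_upwards [continuousAt_fst.eventually
      (eventually_differentiableAt_quadricRadius hij hs2)] with p hp
    exact hp.comp p differentiableAt_fst
  have hinv : ∀ᶠ p in 𝓝 (z₀, w), p.2 ≠ 0 := continuousAt_snd.eventually_ne hw0
  have hP₁ : ∀ᶠ p in 𝓝 (z₀, w), DifferentiableAt ℂ (fun p : EuclideanSpace ℂ (Fin n) × ℂ ↦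
      quadricPoint i j p.1 ((1 + quadricRadius i j p.1) * p.2)
        ((1 - quadricRadius i j p.1) * p.2⁻¹)) p := by
    filter_upwards [hQ, hinv] with p hp hp0
    exact .quadricPoint i j (by fun_prop) (by fun_prop) (by fun_prop (disch := assumption))
  have hP₂ : ∀ᶠ p in 𝓝 (z₀, w), DifferentiableAt ℂ (fun p : EuclideanSpace ℂ (Fin n) × ℂ ↦
      quadricPoint i j p.1 ((1 - quadricRadius i j p.1) * p.2⁻¹)
        ((1 + quadricRadius i j p.1) * p.2)) p := by
    filter_upwards [hQ, hinv] with p hp hp0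
    exact .quadricPoint i j (by fun_prop) (by fun_prop (disch := assumption)) (by fun_prop)
  have hrη : r ^ 2 ≤ η ^ 2 := by nlinarith
  have hm₁ : quadricPoint i j z₀ ((1 + quadricRadius i j z₀) * w)
      ((1 - quadricRadius i j z₀) * w⁻¹) ∈ Ω := by
    rw [hq]
    exact hTΩ (quadricPoint_mem_sphereTube hij r s hrη hw)
  have hm₂ : quadricPoint i j z₀ ((1 - quadricRadius i j z₀) * w⁻¹)
      ((1 + quadricRadius i j z₀) * w) ∈ Ω := by
    rw [hq]
    have := quadricPoint_mem_sphereTube hij (-r) s (η := η) (by simpa using hrη)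
      (w := w⁻¹) (by simpa using hw)
    simp only [Complex.ofReal_neg, inv_inv, sub_neg_eq_add, ← sub_eq_add_neg] at this
    exact hTΩ this
  have hden : ∀ x : ℂ, ‖x‖ = s → (1 + quadricRadius i j z₀) * w - x ≠ 0 := by
    intro x hx h
    have h1 : ‖(1 + quadricRadius i j z₀) * w‖ = 1 + r := by
      rw [norm_mul, hw1, mul_one, hq, ← Complex.ofReal_one, ← Complex.ofReal_add,
        Complex.norm_of_nonneg (by linarith)]
    rw [sub_eq_zero.1 h, hx] at h1
    linarith
  have hd₁ : (1 + quadricRadius i j z₀) * w - (z₀ i + I * z₀ j) ≠ 0 := hden _ <| by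
    simp [hz₀, hij.symm, abs_of_nonneg hs₀]
  have hd₂ : (1 + quadricRadius i j z₀) * w - (z₀ i - I * z₀ j) ≠ 0 := hden _ <| by
    simp [hz₀, hij.symm, abs_of_nonneg hs₀]
  have hQ₀ := hQ.self_of_nhds.continuousAt
  have hci := hi.continuous
  have hcj := hj.continuous
  have hd₁' : ∀ᶠ p in 𝓝 (z₀, w), (1 + quadricRadius i j p.1) * p.2 - (p.1 i + I * p.1 j) ≠ 0 :=
    ContinuousAt.eventually_ne (by fun_prop) hd₁
  have hd₂' : ∀ᶠ p in 𝓝 (z₀, w), (1 + quadricRadius i j p.1) * p.2 - (p.1 i - I * p.1 j) ≠ 0 :=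
    ContinuousAt.eventually_ne (by fun_prop) hd₂
  filter_upwards [hQ, hinv, hP₁, hP₂, hd₁', hd₂',
    hP₁.self_of_nhds.continuousAt.eventually_mem (hΩ.mem_nhds hm₁),
    hP₂.self_of_nhds.continuousAt.eventually_mem (hΩ.mem_nhds hm₂)]
    with p hQp hp0 hP₁p hP₂p hd₁p hd₂p hm₁p hm₂p
  have hf₁ := (hf.differentiableAt (hΩ.mem_nhds hm₁p)).comp p hP₁p
  have hf₂ := (hf.differentiableAt (hΩ.mem_nhds hm₂p)).comp p hP₂p
  simp only [Function.comp_def] at hf₁ hf₂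
  exact (hf₁.mul (by fun_prop (disch := assumption))).add
    (hf₂.mul (by fun_prop (disch := assumption)))

theorem eventually_quadricPoint_mem {i j : Fin n} (hij : i ≠ j) {η : ℝ}
    {Ω : Set (EuclideanSpace ℂ (Fin n))} (hΩ : IsOpen Ω)
    (hTΩ : {z : EuclideanSpace ℂ (Fin n) | (∑ k : Fin n, ((z k).re) ^ 2 = 1) ∧
      ∑ k : Fin n, ((z k).im) ^ 2 ≤ η ^ 2} ⊆ Ω) :
    ∀ᶠ p : EuclideanSpace ℂ (Fin n) × ℝ in 𝓝 (EuclideanSpace.single i 1, 1),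
      ∀ w ∈ sphere (0 : ℂ) 1, quadricPoint i j p.1 (p.2 * w)
        ((p.1 i + I * p.1 j) * (p.1 i - I * p.1 j) / (p.2 * w)) ∈ Ω := by
  refine (isCompact_sphere (0 : ℂ) 1).eventually_forall_of_forall_eventually fun w hw ↦ ?_
  have hw0 : w ≠ 0 := ne_zero_of_mem_unit_sphere ⟨w, hw⟩
  refine ContinuousAt.eventually_mem (f := fun p : (EuclideanSpace ℂ (Fin n) × ℝ) × ℂ ↦
    quadricPoint i j p.1.1 (p.1.2 * p.2)
      ((p.1.1 i + I * p.1.1 j) * (p.1.1 i - I * p.1.1 j) / (p.1.2 * p.2))) ?_ (hΩ.mem_nhds ?_)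
  · unfold quadricPoint
    have : ((1 : ℝ) : ℂ) * w ≠ 0 := by simpa using hw0
    fun_prop (disch := assumption)
  · have := quadricPoint_mem_sphereTube hij 0 1 (η := η) (by simpa using sq_nonneg η) hw
    refine hTΩ ?_
    simpa [hij.symm] using this

theorem exists_eventually_circleAverage_quadricKernel_eq {i j : Fin n} (hij : i ≠ j) {η : ℝ}
    {Ω : Set (EuclideanSpace ℂ (Fin n))} (hΩ : IsOpen Ω)
    (hTΩ : {z : EuclideanSpace ℂ (Fin n) | (∑ k : Fin n, ((z k).re) ^ 2 = 1) ∧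
      ∑ k : Fin n, ((z k).im) ^ 2 ≤ η ^ 2} ⊆ Ω)
    {f : EuclideanSpace ℂ (Fin n) → ℂ} (hf : DifferentiableOn ℂ f Ω) :
    ∃ s : ℝ, 0 < s ∧ s < 1 ∧
      (∀ t ∈ Icc s 1, (EuclideanSpace.single i (t : ℂ) : EuclideanSpace ℂ (Fin n)) ∈ Ω) ∧
      ∀ᶠ z in 𝓝 (EuclideanSpace.single i (s : ℂ)),
        circleAverage (quadricKernel i j f z) 0 1 = f z := by
  have he : (EuclideanSpace.single i ((1 : ℝ) : ℂ) : EuclideanSpace ℂ (Fin n)) ∈ Ω := by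
    have := quadricPoint_mem_sphereTube hij 0 1 (η := η) (by simpa using sq_nonneg η)
      (w := 1) (by simp)
    refine hTΩ ?_
    have h2 := quadricPoint_self i j (EuclideanSpace.single i ((1 : ℝ) : ℂ))
    simp only [Complex.ofReal_zero, add_zero, sub_zero, mul_one, inv_one] at this
    rw [← h2]
    simpa [hij.symm] using this
  have hsc : Continuous fun t : ℝ ↦
      (EuclideanSpace.single i (t : ℂ) : EuclideanSpace ℂ (Fin n)) :=
    continuous_single_ofReal i
  obtain ⟨ε, hε, hεΩ⟩ := Metric.eventually_nhds_iff_ball.1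
    (hsc.continuousAt.eventually_mem (hΩ.mem_nhds he))
  obtain ⟨κ, hκ, hκΩ⟩ := Metric.eventually_nhds_iff_ball.1 (eventually_quadricPoint_mem hij hΩ hTΩ)
  have hE : ∀ᶠ t : ℝ in 𝓝[<] 1, t ∈ Ioo 0 1 ∧ t ∈ ball 1 ε ∧ √(1 - t ^ 2) < min κ 1 ∧
      (EuclideanSpace.single i (t : ℂ) : EuclideanSpace ℂ (Fin n)) ∈
        ball (EuclideanSpace.single i 1) κ := by
    have h3 : Continuous fun t : ℝ ↦ √(1 - t ^ 2) := by fun_prop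
    refine Filter.inter_mem (Ioo_mem_nhdsLT zero_lt_one) (nhdsWithin_le_nhds ?_)
    refine Filter.inter_mem (ball_mem_nhds _ hε) (Filter.inter_mem ?_ ?_)
    · exact h3.continuousAt.eventually_lt_const (by simpa using hκ)
    · exact hsc.continuousAt.eventually_mem (isOpen_ball.mem_nhds (by simpa using hκ))
  obtain ⟨s, ⟨hs0, hs1⟩, hsε, hsκ, hsB⟩ := hE.exists
  refine ⟨s, hs0, hs1, fun t ht ↦ hεΩ t ?_, ?_⟩
  · rw [mem_ball, Real.dist_eq, abs_lt] at hsε ⊢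
    constructor <;> linarith [ht.1, ht.2]
  have hs2 : s ^ 2 < 1 := by nlinarith
  set z₀ : EuclideanSpace ℂ (Fin n) := EuclideanSpace.single i (s : ℂ) with hz₀
  have hq : quadricRadius i j z₀ = (√(1 - s ^ 2) : ℝ) := quadricRadius_single hij hs2
  have hr0 : 0 < √(1 - s ^ 2) := Real.sqrt_pos.2 (by linarith)
  have hr2 : √(1 - s ^ 2) ^ 2 = 1 - s ^ 2 := Real.sq_sqrt (by linarith)
  set r : ℝ := √(1 - s ^ 2)
  obtain ⟨hrκ, hr1⟩ := lt_min_iff.1 hsκ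
  have hQ := (eventually_differentiableAt_quadricRadius hij hs2).self_of_nhds.continuousAt
  have hu : ‖z₀ i + I * z₀ j‖ = s := by simp [hz₀, hij.symm, abs_of_pos hs0]
  have hn₁ : ‖1 - quadricRadius i j z₀‖ = 1 - r := by
    rw [hq, ← Complex.ofReal_one, ← Complex.ofReal_sub, Complex.norm_of_nonneg (by linarith)]
  have hn₂ : ‖1 + quadricRadius i j z₀‖ = 1 + r := by
    rw [hq, ← Complex.ofReal_one, ← Complex.ofReal_add, Complex.norm_of_nonneg (by linarith)]
  have e1 : ∀ᶠ z in 𝓝 z₀, quadricRadius i j z ≠ 1 :=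
    hQ.eventually_ne (by rw [hq]; exact_mod_cast hr1.ne)
  have e2 : ∀ᶠ z in 𝓝 z₀, ‖1 - quadricRadius i j z‖ < ‖z i + I * z j‖ :=
    ContinuousAt.eventually_lt (by fun_prop) (by fun_prop) (by rw [hn₁, hu]; nlinarith)
  have e3 : ∀ᶠ z in 𝓝 z₀, ‖z i + I * z j‖ < ‖1 + quadricRadius i j z‖ :=
    ContinuousAt.eventually_lt (by fun_prop) (by fun_prop) (by rw [hn₂, hu]; linarith)
  have e4 : ∀ᶠ z in 𝓝 z₀, ‖quadricRadius i j z‖ < κ :=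
    hQ.norm.eventually_lt_const <| by
      change ‖quadricRadius i j z₀‖ < κ
      rwa [hq, Complex.norm_of_nonneg hr0.le]
  filter_upwards [e1, e2, e3, e4, isOpen_ball.mem_nhds hsB] with z h1 h2 h3 h4 h5
  refine circleAverage_quadricKernel h1 h2 h3 fun ζ hζ1 hζ2 ↦
    hf.differentiableAt (hΩ.mem_nhds ?_)
  have hζ : 0 < ‖ζ‖ := (norm_pos_iff.2 (sub_ne_zero.2 h1.symm)).trans_le hζ1
  have hζ0 : (‖ζ‖ : ℂ) ≠ 0 := by exact_mod_cast hζ.ne'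
  have hρ : ‖ζ‖ ∈ ball (1 : ℝ) κ := by
    have t1 := norm_sub_norm_le (1 : ℂ) (quadricRadius i j z)
    have t2 := norm_add_le (1 : ℂ) (quadricRadius i j z)
    rw [norm_one] at t1 t2
    rw [mem_ball, Real.dist_eq, abs_lt]
    constructor <;> linarith
  have := hκΩ (z, ‖ζ‖) (by rw [mem_ball, Prod.dist_eq]; exact max_lt h5 hρ) (ζ / ‖ζ‖)
    (by simp [hζ.ne'])
  simpa [mul_div_cancel₀ _ hζ0] using this

end

/-- The key claim (2.9)–(2.12) inside Case 2 of Lemma 2.2 of the paper: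
the envelope of holomorphy of the compact "tube torus"
`T = { z ∈ ℂⁿ : Σ (Re z_j)² = 1, Σ (Im z_j)² ≤ η² }` contains the origin.
Any function holomorphic on a neighborhood `Ω` of `T` continues analytically,
along the family of quadrics `C_t = { z : z₁² + ⋯ + z_n² = t }`, to a
connected open set `W` containing `T` and the origin. -/
theorem stmt_2 (n : ℕ) (hn : 2 ≤ n) (η : ℝ) (hη : 1 < η)
    (T : Set (EuclideanSpace ℂ (Fin n)))
    (hT : T = {z | (∑ j : Fin n, ((z j).re) ^ 2 = 1) ∧
      ∑ j : Fin n, ((z j).im) ^ 2 ≤ η ^ 2})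
    (Ω : Set (EuclideanSpace ℂ (Fin n))) (hΩ : IsOpen Ω) (hTΩ : T ⊆ Ω)
    (f : EuclideanSpace ℂ (Fin n) → ℂ) (hf : DifferentiableOn ℂ f Ω) :
    ∃ W : Set (EuclideanSpace ℂ (Fin n)), IsOpen W ∧ IsConnected W ∧
      T ∪ {0} ⊆ W ∧
      ∃ F : EuclideanSpace ℂ (Fin n) → ℂ, DifferentiableOn ℂ F W ∧
        ∃ V : Set (EuclideanSpace ℂ (Fin n)), V.Nonempty ∧ IsOpen V ∧
          V ⊆ W ∩ Ω ∧ Set.EqOn F f V := by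
  subst hT
  set T : Set (EuclideanSpace ℂ (Fin n)) := {z | (∑ j : Fin n, ((z j).re) ^ 2 = 1) ∧
      ∑ j : Fin n, ((z j).im) ^ 2 ≤ η ^ 2}
  obtain ⟨hTc, hTconn⟩ := isCompact_and_isConnected_sphereTube hn (η := η) (by linarith)
  set i : Fin n := ⟨0, by omega⟩
  set j : Fin n := ⟨1, by omega⟩
  have hij : i ≠ j := by simp [i, j]
  obtain ⟨s, hs0, hs1, hsΩ, hsB⟩ :=
    exists_eventually_circleAverage_quadricKernel_eq hij hΩ hTΩ hf
  set e : ℝ → EuclideanSpace ℂ (Fin n) := fun t ↦ EuclideanSpace.single i (t : ℂ) with he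
  have hec : Continuous e := continuous_single_ofReal i
  have heinj : Function.Injective e := fun a b hab ↦ by
    have := congrArg (fun z : EuclideanSpace ℂ (Fin n) ↦ (z i).re) hab
    simpa [he] using this
  have heT : ∀ t ∈ Icc (0 : ℝ) s, e t ∉ T := by
    rintro t ⟨ht0, ht1⟩ ⟨h, -⟩
    rw [Finset.sum_eq_single i (fun k _ hk ↦ by simp [he, hk]) (by simp)] at h
    simp only [he, PiLp.single_apply, if_true, Complex.ofReal_re] at h
    nlinarith
  have h1T : e 1 ∈ T := by
    constructor
    · rw [Finset.sum_eq_single i (fun k _ hk ↦ by simp [he, hk]) (by simp)]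
      simp [he]
    · rw [Finset.sum_eq_zero fun k _ ↦ by by_cases hk : k = i <;> simp [he, hk]]
      positivity
  set F : EuclideanSpace ℂ (Fin n) → ℂ := fun z ↦ circleAverage (quadricKernel i j f z) 0 1
  set K := T ∪ e '' Icc s 1
  set L := e '' Icc 0 s
  have hK : IsCompact K := hTc.union (isCompact_Icc.image hec)
  have hL : IsCompact L := isCompact_Icc.image hec
  have hKL : K ∩ L ⊆ {e s} := by
    rintro _ ⟨hzK, t, ht, rfl⟩
    rcases hzK with hzT | ⟨t', ht', htt⟩
    · exact absurd hzT (heT t ht)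
    · have := heinj htt
      rw [mem_singleton_iff, le_antisymm ht.2 (this ▸ ht'.1)]
  have hagree : {z | F z = f z} ∈ 𝓝ˢ K ⊓ 𝓝ˢ L := by
    rw [← hK.nhdsSet_inter_eq hL]
    exact nhdsSet_mono hKL (by rwa [nhdsSet_singleton])
  obtain ⟨A, hA, B, hB, hAB⟩ := Filter.mem_inf_iff.1 hagree
  have hKΩ : K ⊆ Ω := union_subset hTΩ (by rintro _ ⟨t, ht, rfl⟩; exact hsΩ t ht)
  have hFL : {z | DifferentiableAt ℂ F z} ∈ 𝓝ˢ L := by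
    rw [mem_nhdsSet_iff_forall]
    rintro _ ⟨t, ht, rfl⟩
    exact eventually_differentiableAt_circleAverage fun w hw ↦
      eventually_differentiableAt_quadricKernel hij ht.1 (ht.2.trans_lt hs1) hη.le hΩ hTΩ hf hw
  obtain ⟨δ₁, hδ₁, hA'⟩ := (hasBasis_nhdsSet_thickening hK).mem_iff.1
    (Filter.inter_mem hA (hΩ.mem_nhdsSet.2 hKΩ))
  obtain ⟨δ₂, hδ₂, hB'⟩ := (hasBasis_nhdsSet_thickening hL).mem_iff.1
    (Filter.inter_mem hB hFL)
  set δ := min δ₁ δ₂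
  have hδ : 0 < δ := lt_min hδ₁ hδ₂
  have hKs : thickening δ K ⊆ A ∩ Ω := (thickening_mono (min_le_left _ _) K).trans hA'
  have hLs : thickening δ L ⊆ B ∩ {z | DifferentiableAt ℂ F z} :=
    (thickening_mono (min_le_right _ _) L).trans hB'
  classical
  set H : EuclideanSpace ℂ (Fin n) → ℂ := (thickening δ L).piecewise F f
  have hHL : EqOn H F (thickening δ L) := piecewise_eqOn _ _ _
  have hHK : EqOn H f (thickening δ K) := by
    intro z hz
    by_cases hzL : z ∈ thickening δ L
    · have : z ∈ A ∩ B := ⟨(hKs hz).1, (hLs hzL).1⟩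
      rw [← hAB] at this
      exact (hHL hzL).trans this
    · exact piecewise_eq_of_notMem _ _ _ hzL
  have hsL : e s ∈ L := ⟨s, ⟨hs0.le, le_rfl⟩, rfl⟩
  have hsK : e s ∈ K := Or.inr ⟨s, ⟨le_rfl, hs1.le⟩, rfl⟩
  have hKconn : IsConnected K := hTconn.union ⟨e 1, h1T, 1, ⟨hs1.le, le_rfl⟩, rfl⟩
    ((isConnected_Icc hs1.le).image _ hec.continuousOn)
  have hLconn : IsConnected L := (isConnected_Icc hs0.le).image _ hec.continuousOn
  refine ⟨thickening δ (K ∪ L), isOpen_thickening, isConnected_thickening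
    (hKconn.union ⟨e s, hsK, hsL⟩ hLconn) hδ, ?_, H, ?_, thickening δ K, ?_, isOpen_thickening,
    ?_, hHK⟩
  · refine Subset.trans (union_subset ?_ ?_) (self_subset_thickening hδ _)
    · exact subset_union_left.trans subset_union_left
    · rw [singleton_subset_iff]
      exact Or.inr ⟨0, ⟨le_rfl, hs0.le⟩, by simp [he]⟩
  · rw [thickening_union]
    rintro z (hz | hz)
    · have hev := hHK.eventuallyEq_of_mem (isOpen_thickening.mem_nhds hz)
      exact ((hf.differentiableAt (hΩ.mem_nhds (hKs hz).2)).congr_of_eventuallyEq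
        hev).differentiableWithinAt
    · have hev := hHL.eventuallyEq_of_mem (isOpen_thickening.mem_nhds hz)
      exact ((show DifferentiableAt ℂ F z from (hLs hz).2).congr_of_eventuallyEq
        hev).differentiableWithinAt
  · exact ⟨e s, self_subset_thickening hδ _ hsK⟩
  · exact subset_inter (thickening_subset_of_subset _ subset_union_left)
      (hKs.trans inter_subset_right)
end

section
/- Let n ≥ 2, let (q_{jk}) be a symmetric n × n complex matrix and Q(z) = Σ_{j,k=1}^n q_{jk} z_j z_k the associated holomorphic quadratic form, let C ≥ 0, and let ρ : ℂⁿ → ℝ be a function satisfying |ρ(z) − (2 Re Q(z) + ‖z‖²)| ≤ C‖z‖³ for all z with ‖z‖ < 1. Then there exists r ∈ (0,1) with the following property: for every function f holomorphic on D_r = { z ∈ ℂⁿ : ‖z‖ < r and ρ(z) > 0 } there exist an open neighborhood U of the origin, a nonempty open set V ⊆ U ∩ D_r with 0 in the closure of V, and a function F holomorphic on U such that F = f on V. -/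
open Metric Set Filter Topology

/-- An integral over a compact interval of functions depending holomorphically on a
finite-dimensional parameter is holomorphic in the parameter. -/
theorem differentiableOn_intervalIntegral_of_continuousOn {E : Type*} [NormedAddCommGroup E]
    [NormedSpace ℂ E] [FiniteDimensional ℂ E] {U : Set E} (hU : IsOpen U) {k : ℝ → E → ℂ}
    (a b : ℝ) (hc : ContinuousOn (Function.uncurry k) (univ ×ˢ U))
    (hd : ∀ t, DifferentiableOn ℂ (k t) U) :
    DifferentiableOn ℂ (fun z => ∫ t in a..b, k t z) U := by
  have : ProperSpace E := FiniteDimensional.proper ℂ E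
  intro z₀ hz₀
  obtain ⟨ε, hε, hball⟩ := Metric.nhds_basis_closedBall.mem_iff.1 (hU.mem_nhds hz₀)
  have hdball : ∀ t z, z ∈ ball z₀ ε → DifferentiableAt ℂ (k t) z := fun t z hz =>
    (hd t).differentiableAt (hU.mem_nhds (hball (ball_subset_closedBall hz)))
  have hcball : ContinuousOn (Function.uncurry k) (univ ×ˢ closedBall z₀ ε) :=
    hc.mono (prod_mono le_rfl hball)
  have hct : ∀ z ∈ U, Continuous fun t => k t z := fun z hz =>
    hc.comp_continuous (f := fun t : ℝ => (t, z)) (by fun_prop) (fun t => ⟨mem_univ _, hz⟩)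
  obtain ⟨M, hM⟩ := (isCompact_uIcc.prod (isCompact_closedBall z₀ ε)).exists_bound_of_continuousOn
    (hcball.mono (prod_mono (subset_univ (uIcc a b)) le_rfl))
  have hM' : ∀ t ∈ uIcc a b, ∀ z ∈ closedBall z₀ ε, ‖k t z‖ ≤ M := fun t ht z hz =>
    hM (t, z) ⟨ht, hz⟩
  have hcont : Continuous fun t => fderiv ℂ (k t) z₀ := by
    rw [continuous_iff_continuousAt]
    intro t₀
    rw [ContinuousAt, Metric.tendsto_nhds]
    intro η hη
    obtain ⟨v, hv, hvk⟩ := (isCompact_closedBall z₀ ε).mem_uniformity_of_prod hcball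
      (mem_univ t₀) (Metric.dist_mem_uniformity (show 0 < η * ε / 4 by positivity))
    rw [nhdsWithin_univ] at hv
    filter_upwards [hv] with t ht
    have hz₀' : z₀ ∈ ball z₀ ε := mem_ball_self hε
    have hmaps : MapsTo (fun z => k t z - k t₀ z) (ball z₀ ε)
        (closedBall (k t z₀ - k t₀ z₀) (η * ε / 2)) := by
      intro z hz
      have h1 := hvk t ht z (ball_subset_closedBall hz)
      have h2 := hvk t ht z₀ (ball_subset_closedBall hz₀')
      simp only [mem_ofPred_eq, dist_eq_norm] at h1 h2
      rw [mem_closedBall, dist_eq_norm]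
      linarith [norm_sub_le (k t z - k t₀ z) (k t z₀ - k t₀ z₀)]
    have h := Complex.norm_fderiv_le_div_of_mapsTo_ball (f := fun z => k t z - k t₀ z)
      (fun z hz => ((hdball t z hz).sub (hdball t₀ z hz)).differentiableWithinAt) hmaps hε
    rw [fderiv_fun_sub (hdball t _ hz₀') (hdball t₀ _ hz₀')] at h
    rw [dist_eq_norm]
    refine h.trans_lt ?_
    have : η * ε / 2 / ε = η / 2 := by field_simp
    linarith
  have hlip : ∀ t ∈ uIoc a b, ∀ z ∈ ball z₀ (ε / 2), ‖fderiv ℂ (k t) z‖ ≤ 2 * M / (ε / 2) := by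
    intro t ht z hz
    have hsub : ball z (ε / 2) ⊆ ball z₀ ε := ball_subset_ball' (by
      rw [mem_ball] at hz; linarith)
    refine Complex.norm_fderiv_le_div_of_mapsTo_ball
      (fun y hy => (hdball t y (hsub hy)).differentiableWithinAt) (fun y hy => ?_) (by positivity)
    have h1 := hM' t (uIoc_subset_uIcc ht) y (ball_subset_closedBall (hsub hy))
    have h2 := hM' t (uIoc_subset_uIcc ht) z
      (ball_subset_closedBall (hsub (mem_ball_self (by positivity))))
    rw [mem_closedBall, dist_eq_norm]
    linarith [norm_sub_le (k t y) (k t z)]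
  refine (intervalIntegral.hasFDerivAt_integral_of_dominated_of_fderiv_le
    (F := fun z t => k t z) (F' := fun z t => fderiv ℂ (k t) z) (bound := fun _ => 2 * M / (ε / 2))
    (ball_mem_nhds z₀ (half_pos hε)) ?_ ((hct z₀ hz₀).intervalIntegrable _ _)
    hcont.aestronglyMeasurable ?_ intervalIntegrable_const
    ?_).differentiableAt.differentiableWithinAt
  · filter_upwards [hU.mem_nhds hz₀] with z hz using (hct z hz).aestronglyMeasurable
  · exact .of_forall hlip
  · exact .of_forall fun t _ z hz =>
      (hdball t z (ball_subset_ball (by linarith) hz)).hasFDerivAt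

theorem differentiableOn_circleIntegral_of_continuousOn {E : Type*} [NormedAddCommGroup E]
    [NormedSpace ℂ E] [FiniteDimensional ℂ E] {U : Set E} (hU : IsOpen U) {h : ℂ → E → ℂ}
    {c : ℂ} {R : ℝ} (hR : 0 ≤ R) (hc : ContinuousOn (Function.uncurry h) (sphere c R ×ˢ U))
    (hd : ∀ s ∈ sphere c R, DifferentiableOn ℂ (h s) U) :
    DifferentiableOn ℂ (fun z => ∮ s in C(c, R), h s z) U := by
  refine differentiableOn_intervalIntegral_of_continuousOn hU 0 (2 * Real.pi)
    (k := fun t z => deriv (circleMap c R) t * h (circleMap c R t) z) ?_ fun t =>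
      (hd _ (circleMap_mem_sphere c hR t)).const_mul _
  refine ContinuousOn.mul ?_ (hc.comp (f := fun p : ℝ × E => (circleMap c R p.1, p.2)) ?_ ?_)
  · simp only [deriv_circleMap]
    fun_prop
  · fun_prop
  · exact fun p hp => ⟨circleMap_mem_sphere c hR _, hp.2⟩

/-- The substitution `s = c / σ` in a circle integral about the origin. -/
theorem circleIntegral_zero_comp_div {c : ℂ} (hc : c ≠ 0) {R : ℝ} (hR : 0 < R) (h : ℂ → ℂ) :
    (∮ s in C(0, ‖c‖ / R), h s) = ∮ s in C(0, R), c / s ^ 2 * h (c / s) := by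
  set k : ℝ → ℂ := fun t =>
    deriv (circleMap 0 (‖c‖ / R)) t • h (circleMap 0 (‖c‖ / R) t) with hk
  have hper : Function.Periodic k (2 * Real.pi) := fun t => by
    simp only [hk, deriv_circleMap, periodic_circleMap 0 _ t]
  have hmap : ∀ t, c / circleMap 0 R t = circleMap 0 (‖c‖ / R) (c.arg - t) := fun t => by
    have hR' : (R : ℂ) ≠ 0 := by exact_mod_cast hR.ne'
    nth_rewrite 1 [← Complex.norm_mul_exp_arg_mul_I c]
    simp only [circleMap, zero_add, Complex.ofReal_div, Complex.ofReal_sub, sub_mul,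
      Complex.exp_sub]
    field_simp
  have hrhs : (∮ s in C(0, R), c / s ^ 2 * h (c / s))
      = ∫ t in (0 : ℝ)..2 * Real.pi, k (c.arg - t) := by
    refine intervalIntegral.integral_congr fun t _ => ?_
    simp only [hk, deriv_circleMap, ← hmap, smul_eq_mul]
    have : circleMap 0 R t ≠ 0 := circleMap_ne_center hR.ne'
    field_simp
  have hshift := hper.intervalIntegral_add_eq (c.arg - 2 * Real.pi) 0
  rw [hrhs, intervalIntegral.integral_comp_sub_left, sub_zero]
  rw [sub_add_cancel, zero_add] at hshift
  exact hshift.symm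

/-- **Cauchy's integral formula** on an annulus centred at the origin. -/
theorem circleIntegral_sub_inv_mul_sub_of_differentiableOn_annulus {r R : ℝ} (hr : 0 < r)
    {g : ℂ → ℂ} {a : ℂ} (hra : r < ‖a‖) (haR : ‖a‖ < R)
    (hg : ∀ s, r ≤ ‖s‖ → ‖s‖ ≤ R → DifferentiableAt ℂ g s) :
    (∮ s in C(0, R), (s - a)⁻¹ * g s) - (∮ s in C(0, r), (s - a)⁻¹ * g s)
      = 2 * Real.pi * Complex.I * g a := by
  have hR : 0 < R := hr.trans (hra.trans haR)
  have ha : DifferentiableAt ℂ g a := hg a hra.le haR.le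
  have hnhds : closedBall (0 : ℂ) R \ ball 0 r ∈ 𝓝 a := by
    refine mem_of_superset ((isOpen_ball.sdiff isClosed_closedBall).mem_nhds
      (show a ∈ ball (0 : ℂ) R \ closedBall 0 r by simp [hra, haR]))
      (sdiff_subset_sdiff ball_subset_closedBall ball_subset_closedBall)
  have key := Complex.circleIntegral_eq_of_differentiable_on_annulus_off_countable hr
    (hra.trans haR).le (countable_singleton a) (f := dslope g a) (c := 0)
    ((continuousOn_dslope hnhds).2 ⟨fun s hs => by
      simp only [Set.mem_sdiff, mem_closedBall_zero_iff, mem_ball_zero_iff, not_lt] at hs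
      exact (hg s hs.2 hs.1).continuousAt.continuousWithinAt, ha⟩)
    (fun s hs => by
      simp only [Set.mem_sdiff, mem_closedBall_zero_iff, mem_ball_zero_iff, not_le,
        mem_singleton_iff] at hs
      exact (differentiableAt_dslope_of_ne hs.2).2 (hg s hs.1.2.le hs.1.1.le))
  have hsplit : ∀ ρ, r ≤ ρ → ρ ≤ R → ρ ≠ ‖a‖ → (∮ s in C(0, ρ), dslope g a s)
      = (∮ s in C(0, ρ), (s - a)⁻¹ * g s) - (∮ s in C(0, ρ), (s - a)⁻¹) * g a := by
    intro ρ h1 h2 h3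
    have hρ : 0 ≤ ρ := hr.le.trans h1
    have hne : ∀ s ∈ sphere (0 : ℂ) ρ, s - a ≠ 0 := by
      intro s hs h
      rw [mem_sphere_zero_iff_norm] at hs
      exact h3 (by rw [← hs, sub_eq_zero.1 h])
    have hinv : ContinuousOn (fun s : ℂ => (s - a)⁻¹) (sphere 0 ρ) :=
      ContinuousOn.inv₀ (by fun_prop) hne
    have hgc : ContinuousOn g (sphere 0 ρ) := fun s hs => by
      rw [mem_sphere_zero_iff_norm] at hs
      exact (hg s (hs ▸ h1) (hs ▸ h2)).continuousAt.continuousWithinAt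
    rw [mul_comm _ (g a), ← circleIntegral.integral_const_mul, ← circleIntegral.integral_sub
      ((hinv.fun_mul hgc).circleIntegrable hρ)
      ((continuousOn_const.fun_mul hinv).circleIntegrable hρ)]
    refine circleIntegral.integral_congr hρ fun s hs => ?_
    rw [dslope_of_ne _ (sub_ne_zero.1 (hne s hs)), slope_def_field]
    ring
  have h0 : (∮ s in C(0, r), (s - a)⁻¹) = 0 := by
    refine Complex.circleIntegral_eq_zero_of_differentiable_on_off_countable hr.le
      countable_empty (fun s hs => ?_) fun s hs => ?_
    · have : s - a ≠ 0 := fun h => by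
        rw [mem_closedBall_zero_iff, sub_eq_zero.1 h] at hs; linarith
      exact ContinuousAt.continuousWithinAt (by fun_prop (disch := assumption))
    · have : s - a ≠ 0 := fun h => by
        rw [sub_eq_zero.1 h] at hs; simp at hs; linarith
      fun_prop (disch := assumption)
  rw [hsplit R (hra.trans haR).le le_rfl haR.ne', hsplit r le_rfl (hra.trans haR).le hra.ne, h0,
    circleIntegral.integral_sub_inv_of_mem_ball (by simpa using haR)] at key
  linear_combination key

theorem IsCompact.isOpen_setOf_forall_mem {X Y Z : Type*} [TopologicalSpace X]
    [TopologicalSpace Y] [TopologicalSpace Z] {K : Set Y} (hK : IsCompact K) {G : Set Z}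
    (hG : IsOpen G) {Φ : Y → X → Z}
    (hΦ : ∀ y ∈ K, ∀ x, ContinuousAt (Function.uncurry Φ) (y, x)) :
    IsOpen {x | ∀ y ∈ K, Φ y x ∈ G} := by
  rw [isOpen_iff_mem_nhds]
  intro x hx
  refine hK.eventually_forall_of_forall_eventually fun y hy => ?_
  exact (continuous_swap.tendsto' (x, y) (y, x) rfl).eventually
    ((hΦ y hy x).eventually (hG.mem_nhds (hx y hy)))

/-- Some germ of `f` on `G` with the origin in the closure of its domain continues
holomorphically to a neighbourhood of the origin. -/
def ExtendsAcrossOrigin {E : Type*} [NormedAddCommGroup E] [NormedSpace ℂ E] (G : Set E)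
    (f : E → ℂ) : Prop :=
  ∃ U : Set E, IsOpen U ∧ 0 ∈ U ∧ ∃ V : Set E, V.Nonempty ∧ IsOpen V ∧ V ⊆ U ∩ G ∧
    0 ∈ closure V ∧ ∃ F : E → ℂ, DifferentiableOn ℂ F U ∧ EqOn F f V

section Extension

variable {E : Type*} [NormedAddCommGroup E] [NormedSpace ℂ E] [FiniteDimensional ℂ E]
  {G : Set E} {f : E → ℂ}

/-- Extension by Cauchy's formula on discs parallel to `w`, in a Hartogs figure. -/
theorem extendsAcrossOrigin_of_discs (hG : IsOpen G) (hf : DifferentiableOn ℂ f G) {w v : E}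
    {u : E →L[ℂ] ℂ} (huv : u v = 0) {δ : ℝ} (hδ : 0 < δ)
    (hw : ∀ s : ℂ, ‖s‖ = δ → s • w ∈ G)
    (hv : ∀ᶠ t : ℝ in 𝓝[>] 0, ∀ s : ℂ, ‖s‖ ≤ δ → s • w + (t : ℂ) • v ∈ G) :
    ExtendsAcrossOrigin G f := by
  set Φ : ℂ → E → E := fun s z => s • w + (z - u z • w) with hΦ
  have hΦc : Continuous (Function.uncurry Φ) := by
    simp only [hΦ, Function.uncurry_def]; fun_prop
  set U : Set E := {z | ‖u z‖ < δ} ∩ {z | ∀ s ∈ sphere (0 : ℂ) δ, Φ s z ∈ G} with hUdef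
  have hU : IsOpen U := (isOpen_lt (by fun_prop) continuous_const).inter
    ((isCompact_sphere 0 δ).isOpen_setOf_forall_mem hG fun _ _ _ => hΦc.continuousAt)
  have h0U : (0 : E) ∈ U := ⟨by simpa using hδ, fun s hs => by
    simpa [hΦ] using hw s (mem_sphere_zero_iff_norm.1 hs)⟩
  set V : Set E := U ∩ {z | ∀ s ∈ closedBall (0 : ℂ) δ, Φ s z ∈ G} with hVdef
  have hV : IsOpen V := hU.inter
    ((isCompact_closedBall 0 δ).isOpen_setOf_forall_mem hG fun _ _ _ => hΦc.continuousAt)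
  have hΦu : ∀ z, Φ (u z) z = z := fun z => by simp [hΦ]
  have hcl : (0 : E) ∈ closure V := by
    have htend : Tendsto (fun t : ℝ => (t : ℂ) • v) (𝓝[>] 0) (𝓝 0) :=
      (Continuous.tendsto' (by fun_prop) 0 0 (by simp)).mono_left nhdsWithin_le_nhds
    refine mem_closure_of_tendsto htend ?_
    filter_upwards [htend.eventually (hU.mem_nhds h0U), hv] with t ht htv
    refine ⟨ht, fun s hs => ?_⟩
    simpa [hΦ, huv] using htv s (mem_closedBall_zero_iff.1 hs)
  have hne : ∀ s ∈ sphere (0 : ℂ) δ, ∀ z ∈ U, s - u z ≠ 0 := fun s hs z hz h => by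
    rw [mem_sphere_zero_iff_norm, sub_eq_zero.1 h] at hs
    exact hz.1.ne hs
  refine ⟨U, hU, h0U, V, closure_nonempty_iff.1 ⟨0, hcl⟩, hV, fun z hz => ⟨hz.1, ?_⟩, hcl,
    fun z => (2 * Real.pi * Complex.I)⁻¹ * ∮ s in C(0, δ), (s - u z)⁻¹ * f (Φ s z),
    DifferentiableOn.const_mul (differentiableOn_circleIntegral_of_continuousOn hU hδ.le ?_ ?_) _,
    ?_⟩
  · simpa [hΦu] using hz.2 (u z) (mem_closedBall_zero_iff.2 hz.1.1.le)
  · refine ContinuousOn.mul (ContinuousOn.inv₀ (by fun_prop) fun p hp => hne _ hp.1 _ hp.2)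
      (hf.continuousOn.comp hΦc.continuousOn fun p hp => hp.2.2 _ hp.1)
  · refine fun s hs => DifferentiableOn.mul (DifferentiableOn.inv (by fun_prop) (hne s hs))
      (hf.comp (g := f) (f := Φ s) (by simp only [hΦ]; fun_prop) fun z hz => hz.2 s hs)
  · intro z hz
    have hd : DifferentiableOn ℂ (fun s => f (Φ s z)) (closedBall 0 δ) :=
      hf.comp (g := f) (f := fun s => Φ s z) (by simp only [hΦ]; fun_prop) hz.2
    have := hd.circleIntegral_sub_inv_smul (mem_ball_zero_iff.2 hz.1.1)
    simp only [smul_eq_mul, hΦu] at this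
    simp only [this]
    field_simp [Complex.two_pi_I_ne_zero]

/-- Extension by Cauchy's formula on the annuli `a z * b z = const`; the integral over the inner
boundary circle is transported by `s = a z * b z / σ` to a circle in the direction of `v`. -/
theorem extendsAcrossOrigin_of_annuli (hG : IsOpen G) (hf : DifferentiableOn ℂ f G)
    {Q : E → ℂ} (hQc : Continuous Q) (hQ0 : Q 0 = 0) {w v : E} {a b : E →L[ℂ] ℂ}
    (haw : a w = 1) (hav : a v = 0) (hbw : b w = 0) (hbv : b v = 1)
    (hQ : ∀ s t z, Q (s • w + t • v + (z - a z • w - b z • v))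
      = s * t + Q (z - a z • w - b z • v))
    {r : ℝ} (hr : 0 < r) (hGQ : ∀ z, z ≠ 0 → ‖z‖ < r → 0 ≤ (Q z).re → z ∈ G) :
    ExtendsAcrossOrigin G f := by
  have hw0 : w ≠ 0 := fun h => by simp [h] at haw
  have hv0 : v ≠ 0 := fun h => by simp [h] at hbv
  obtain ⟨δ, hδ, hδr⟩ : ∃ δ : ℝ, 0 < δ ∧ δ * ‖w‖ + δ * ‖v‖ < r / 2 := by
    refine ⟨r / (4 * (‖w‖ + ‖v‖)), by positivity, ?_⟩
    have : r / (4 * (‖w‖ + ‖v‖)) * ‖w‖ + r / (4 * (‖w‖ + ‖v‖)) * ‖v‖ = r / 4 := by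
      field_simp
    linarith
  set p : E → E := fun z => z - a z • w - b z • v with hp
  have hpd : Differentiable ℂ p := by simp only [hp]; fun_prop
  have hpc : Continuous p := hpd.continuous
  set Φ : ℂ → E → E := fun s z => s • w + (a z * b z / s) • v + p z with hΦ
  set Ψ : ℂ → E → E := fun s z => (a z * b z / s) • w + s • v + p z with hΨ
  have hp0 : p 0 = 0 := by simp [hp]
  have hs0 : ∀ s ∈ sphere (0 : ℂ) δ, s ≠ 0 := fun s hs => ne_zero_of_mem_sphere hδ.ne' ⟨s, hs⟩
  have hΦc : ∀ s ∈ sphere (0 : ℂ) δ, ∀ z, ContinuousAt (Function.uncurry Φ) (s, z) := by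
    intro s hs z
    have : ((s, z) : ℂ × E).1 ≠ 0 := hs0 s hs
    simp only [hΦ, Function.uncurry_def]
    fun_prop (disch := assumption)
  have hΨc : ∀ s ∈ sphere (0 : ℂ) δ, ∀ z, ContinuousAt (Function.uncurry Ψ) (s, z) := by
    intro s hs z
    have : ((s, z) : ℂ × E).1 ≠ 0 := hs0 s hs
    simp only [hΨ, Function.uncurry_def]
    fun_prop (disch := assumption)
  set U : Set E := {z | ‖a z‖ < δ ∧ ‖b z‖ < δ ∧ ‖p z‖ < r / 2} ∩
    ({z | ∀ s ∈ sphere (0 : ℂ) δ, Φ s z ∈ G} ∩ {z | ∀ s ∈ sphere (0 : ℂ) δ, Ψ s z ∈ G})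
    with hUdef
  have hU : IsOpen U :=
    ((isOpen_lt a.continuous.norm continuous_const).and
      ((isOpen_lt b.continuous.norm continuous_const).and
        (isOpen_lt hpc.norm continuous_const))).inter
    (((isCompact_sphere 0 δ).isOpen_setOf_forall_mem hG hΦc).inter
      ((isCompact_sphere 0 δ).isOpen_setOf_forall_mem hG hΨc))
  have h0U : (0 : E) ∈ U := by
    have hδw : 0 ≤ δ * ‖w‖ := by positivity
    have hδv : 0 ≤ δ * ‖v‖ := by positivity
    refine ⟨⟨by simpa using hδ, by simpa using hδ, by simpa [hp0] using hr⟩,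
      fun s hs => ?_, fun s hs => ?_⟩
    · have h1 : Q (s • w) = 0 := by simpa [hp0, hp, hQ0] using hQ s 0 0
      have h2 : Φ s 0 = s • w := by simp [hΦ, hp0]
      rw [h2]
      refine hGQ _ (smul_ne_zero (hs0 s hs) hw0) ?_ (by simp [h1])
      rw [norm_smul, mem_sphere_zero_iff_norm.1 hs]
      linarith
    · have h1 : Q (s • v) = 0 := by simpa [hp0, hp, hQ0] using hQ 0 s 0
      have h2 : Ψ s 0 = s • v := by simp [hΨ, hp0]
      rw [h2]
      refine hGQ _ (smul_ne_zero (hs0 s hs) hv0) ?_ (by simp [h1])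
      rw [norm_smul, mem_sphere_zero_iff_norm.1 hs]
      linarith
  set V : Set E := U ∩ {z | a z ≠ 0 ∧ b z ≠ 0 ∧ 0 < (Q z).re} with hVdef
  have hV : IsOpen V := hU.inter ((isOpen_ne_fun a.continuous continuous_const).and
    ((isOpen_ne_fun b.continuous continuous_const).and
      (isOpen_lt continuous_const (Complex.continuous_re.comp hQc))))
  have hcl : (0 : E) ∈ closure V := by
    have htend : Tendsto (fun t : ℝ => (t : ℂ) • w + (t : ℂ) • v) (𝓝[>] 0) (𝓝 0) :=
      (Continuous.tendsto' (by fun_prop) 0 0 (by simp)).mono_left nhdsWithin_le_nhds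
    refine mem_closure_of_tendsto htend ?_
    filter_upwards [htend.eventually (hU.mem_nhds h0U), self_mem_nhdsWithin] with t ht ht0
    have ht0' : (t : ℂ) ≠ 0 := by exact_mod_cast (mem_Ioi.1 ht0).ne'
    refine ⟨ht, by simpa [haw, hav] using ht0', by simpa [hbw, hbv] using ht0', ?_⟩
    have h1 : Q ((t : ℂ) • w + (t : ℂ) • v) = t * t := by
      simpa [hp0, hp, hQ0] using hQ t t 0
    rw [h1, ← Complex.ofReal_mul, Complex.ofReal_re]
    exact mul_self_pos.2 (mem_Ioi.1 ht0).ne'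
  have hΦa : ∀ z, a z ≠ 0 → Φ (a z) z = z := fun z hz => by
    simp only [hΦ, hp]
    rw [mul_div_cancel_left₀ _ hz]
    abel
  have hdecomp : ∀ z, a z • w + b z • v + (z - a z • w - b z • v) = z := fun z => by abel
  have hQΦ : ∀ s z, s ≠ 0 → Q (Φ s z) = Q z := fun s z hs => by
    have h1 := hQ (a z) (b z) z
    rw [hdecomp] at h1
    simp only [hΦ, hp, hQ]
    rw [h1, mul_div_cancel₀ _ hs]
  have hΦG : ∀ z ∈ V, ∀ s, ‖a z * b z‖ / δ ≤ ‖s‖ → ‖s‖ ≤ δ → Φ s z ∈ G := by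
    intro z hz s hs1 hs2
    have hc : 0 < ‖a z * b z‖ := norm_pos_iff.2 (mul_ne_zero hz.2.1 hz.2.2.1)
    have hs : s ≠ 0 := norm_pos_iff.1 (lt_of_lt_of_le (by positivity) hs1)
    have hQz := hQΦ s z hs
    refine hGQ _ (fun h => ?_) ?_ (by rw [hQz]; exact hz.2.2.2.le)
    · rw [h, hQ0] at hQz
      have := hz.2.2.2
      rw [← hQz] at this
      simp at this
    · have h1 : ‖a z * b z / s‖ ≤ δ := by
        rw [norm_div, div_le_iff₀ (norm_pos_iff.2 hs)]
        rwa [div_le_iff₀ hδ, mul_comm ‖s‖] at hs1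
      calc ‖Φ s z‖ ≤ ‖s • w‖ + ‖(a z * b z / s) • v‖ + ‖p z‖ := norm_add₃_le
        _ ≤ δ * ‖w‖ + δ * ‖v‖ + ‖p z‖ := by
          rw [norm_smul, norm_smul]
          gcongr
        _ < r := by linarith [hz.1.1.2.2]
  have hne : ∀ {c : E →L[ℂ] ℂ} {z : E}, ‖c z‖ < δ → ∀ s ∈ sphere (0 : ℂ) δ, s - c z ≠ 0 :=
    fun hc s hs h => by
      rw [mem_sphere_zero_iff_norm, sub_eq_zero.1 h] at hs
      exact hc.ne hs
  refine ⟨U, hU, h0U, V, closure_nonempty_iff.1 ⟨0, hcl⟩, hV, fun z hz => ⟨hz.1, ?_⟩, hcl,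
    fun z => (2 * Real.pi * Complex.I)⁻¹ * ((∮ s in C(0, δ), (s - a z)⁻¹ * f (Φ s z)) +
      ∮ s in C(0, δ), b z * (s * (s - b z))⁻¹ * f (Ψ s z)),
    DifferentiableOn.const_mul
      ((differentiableOn_circleIntegral_of_continuousOn hU hδ.le ?_ ?_).add
        (differentiableOn_circleIntegral_of_continuousOn hU hδ.le ?_ ?_)) _, ?_⟩
  · have hb : ‖a z * b z‖ / δ ≤ ‖a z‖ := by
      rw [div_le_iff₀ hδ, norm_mul]
      have := hz.1.1.2.1
      gcongr
    simpa [hΦa z hz.2.1] using hΦG z hz (a z) hb hz.1.1.1.le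
  · refine ContinuousOn.mul
      (ContinuousOn.inv₀ (by fun_prop) fun q hq => hne hq.2.1.1 _ hq.1)
      (hf.continuousOn.comp (fun q hq => (hΦc _ hq.1 _).continuousWithinAt)
        fun q hq => hq.2.2.1 _ hq.1)
  · refine fun s hs => DifferentiableOn.mul
      (DifferentiableOn.inv (by fun_prop) fun z hz => hne hz.1.1 s hs)
      (hf.comp (g := f) (f := Φ s) (by simp only [hΦ]; fun_prop) fun z hz => hz.2.1 s hs)
  · refine ContinuousOn.mul (ContinuousOn.mul (by fun_prop)
      (ContinuousOn.inv₀ (by fun_prop)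
        fun q hq => mul_ne_zero (hs0 _ hq.1) (hne hq.2.1.2.1 _ hq.1)))
      (hf.continuousOn.comp (fun q hq => (hΨc _ hq.1 _).continuousWithinAt)
        fun q hq => hq.2.2.2 _ hq.1)
  · refine fun s hs => DifferentiableOn.mul (DifferentiableOn.mul (by fun_prop)
      (DifferentiableOn.inv (by fun_prop)
        fun z hz => mul_ne_zero (hs0 s hs) (hne hz.1.2.1 s hs)))
      (hf.comp (g := f) (f := Ψ s) (by simp only [hΨ]; fun_prop) fun z hz => hz.2.2 s hs)
  · intro z hz
    have hc : a z * b z ≠ 0 := mul_ne_zero hz.2.1 hz.2.2.1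
    have hrad : 0 < ‖a z * b z‖ / δ := div_pos (norm_pos_iff.2 hc) hδ
    have hcauchy := circleIntegral_sub_inv_mul_sub_of_differentiableOn_annulus hrad
      (g := fun s => f (Φ s z)) (a := a z) (R := δ)
      (by
        rw [div_lt_iff₀ hδ, norm_mul]
        exact mul_lt_mul_of_pos_left hz.1.1.2.1 (norm_pos_iff.2 hz.2.1))
      hz.1.1.1 (fun s h1 h2 => by
        have hs : s ≠ 0 := norm_pos_iff.1 (hrad.trans_le h1)
        refine DifferentiableAt.comp s (g := f) (f := fun s => Φ s z)
          (hf.differentiableAt (hG.mem_nhds (hΦG z hz s h1 h2))) ?_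
        simp only [hΦ]
        fun_prop (disch := assumption))
    rw [circleIntegral_zero_comp_div hc hδ (fun s => (s - a z)⁻¹ * f (Φ s z))] at hcauchy
    have hinner : (∮ s in C(0, δ), b z * (s * (s - b z))⁻¹ * f (Ψ s z)) =
        -∮ s in C(0, δ), a z * b z / s ^ 2 *
          ((a z * b z / s - a z)⁻¹ * f (Φ (a z * b z / s) z)) := by
      rw [← neg_one_mul, ← circleIntegral.integral_const_mul]
      refine circleIntegral.integral_congr hδ.le fun s hs => ?_
      have hs' := hs0 s hs
      have h1 : Φ (a z * b z / s) z = Ψ s z := by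
        simp only [hΦ, hΨ]
        rw [div_div_cancel₀ hc]
      have h2 : s - b z ≠ 0 := hne hz.1.1.2.1 s hs
      have h3 : a z * b z / s - a z = -(a z * (s - b z) / s) := by
        field_simp; ring
      have haz : a z ≠ 0 := hz.2.1
      simp only [h1, h3, inv_neg, inv_div]
      field_simp
    simp only [hΦa z hz.2.1] at hcauchy
    simp only
    rw [hinner, ← sub_eq_add_neg, hcauchy, inv_mul_cancel_left₀ Complex.two_pi_I_ne_zero]

/-- A nonzero null vector of a symmetric complex bilinear form in dimension at least two. -/
theorem exists_ne_zero_apply_self_eq_zero {E : Type*} [AddCommGroup E] [Module ℂ E]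
    [FiniteDimensional ℂ E] (hE : 2 ≤ Module.finrank ℂ E) {B : E →ₗ[ℂ] E →ₗ[ℂ] ℂ}
    (hB : ∀ x y, B x y = B y x) : ∃ w, w ≠ 0 ∧ B w w = 0 := by
  obtain ⟨x, hx⟩ : ∃ x : E, x ≠ 0 := by
    have : Nontrivial E := Module.nontrivial_of_finrank_pos (R := ℂ) (by omega)
    exact exists_ne 0
  by_cases hxx : B x x = 0
  · exact ⟨x, hx, hxx⟩
  obtain ⟨y, hy, hy0⟩ : ∃ y ∈ LinearMap.ker (B x), y ≠ 0 :=
    Submodule.exists_mem_ne_zero_of_ne_bot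
      (LinearMap.ker_ne_bot_of_finrank_lt (by rw [Module.finrank_self]; omega))
  rw [LinearMap.mem_ker] at hy
  obtain ⟨t, ht⟩ := IsAlgClosed.exists_pow_nat_eq (-(B y y) / B x x) (n := 2) (by norm_num)
  refine ⟨t • x + y, fun h => ?_, ?_⟩
  · have h1 := congrArg (B x) h
    simp only [map_add, map_smul, hy, smul_eq_mul, add_zero, map_zero, mul_eq_zero, hxx,
      or_false] at h1
    rw [h1] at h
    exact hy0 (by simpa using h)
  · simp only [map_add, map_smul, LinearMap.add_apply, LinearMap.smul_apply, smul_eq_mul, hy,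
      hB y x]
    have h1 : t * (t * B x x) = t ^ 2 * B x x := by ring
    rw [mul_zero, add_zero, zero_add, h1, ht]
    field_simp
    ring

/-- Holomorphic functions on an open set containing the punctured germ of `{0 ≤ Re Q}`, for a
quadratic form `Q` in at least two complex variables, extend across the origin. -/
theorem extendsAcrossOrigin_of_re_quadratic_nonneg (hE : 2 ≤ Module.finrank ℂ E)
    {B : E →ₗ[ℂ] E →ₗ[ℂ] ℂ} (hB : ∀ x y, B x y = B y x) (hG : IsOpen G)
    (hf : DifferentiableOn ℂ f G) {r : ℝ} (hr : 0 < r)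
    (hGB : ∀ z, z ≠ 0 → ‖z‖ < r → 0 ≤ (B z z).re → z ∈ G) : ExtendsAcrossOrigin G f := by
  obtain ⟨w, hw0, hw⟩ := exists_ne_zero_apply_self_eq_zero hE hB
  by_cases hker : ∀ y, B w y = 0
  · obtain ⟨u, huw⟩ := SeparatingDual.exists_eq_one (R := ℂ) hw0
    obtain ⟨v', hv', hv'0⟩ : ∃ v ∈ LinearMap.ker (u : E →ₗ[ℂ] ℂ), v ≠ 0 :=
      Submodule.exists_mem_ne_zero_of_ne_bot
        (LinearMap.ker_ne_bot_of_finrank_lt (by rw [Module.finrank_self]; omega))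
    obtain ⟨v, hv0, huv, hBv⟩ : ∃ v, v ≠ 0 ∧ u v = 0 ∧ 0 ≤ (B v v).re := by
      have huv' : u v' = 0 := hv'
      rcases le_total 0 (B v' v').re with h | h
      · exact ⟨v', hv'0, huv', h⟩
      · refine ⟨Complex.I • v', smul_ne_zero Complex.I_ne_zero hv'0, by simp [huv'], ?_⟩
        simpa [← mul_assoc] using h
    set δ := r / (2 * ‖w‖) with hδdef
    have hδ : 0 < δ := by positivity
    have hδw : δ * ‖w‖ = r / 2 := by simp only [hδdef]; field_simp
    refine extendsAcrossOrigin_of_discs hG hf (w := w) huv hδ (fun s hs => ?_) ?_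
    · refine hGB _ (smul_ne_zero (norm_pos_iff.1 (hs ▸ hδ)) hw0) ?_ (by simp [hw])
      rw [norm_smul, hs, hδw]
      linarith
    · have htend : Tendsto (fun t : ℝ => ‖(t : ℂ) • v‖) (𝓝[>] 0) (𝓝 0) :=
        (Continuous.tendsto' (by fun_prop) 0 0 (by simp)).mono_left nhdsWithin_le_nhds
      filter_upwards [htend.eventually (gt_mem_nhds (half_pos hr)), self_mem_nhdsWithin]
        with t ht ht0 s hs
      have ht0' : (t : ℂ) ≠ 0 := by exact_mod_cast (mem_Ioi.1 ht0).ne'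
      refine hGB _ (fun h => ?_) ?_ ?_
      · have hs0 : s = 0 := by simpa [huw, huv] using congrArg u h
        rw [hs0, zero_smul, zero_add] at h
        exact smul_ne_zero ht0' hv0 h
      · calc ‖s • w + (t : ℂ) • v‖ ≤ ‖s‖ * ‖w‖ + ‖(t : ℂ) • v‖ := by
              rw [← norm_smul]; exact norm_add_le _ _
          _ ≤ δ * ‖w‖ + ‖(t : ℂ) • v‖ := by gcongr
          _ < r := by linarith
      · have h1 : B (s • w + (t : ℂ) • v) (s • w + (t : ℂ) • v) = ((t * t : ℝ) : ℂ) * B v v := by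
          simp only [map_add, map_smul, LinearMap.add_apply, LinearMap.smul_apply, smul_eq_mul,
            hker, hB v w, Complex.ofReal_mul]
          ring
        rw [h1, Complex.re_ofReal_mul]
        exact mul_nonneg (mul_self_nonneg t) hBv
  · push Not at hker
    obtain ⟨y, hy⟩ := hker
    set y' := (2 * B w y)⁻¹ • y with hy'def
    have hy' : B w y' = 1 / 2 := by
      simp only [hy'def, map_smul, smul_eq_mul]; field_simp
    set v := y' - B y' y' • w with hvdef
    have hwv : B w v = 1 / 2 := by simp [hvdef, hw, hy']
    have hvw : B v w = 1 / 2 := by rw [hB, hwv]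
    have hvv : B v v = 0 := by
      simp only [hvdef, map_sub, map_smul, LinearMap.sub_apply, LinearMap.smul_apply,
        smul_eq_mul, hw, hy', hB y' w]
      ring
    refine extendsAcrossOrigin_of_annuli hG hf (Q := fun z => B z z) ?_ (by simp) (w := w) (v := v)
      (a := LinearMap.toContinuousLinearMap ((2 : ℂ) • B v))
      (b := LinearMap.toContinuousLinearMap ((2 : ℂ) • B w)) (by simp [hvw]) (by simp [hvv])
      (by simp [hw]) (by simp [hwv]) (fun s t z => ?_) hr hGB
    · have h : Continuous fun z => LinearMap.toContinuousLinearMap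
          ((LinearMap.toContinuousLinearMap : (E →ₗ[ℂ] ℂ) ≃ₗ[ℂ] _).toLinearMap ∘ₗ B) z z := by
        fun_prop
      exact h
    · simp only [LinearMap.coe_toContinuousLinearMap', _root_.smul_apply, LinearMap.smul_apply, smul_eq_mul,
        map_add, map_sub, map_smul, LinearMap.add_apply, LinearMap.sub_apply, hw, hvv, hwv, hvw,
        hB z w, hB z v]
      ring

end Extension

/-- The key step in the proof of Proposition 2.1 of the paper: if
`ρ(z) = 2 Re Q(z) + ‖z‖² + O(‖z‖³)` near `0`, with `Q` a holomorphic quadratic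
form (normal form (2.1)–(2.2) of a strictly plurisubharmonic function at a
nondegenerate critical point with critical value 0), then holomorphic
functions on the superlevel set `{ ρ > 0 }` near `0` extend across the
critical point. -/
theorem stmt_3 (n : ℕ) (hn : 2 ≤ n)
    (q : Matrix (Fin n) (Fin n) ℂ) (hq : q.IsSymm)
    (Q : EuclideanSpace ℂ (Fin n) → ℂ)
    (hQ : ∀ z : EuclideanSpace ℂ (Fin n),
      Q z = ∑ j : Fin n, ∑ k : Fin n, q j k * z j * z k)
    (C : ℝ) (hC : 0 ≤ C)
    (ρ : EuclideanSpace ℂ (Fin n) → ℝ)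
    (hρ : ∀ z : EuclideanSpace ℂ (Fin n), ‖z‖ < 1 →
      |ρ z - (2 * (Q z).re + ‖z‖ ^ 2)| ≤ C * ‖z‖ ^ 3) :
    ∃ r : ℝ, 0 < r ∧ r < 1 ∧
      ∀ f : EuclideanSpace ℂ (Fin n) → ℂ,
        DifferentiableOn ℂ f {z | ‖z‖ < r ∧ 0 < ρ z} →
        ∃ U : Set (EuclideanSpace ℂ (Fin n)), IsOpen U ∧
          (0 : EuclideanSpace ℂ (Fin n)) ∈ U ∧
          ∃ V : Set (EuclideanSpace ℂ (Fin n)), V.Nonempty ∧ IsOpen V ∧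
            V ⊆ U ∩ {z | ‖z‖ < r ∧ 0 < ρ z} ∧
            (0 : EuclideanSpace ℂ (Fin n)) ∈ closure V ∧
            ∃ F : EuclideanSpace ℂ (Fin n) → ℂ, DifferentiableOn ℂ F U ∧
              Set.EqOn F f V := by
  obtain ⟨B, hB⟩ : ∃ B : EuclideanSpace ℂ (Fin n) →ₗ[ℂ] EuclideanSpace ℂ (Fin n) →ₗ[ℂ] ℂ,
      ∀ x y, B x y = ∑ j, ∑ k, x j * q j k * y k := by
    refine ⟨(Matrix.toBilin' q).compl₁₂ (WithLp.linearEquiv 2 ℂ (Fin n → ℂ)).toLinearMap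
      (WithLp.linearEquiv 2 ℂ (Fin n → ℂ)).toLinearMap, fun x y => ?_⟩
    simp [LinearMap.compl₁₂_apply, Matrix.toBilin'_apply]
  have hBsymm : ∀ x y, B x y = B y x := fun x y => by
    rw [hB, hB, Finset.sum_comm]
    refine Finset.sum_congr rfl fun j _ => Finset.sum_congr rfl fun k _ => ?_
    rw [hq.apply j k]
    ring
  have hBQ : ∀ z, B z z = Q z := fun z => by
    rw [hB, hQ]
    exact Finset.sum_congr rfl fun j _ => Finset.sum_congr rfl fun k _ => by ring
  have hQc : Continuous Q := by
    rw [funext hQ]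
    fun_prop
  set r : ℝ := 1 / (2 * (C + 1)) with hr
  have hr0 : 0 < r := by positivity
  have hrC : r * (C + 1) = 1 / 2 := by rw [hr]; field_simp
  have hr1 : r < 1 := by nlinarith
  refine ⟨r, hr0, hr1, fun f hf => ?_⟩
  set G : Set (EuclideanSpace ℂ (Fin n)) :=
    {z | ‖z‖ < r ∧ 0 < 2 * (Q z).re + ‖z‖ ^ 2 / 2} with hGdef
  have hG : IsOpen G := (isOpen_lt continuous_norm continuous_const).and
    (isOpen_lt continuous_const
      (((Complex.continuous_re.comp hQc).const_mul 2).add ((continuous_norm.pow 2).div_const 2)))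
  have hGρ : G ⊆ {z | ‖z‖ < r ∧ 0 < ρ z} := by
    rintro z ⟨hzr, hz⟩
    refine ⟨hzr, ?_⟩
    have h1 := (abs_le.1 (hρ z (hzr.trans hr1))).1
    have h2 : C * ‖z‖ ≤ 1 / 2 := by nlinarith [norm_nonneg z]
    have h3 : C * ‖z‖ ^ 3 ≤ ‖z‖ ^ 2 / 2 := by nlinarith [sq_nonneg ‖z‖]
    linarith
  obtain ⟨U, hU, h0U, V, hVne, hV, hVUG, hcl, F, hF, hFf⟩ :=
    extendsAcrossOrigin_of_re_quadratic_nonneg (by simpa using hn) hBsymm hG (hf.mono hGρ) hr0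
      (fun z hz0 hzr hz => ⟨hzr, by
        rw [hBQ] at hz
        have : 0 < ‖z‖ := norm_pos_iff.2 hz0
        positivity⟩)
  exact ⟨U, hU, h0U, V, hVne, hV, hVUG.trans (inter_subset_inter_right _ hGρ), hcl, F, hF, hFf⟩
end

section
/- Let n ≥ 1, k ≥ 1, 0 < r < 1 and C₀ > 0. Let f : Δⁿ × A^k(r,1) → ℂ be holomorphic with |f| ≤ C₀, and suppose there is a dense subset S ⊆ Δⁿ such that for every s ∈ S there is a function g_s holomorphic on Δ^k with |g_s| ≤ C₀ on Δ^k and g_s(w) = f(s,w) for all w ∈ A^k(r,1). Then there exists a holomorphic function F : Δⁿ × Δ^k → ℂ such that F(s,w) = f(s,w) for all (s,w) ∈ Δⁿ × A^k(r,1). -/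
open Metric Set Filter Topology MeasureTheory

/-- **Cauchy's estimate** for the Fréchet derivative of a bounded holomorphic function. -/
theorem norm_fderiv_le_of_bounded_on_ball {X : Type*} [NormedAddCommGroup X] [NormedSpace ℂ X]
    {g : X → ℂ} {x₀ x : X} {ε C : ℝ} (hε : 0 < ε) (hg : DifferentiableOn ℂ g (ball x₀ ε))
    (hC : ∀ x ∈ ball x₀ ε, ‖g x‖ ≤ C) (hx : x ∈ ball x₀ (ε / 2)) :
    ‖fderiv ℂ g x‖ ≤ 4 * C / ε := by
  have hsub : ball x (ε / 2) ⊆ ball x₀ ε := by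
    refine ball_subset_ball' ?_
    have := mem_ball.1 hx
    linarith
  have hmaps : MapsTo g (ball x (ε / 2)) (closedBall (g x) (2 * C)) := by
    intro y hy
    rw [mem_closedBall, dist_eq_norm]
    have h1 := hC y (hsub hy)
    have h2 := hC x (hsub (mem_ball_self (by positivity)))
    linarith [norm_sub_le (g y) (g x)]
  have := Complex.norm_fderiv_le_div_of_mapsTo_ball (hg.mono hsub) hmaps (by positivity)
  refine this.trans_eq ?_
  field_simp
  ring

/-- The derivative at `x₀` of a family `G · t` depends measurably on `t` if `G x` is continuous for
`x` near `x₀`. -/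
theorem stronglyMeasurable_fderiv_of_continuous {X : Type*} [NormedAddCommGroup X]
    [NormedSpace ℂ X] [FiniteDimensional ℂ X] {G : X → ℝ → ℂ} {x₀ : X}
    (hcont : ∀ᶠ x in 𝓝 x₀, Continuous (G x)) (hd : ∀ t, DifferentiableAt ℂ (G · t) x₀) :
    StronglyMeasurable fun t => fderiv ℂ (G · t) x₀ := by
  have hdir (v : X) : StronglyMeasurable fun t => fderiv ℂ (G · t) x₀ v := by
    have hlim : Tendsto (fun n : ℕ => x₀ + ((n : ℂ)⁻¹) • v) atTop (𝓝 x₀) := by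
      have h0 := (tendsto_inv_atTop_nhds_zero_nat (𝕜 := ℂ)).smul_const v
      simpa using h0.const_add x₀
    obtain ⟨N, hN⟩ := eventually_atTop.1 (hlim.eventually hcont)
    refine stronglyMeasurable_of_tendsto atTop
      (f := fun (n : ℕ) t => ((n + N : ℕ) : ℂ) •
        (G (x₀ + (((n + N : ℕ) : ℂ)⁻¹) • v) t - G x₀ t)) (fun n => ?_) ?_
    · exact (((hN (n + N) (by omega)).sub hcont.self_of_nhds).const_smul
        ((n + N : ℕ) : ℂ)).stronglyMeasurable
    · rw [tendsto_pi_nhds]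
      intro t
      have h1 := (hd t).hasFDerivAt.lim v (c := fun n : ℕ => (n : ℂ)) (l := atTop)
        (by simpa using tendsto_natCast_atTop_atTop)
      exact h1.comp (tendsto_add_atTop_nat N)
  let b := Module.finBasis ℂ X
  have hsum : (fun t => fderiv ℂ (G · t) x₀) = fun t => ∑ i,
      fderiv ℂ (G · t) x₀ (b i) • (LinearMap.toContinuousLinearMap (b.coord i)) := by
    ext t v
    conv_lhs => rw [← b.sum_repr v]
    simp only [map_sum, map_smul, smul_eq_mul, FunLike.coe_sum, Finset.sum_apply,
      FunLike.coe_smul, Pi.smul_apply, LinearMap.coe_toContinuousLinearMap', Module.Basis.coord_apply,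
      mul_comm]
  rw [hsum]
  refine Finset.stronglyMeasurable_fun_sum _ fun i _ => (hdir (b i)).smul_const _

/-- An integral of a bounded continuous family of holomorphic functions is holomorphic. -/
theorem differentiableAt_intervalIntegral_of_bounded {X : Type*} [NormedAddCommGroup X]
    [NormedSpace ℂ X] [FiniteDimensional ℂ X] {G : X → ℝ → ℂ} {x₀ : X} {ε C a b : ℝ}
    (hε : 0 < ε) (hcont : ∀ x ∈ ball x₀ ε, Continuous (G x))
    (hd : ∀ t, DifferentiableOn ℂ (G · t) (ball x₀ ε))
    (hC : ∀ x ∈ ball x₀ ε, ∀ t, ‖G x t‖ ≤ C) :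
    DifferentiableAt ℂ (fun x => ∫ t in a..b, G x t) x₀ := by
  have hU : ball x₀ ε ∈ 𝓝 x₀ := ball_mem_nhds _ hε
  have hV : ball x₀ (ε / 2) ∈ 𝓝 x₀ := ball_mem_nhds _ (by positivity)
  have hcont' : ∀ᶠ x in 𝓝 x₀, Continuous (G x) := mem_of_superset hU hcont
  have hmeas := stronglyMeasurable_fderiv_of_continuous hcont'
    fun t => (hd t).differentiableAt hU
  have key (a b : ℝ) := hasFDerivAt_integral_of_dominated_of_fderiv_le (𝕜 := ℂ)
    (μ := volume.restrict (Ioc a b)) (F := G) (bound := fun _ => 4 * C / ε)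
    (F' := fun x t => fderiv ℂ (G · t) x) hV
    (hcont'.mono fun x hx => hx.aestronglyMeasurable)
    (hcont'.self_of_nhds.integrableOn_Ioc) hmeas.aestronglyMeasurable
    (ae_of_all _ fun t x hx => norm_fderiv_le_of_bounded_on_ball hε (hd t)
      (fun y hy => hC y hy t) hx)
    (integrable_const _)
    (ae_of_all _ fun t x hx => ((hd t).differentiableAt
      (isOpen_ball.mem_nhds (ball_subset_ball (by linarith) hx))).hasFDerivAt)
  exact ((key a b).sub (key b a)).differentiableAt

/-- A circle integral depending holomorphically on a parameter is holomorphic. -/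
theorem differentiableAt_circleIntegral_of_bounded {X : Type*} [NormedAddCommGroup X]
    [NormedSpace ℂ X] [FiniteDimensional ℂ X] {h : X → ℂ → ℂ} {x₀ : X} {c : ℂ} {ε R C : ℝ}
    (hε : 0 < ε) (hR : 0 ≤ R) (hcont : ∀ x ∈ ball x₀ ε, ContinuousOn (h x) (sphere c R))
    (hd : ∀ z ∈ sphere c R, DifferentiableOn ℂ (h · z) (ball x₀ ε))
    (hC : ∀ x ∈ ball x₀ ε, ∀ z ∈ sphere c R, ‖h x z‖ ≤ C) :
    DifferentiableAt ℂ (fun x => ∮ z in C(c, R), h x z) x₀ := by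
  have hmem (t : ℝ) := circleMap_mem_sphere c hR t
  refine differentiableAt_intervalIntegral_of_bounded (C := R * C) hε (fun x hx => ?_)
    (fun t => (hd _ (hmem t)).const_smul (deriv (circleMap c R) t)) fun x hx t => ?_
  · simp only [deriv_circleMap]
    exact ((continuous_circleMap 0 R).mul continuous_const).smul
      ((hcont x hx).comp_continuous (continuous_circleMap c R) hmem)
  · simp only [deriv_circleMap, norm_smul, norm_mul, norm_circleMap_zero, Complex.norm_I,
      mul_one, abs_of_nonneg hR]
    exact mul_le_mul_of_nonneg_left (hC x hx _ (hmem t)) hR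

/-- **Weierstrass M-test** for holomorphic functions of several variables. -/
theorem differentiableAt_tsum_of_bounded {X : Type*} [NormedAddCommGroup X] [NormedSpace ℂ X]
    {u : ℕ → X → ℂ} {b : ℕ → ℝ} {x₀ : X} {ε : ℝ} (hε : 0 < ε)
    (hd : ∀ m, DifferentiableOn ℂ (u m) (ball x₀ ε)) (hb : Summable b)
    (hu : ∀ m, ∀ x ∈ ball x₀ ε, ‖u m x‖ ≤ b m) :
    DifferentiableAt ℂ (fun x => ∑' m, u m x) x₀ := by
  let : NormedSpace ℝ X := NormedSpace.restrictScalars ℝ ℂ X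
  have hx₀ : x₀ ∈ ball x₀ (ε / 2) := mem_ball_self (by positivity)
  exact (hasFDerivAt_tsum_of_isPreconnected (𝕜 := ℂ) (u := fun m => 4 * b m / ε)
    ((hb.mul_left 4).div_const ε) isOpen_ball (convex_ball x₀ (ε / 2)).isPreconnected
    (fun m x hx => ((hd m).differentiableAt
      (isOpen_ball.mem_nhds (ball_subset_ball (by linarith) hx))).hasFDerivAt)
    (fun m x hx => norm_fderiv_le_of_bounded_on_ball hε (hd m) (hu m) hx) hx₀
    (hb.of_norm_bounded fun m => hu m x₀ (mem_ball_self hε)) hx₀).differentiableAt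

/-- The unit polydisc centred at the origin. -/
def unitPolydisc (m : ℕ) : Set (EuclideanSpace ℂ (Fin m)) := {z | ∀ j, ‖z j‖ < 1}

theorem isOpen_unitPolydisc (m : ℕ) : IsOpen (unitPolydisc m) := by
  simp only [unitPolydisc, ofPred_forall]
  exact isOpen_iInter_of_finite fun j =>
    isOpen_lt (by fun_prop) continuous_const

theorem mem_unitPolydisc_of_norm_lt_one {m : ℕ} {z : EuclideanSpace ℂ (Fin m)} (hz : ‖z‖ < 1) :
    z ∈ unitPolydisc m := fun j => (PiLp.norm_apply_le z j).trans_lt hz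

theorem isOpen_setOf_mem_and_norm_mem_Ioo {Y W : Type*} [TopologicalSpace Y]
    [SeminormedAddCommGroup W] {U : Set Y} (hU : IsOpen U) (r : ℝ) :
    IsOpen {p : Y × W | p.1 ∈ U ∧ r < ‖p.2‖ ∧ ‖p.2‖ < 1} :=
  (hU.preimage continuous_fst).inter
    ((isOpen_lt continuous_const continuous_snd.norm).inter
      (isOpen_lt continuous_snd.norm continuous_const))

/-- A holomorphic function on a product of an open set with a shell `{r < ‖w‖ < 1}` induces, by
Cauchy integrals over circles inside the shell, a holomorphic function near the zero section. -/
theorem exists_differentiableOn_near_zero_of_shell {Y : Type*} [NormedAddCommGroup Y]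
    [NormedSpace ℂ Y] [FiniteDimensional ℂ Y] {U : Set Y} (hU : IsOpen U) {k : ℕ} (hk : 1 ≤ k)
    {r C : ℝ} (hr0 : 0 < r) (hr1 : r < 1) {f : Y × EuclideanSpace ℂ (Fin k) → ℂ}
    (hf : DifferentiableOn ℂ f {p | p.1 ∈ U ∧ r < ‖p.2‖ ∧ ‖p.2‖ < 1})
    (hfb : ∀ p : Y × EuclideanSpace ℂ (Fin k), p.1 ∈ U → r < ‖p.2‖ → ‖p.2‖ < 1 → ‖f p‖ ≤ C) :
    ∃ ε > 0, ∃ G : Y × EuclideanSpace ℂ (Fin k) → ℂ,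
      DifferentiableOn ℂ G (U ×ˢ ball 0 ε) ∧ (∀ p ∈ U ×ˢ ball 0 ε, ‖G p‖ ≤ C) ∧
      ∀ s ∈ U, ∀ g : EuclideanSpace ℂ (Fin k) → ℂ, DifferentiableOn ℂ g (unitPolydisc k) →
        (∀ w, r < ‖w‖ → ‖w‖ < 1 → g w = f (s, w)) → ∀ w ∈ ball 0 ε, G (s, w) = g w := by
  let e : EuclideanSpace ℂ (Fin k) := EuclideanSpace.single ⟨0, hk⟩ 1
  have he : ‖e‖ = 1 := by simp [e]
  obtain ⟨ρ, ε, hε, hρ, h1, h2⟩ : ∃ ρ ε : ℝ, 0 < ε ∧ 0 < ρ ∧ ρ + ε = 1 ∧ ρ - ε = r :=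
    ⟨(1 + r) / 2, (1 - r) / 2, by linarith, by linarith, by ring, by ring⟩
  have hlt {w : EuclideanSpace ℂ (Fin k)} (hw : ‖w‖ < ε) {z : ℂ} (hz : ‖z‖ ≤ ρ) :
      ‖w + z • e‖ < 1 := by
    have := norm_add_le w (z • e)
    rw [norm_smul, he] at this
    linarith
  have hgt {w : EuclideanSpace ℂ (Fin k)} (hw : ‖w‖ < ε) {z : ℂ} (hz : ‖z‖ = ρ) :
      r < ‖w + z • e‖ := by
    have := norm_sub_le (w + z • e) w
    rw [add_sub_cancel_left, norm_smul, he, hz] at this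
    linarith
  have hne {z : ℂ} (hz : z ∈ sphere (0 : ℂ) ρ) : z ≠ 0 := ne_zero_of_mem_sphere hρ.ne' ⟨z, hz⟩
  have hbound {s : Y} (hs : s ∈ U) {w : EuclideanSpace ℂ (Fin k)} (hw : ‖w‖ < ε) {z : ℂ}
      (hz : z ∈ sphere (0 : ℂ) ρ) : ‖z⁻¹ • f (s, w + z • e)‖ ≤ C / ρ := by
    have hz' : ‖z‖ = ρ := mem_sphere_zero_iff_norm.1 hz
    rw [norm_smul, norm_inv, hz', inv_mul_eq_div]
    gcongr
    exact hfb _ hs (hgt hw hz') (hlt hw hz'.le)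
  refine ⟨ε, hε, fun p => (2 * Real.pi * Complex.I : ℂ)⁻¹ •
    ∮ z in C(0, ρ), z⁻¹ • f (p.1, p.2 + z • e), ?_, ?_, ?_⟩
  · intro p hp
    obtain ⟨η, hη, hsub⟩ := Metric.isOpen_iff.1 (hU.prod isOpen_ball) p hp
    have hmem {q} (hq : q ∈ ball p η) {z : ℂ} (hz : z ∈ sphere (0 : ℂ) ρ) :
        (q.1, q.2 + z • e) ∈
          {p : Y × EuclideanSpace ℂ (Fin k) | p.1 ∈ U ∧ r < ‖p.2‖ ∧ ‖p.2‖ < 1} := by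
      have hz' : ‖z‖ = ρ := mem_sphere_zero_iff_norm.1 hz
      have hq2 : ‖q.2‖ < ε := mem_ball_zero_iff.1 (hsub hq).2
      exact ⟨(hsub hq).1, hgt hq2 hz', hlt hq2 hz'.le⟩
    refine DifferentiableAt.differentiableWithinAt (DifferentiableAt.fun_const_smul
      (differentiableAt_circleIntegral_of_bounded (C := C / ρ) hη hρ.le
        (fun q hq => ?_) (fun z hz => ?_) fun q hq z hz =>
        hbound (hsub hq).1 (mem_ball_zero_iff.1 (hsub hq).2) hz) _)
    · exact (continuousOn_id.inv₀ fun z hz => hne hz).smul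
        (hf.continuousOn.comp (by fun_prop) fun z hz => hmem hq hz)
    · exact (hf.comp (by fun_prop) fun q hq => hmem hq hz).const_smul z⁻¹
  · rintro ⟨s, w⟩ ⟨hs, hw⟩
    refine (circleIntegral.norm_two_pi_i_inv_smul_integral_le_of_norm_le_const hρ.le
      fun z hz => hbound hs (mem_ball_zero_iff.1 hw) hz).trans_eq ?_
    field_simp
  · intro s hs g hg hgf w hw
    have hw' := mem_ball_zero_iff.1 hw
    have hd : DifferentiableOn ℂ (fun z : ℂ => g (w + z • e)) (closedBall 0 ρ) :=
      hg.comp (by fun_prop) fun z hz =>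
        mem_unitPolydisc_of_norm_lt_one (hlt hw' (mem_closedBall_zero_iff.1 hz))
    have hcauchy := hd.circleIntegral_one_div_sub_center_pow_smul hρ 0
    have hcongr : (∮ z in C(0, ρ), z⁻¹ • f (s, w + z • e)) =
        ∮ z in C(0, ρ), (1 / (z - 0) ^ (0 + 1)) • g (w + z • e) := by
      refine circleIntegral.integral_congr hρ.le fun z hz => ?_
      have hz' : ‖z‖ = ρ := mem_sphere_zero_iff_norm.1 hz
      simp [hgf _ (hgt hw' hz') (hlt hw' hz'.le)]
    simp only [hcongr, hcauchy, Nat.factorial_zero, Nat.cast_one, div_one, iteratedDeriv_zero,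
      zero_smul, add_zero]
    exact inv_smul_smul₀ Complex.two_pi_I_ne_zero _

/-- The homogeneous Taylor components in `w` of a holomorphic function `G (s, w)` near the zero
section are holomorphic. -/
theorem differentiableOn_iteratedDeriv_smul {Y W : Type*} [NormedAddCommGroup Y]
    [NormedSpace ℂ Y] [FiniteDimensional ℂ Y] [NormedAddCommGroup W] [NormedSpace ℂ W]
    [FiniteDimensional ℂ W] {U : Set Y} (hU : IsOpen U) {ε C : ℝ} (hε : 0 < ε) {G : Y × W → ℂ}
    (hG : DifferentiableOn ℂ G (U ×ˢ ball 0 ε)) (hGb : ∀ p ∈ U ×ˢ ball 0 ε, ‖G p‖ ≤ C) (m : ℕ) :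
    DifferentiableOn ℂ (fun p : Y × W => iteratedDeriv m (fun z : ℂ => G (p.1, z • p.2)) 0)
      (U ×ˢ univ) := by
  rintro ⟨s₀, w₀⟩ ⟨hs₀, -⟩
  refine DifferentiableAt.differentiableWithinAt ?_
  obtain ⟨η, hη, hsub⟩ := Metric.isOpen_iff.1
    (hU.prod (isOpen_ball (x := w₀) (ε := 1))) (s₀, w₀) ⟨hs₀, mem_ball_self one_pos⟩
  obtain ⟨δ, hδ, hδε⟩ : ∃ δ > 0, δ * (‖w₀‖ + 1) < ε :=
    ⟨ε / (2 * (‖w₀‖ + 1)), by positivity, by field_simp; norm_num⟩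
  have hmem {q : Y × W} (hq : q ∈ ball (s₀, w₀) η) {z : ℂ} (hz : ‖z‖ ≤ δ) :
      (q.1, z • q.2) ∈ U ×ˢ ball (0 : W) ε := by
    refine ⟨(hsub hq).1, mem_ball_zero_iff.2 ?_⟩
    have h1 : ‖q.2‖ ≤ ‖w₀‖ + 1 := by
      have := mem_ball_iff_norm.1 (hsub hq).2
      have := norm_sub_norm_le q.2 w₀
      linarith
    rw [norm_smul]
    exact (mul_le_mul hz h1 (norm_nonneg _) hδ.le).trans_lt hδε
  have hne {z : ℂ} (hz : z ∈ sphere (0 : ℂ) δ) : z ≠ 0 := ne_zero_of_mem_sphere hδ.ne' ⟨z, hz⟩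
  have hle {z : ℂ} (hz : z ∈ sphere (0 : ℂ) δ) : ‖z‖ ≤ δ := (mem_sphere_zero_iff_norm.1 hz).le
  have hint : DifferentiableAt ℂ (fun p : Y × W =>
      ∮ z in C(0, δ), (1 / (z - 0) ^ (m + 1)) • G (p.1, z • p.2)) (s₀, w₀) := by
    refine differentiableAt_circleIntegral_of_bounded (C := (1 / δ ^ (m + 1)) * C) hη hδ.le
      (fun q hq => ?_) (fun z hz => ?_) fun q hq z hz => ?_
    · refine ContinuousOn.smul (ContinuousOn.div₀ continuousOn_const
        ((continuousOn_id.sub continuousOn_const).pow _) fun z hz => ?_)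
        (hG.continuousOn.comp (by fun_prop) fun z hz => hmem hq (hle hz))
      simpa using hne hz
    · exact (hG.comp (by fun_prop) fun q hq => hmem hq (hle hz)).const_smul (1 / (z - 0) ^ (m + 1))
    · rw [norm_smul, sub_zero, norm_div, norm_pow, norm_one, mem_sphere_zero_iff_norm.1 hz]
      gcongr
      exact hGb _ (hmem hq (hle hz))
  refine (hint.const_smul (2 * Real.pi * Complex.I / m.factorial : ℂ)⁻¹).congr_of_eventuallyEq ?_
  filter_upwards [ball_mem_nhds (s₀, w₀) hη] with q hq
  have hd : DifferentiableOn ℂ (fun z : ℂ => G (q.1, z • q.2)) (closedBall 0 δ) :=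
    hG.comp (by fun_prop) fun z hz => hmem hq (mem_closedBall_zero_iff.1 hz)
  rw [Pi.smul_apply, hd.circleIntegral_one_div_sub_center_pow_smul hδ m, inv_smul_smul₀]
  simp [Nat.factorial_ne_zero]

/-- Let `G (s, w)` be holomorphic near the zero section, and suppose that for a dense set of
parameters `s` the germ of `G (s, ·)` extends to the polydisc with a uniform bound. Then these
extensions are the restrictions of one holomorphic function. -/
theorem exists_differentiableOn_of_dense_extension {Y : Type*} [NormedAddCommGroup Y]
    [NormedSpace ℂ Y] [FiniteDimensional ℂ Y] {U S : Set Y} (hU : IsOpen U)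
    (hdense : U ⊆ closure S) {k : ℕ} {ε C : ℝ} (hε : 0 < ε)
    {G : Y × EuclideanSpace ℂ (Fin k) → ℂ} {g : Y → EuclideanSpace ℂ (Fin k) → ℂ}
    (hG : DifferentiableOn ℂ G (U ×ˢ ball 0 ε)) (hGb : ∀ p ∈ U ×ˢ ball 0 ε, ‖G p‖ ≤ C)
    (hg : ∀ s ∈ S, DifferentiableOn ℂ (g s) (unitPolydisc k))
    (hgb : ∀ s ∈ S, ∀ w ∈ unitPolydisc k, ‖g s w‖ ≤ C)
    (hgG : ∀ s ∈ S, ∀ w ∈ ball 0 ε, G (s, w) = g s w) :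
    ∃ F : Y × EuclideanSpace ℂ (Fin k) → ℂ, DifferentiableOn ℂ F (U ×ˢ unitPolydisc k) ∧
      ∀ s ∈ S, ∀ w ∈ unitPolydisc k, F (s, w) = g s w := by
  let P (m : ℕ) (p : Y × EuclideanSpace ℂ (Fin k)) : ℂ :=
    (m.factorial : ℂ)⁻¹ * iteratedDeriv m (fun z : ℂ => G (p.1, z • p.2)) 0
  have hP (m : ℕ) : DifferentiableOn ℂ (P m) (U ×ˢ univ) :=
    (differentiableOn_iteratedDeriv_smul hU hε hG hGb m).const_mul _
  have hPg {s : Y} (hs : s ∈ S) (w : EuclideanSpace ℂ (Fin k)) (m : ℕ) :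
      P m (s, w) = (m.factorial : ℂ)⁻¹ * iteratedDeriv m (fun z : ℂ => g s (z • w)) 0 := by
    have hev : (fun z : ℂ => G (s, z • w)) =ᶠ[𝓝 0] fun z : ℂ => g s (z • w) := by
      have hc : Continuous fun z : ℂ => z • w := by fun_prop
      filter_upwards [hc.continuousAt.preimage_mem_nhds (x := 0)
        (by simpa using ball_mem_nhds 0 hε)] with z hz using hgG s hs _ hz
    simp only [P, hev.iteratedDeriv_eq m]
  have hslice {R : ℝ} {w : EuclideanSpace ℂ (Fin k)} (hw : ∀ j, R * ‖w j‖ < 1) {z : ℂ}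
      (hz : ‖z‖ ≤ R) : z • w ∈ unitPolydisc k := fun j => by
    rw [PiLp.smul_apply, norm_smul]
    exact (mul_le_mul_of_nonneg_right hz (norm_nonneg _)).trans_lt (hw j)
  have hgd {s : Y} (hs : s ∈ S) {R : ℝ} {w : EuclideanSpace ℂ (Fin k)}
      (hw : ∀ j, R * ‖w j‖ < 1) :
      DifferentiableOn ℂ (fun z : ℂ => g s (z • w)) (closedBall 0 R) :=
    (hg s hs).comp (by fun_prop) fun z hz => hslice hw (mem_closedBall_zero_iff.1 hz)
  have hPb {s : Y} (hs : s ∈ U) {R : ℝ} (hR : 0 < R) {w : EuclideanSpace ℂ (Fin k)}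
      (hw : ∀ j, R * ‖w j‖ < 1) (m : ℕ) : ‖P m (s, w)‖ ≤ C * R⁻¹ ^ m := by
    have hcont : ContinuousAt (fun t => P m (t, w)) s := by
      have := ((hP m).differentiableAt ((hU.prod isOpen_univ).mem_nhds
        (show (s, w) ∈ U ×ˢ univ from ⟨hs, mem_univ _⟩))).continuousAt
      exact this.comp (f := fun t => (t, w)) (by fun_prop)
    refine mem_closedBall_zero_iff.1 (isClosed_closedBall.closure_subset
      (hcont.continuousWithinAt.mem_closure (hdense hs) fun t ht => ?_))
    simp only [mem_closedBall_zero_iff]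
    rw [hPg ht, norm_mul, norm_inv, RCLike.norm_natCast, inv_mul_le_iff₀
      (by positivity)]
    refine (Complex.norm_iteratedDeriv_le_of_forall_mem_sphere_norm_le m hR
      ((hgd ht hw).mono closure_ball_subset_closedBall).diffContOnCl fun z hz =>
      hgb t ht _ (hslice hw (mem_sphere_zero_iff_norm.1 hz).le)).trans_eq ?_
    rw [inv_pow]
    ring
  have hRex {w : EuclideanSpace ℂ (Fin k)} (hw : w ∈ unitPolydisc k) :
      ∃ R > 1, ∀ j, R * ‖w j‖ < 1 := by
    have hev : ∀ᶠ R : ℝ in 𝓝 1, ∀ j, R * ‖w j‖ < 1 := by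
      refine eventually_all.2 fun j => ?_
      have hc : ContinuousAt (fun R : ℝ => R * ‖w j‖) 1 := by fun_prop
      exact hc.eventually_lt_const (by simpa using hw j)
    obtain ⟨R, h1, h2⟩ := ((hev.filter_mono nhdsWithin_le_nhds).and
      (self_mem_nhdsWithin (s := Ioi (1 : ℝ)))).exists
    exact ⟨R, h2, h1⟩
  refine ⟨fun p => ∑' m, P m p, ?_, ?_⟩
  · rintro ⟨s₀, w₀⟩ ⟨hs₀, hw₀⟩
    obtain ⟨R, hR1, hR⟩ := hRex hw₀
    have hR0 : 0 < R := one_pos.trans hR1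
    have hopen : IsOpen {w : EuclideanSpace ℂ (Fin k) | ∀ j, R * ‖w j‖ < 1} := by
      simp only [ofPred_forall]
      exact isOpen_iInter_of_finite fun j => isOpen_lt (by fun_prop) continuous_const
    obtain ⟨η, hη, hsub⟩ := Metric.isOpen_iff.1 (hU.prod hopen) (s₀, w₀) ⟨hs₀, hR⟩
    refine (differentiableAt_tsum_of_bounded hη
      (fun m => (hP m).mono fun q hq => ⟨(hsub hq).1, mem_univ _⟩)
      ((summable_geometric_of_lt_one (by positivity) (inv_lt_one_of_one_lt₀ hR1)).mul_left C)
      fun m q hq => hPb (hsub hq).1 hR0 (hsub hq).2 m).differentiableWithinAt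
  · intro s hs w hw
    obtain ⟨R, hR1, hR⟩ := hRex hw
    have hsum := Complex.hasSum_taylorSeries_on_ball
      ((hgd hs hR).mono ball_subset_closedBall) (z := 1) (by simpa using hR1)
    simp only [sub_zero, one_pow, one_smul, one_mul, smul_eq_mul] at hsum
    simp only [hPg hs, hsum.tsum_eq]


/-- The instance of Proposition 1.2 of the paper with target ℂ: if `f` is
bounded holomorphic on `Δⁿ × A^k(r,1)` and for every `s` in a dense subset
`S ⊆ Δⁿ` the slice `f_s` extends to a holomorphic function on `Δ^k` bounded by
the same constant, then `f` extends holomorphically to `Δⁿ × Δ^k`. -/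
theorem stmt_8 (n k : ℕ) (hn : 1 ≤ n) (hk : 1 ≤ k)
    (r : ℝ) (hr0 : 0 < r) (hr1 : r < 1)
    (C₀ : ℝ) (hC₀ : 0 < C₀)
    (f : EuclideanSpace ℂ (Fin n) × EuclideanSpace ℂ (Fin k) → ℂ)
    (hf : DifferentiableOn ℂ f
      {p | (∀ j, ‖p.1 j‖ < 1) ∧ r < ‖p.2‖ ∧ ‖p.2‖ < 1})
    (hfb : ∀ p : EuclideanSpace ℂ (Fin n) × EuclideanSpace ℂ (Fin k),
      (∀ j, ‖p.1 j‖ < 1) → r < ‖p.2‖ → ‖p.2‖ < 1 → ‖f p‖ ≤ C₀)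
    (S : Set (EuclideanSpace ℂ (Fin n)))
    (hS : S ⊆ {s | ∀ j, ‖s j‖ < 1})
    (hdense : {s : EuclideanSpace ℂ (Fin n) | ∀ j, ‖s j‖ < 1} ⊆ closure S)
    (hext : ∀ s ∈ S, ∃ g : EuclideanSpace ℂ (Fin k) → ℂ,
      DifferentiableOn ℂ g {w | ∀ j, ‖w j‖ < 1} ∧
      (∀ w : EuclideanSpace ℂ (Fin k), (∀ j, ‖w j‖ < 1) → ‖g w‖ ≤ C₀) ∧
      (∀ w : EuclideanSpace ℂ (Fin k), r < ‖w‖ → ‖w‖ < 1 → g w = f (s, w))) :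
    ∃ F : EuclideanSpace ℂ (Fin n) × EuclideanSpace ℂ (Fin k) → ℂ,
      DifferentiableOn ℂ F
        ({s : EuclideanSpace ℂ (Fin n) | ∀ j, ‖s j‖ < 1} ×ˢ
         {w : EuclideanSpace ℂ (Fin k) | ∀ j, ‖w j‖ < 1}) ∧
      ∀ s : EuclideanSpace ℂ (Fin n), (∀ j, ‖s j‖ < 1) →
        ∀ w : EuclideanSpace ℂ (Fin k), r < ‖w‖ → ‖w‖ < 1 →
          F (s, w) = f (s, w) := by
  have hU : IsOpen (unitPolydisc n) := isOpen_unitPolydisc n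
  obtain ⟨ε, hε, G, hG, hGb, hGg⟩ := exists_differentiableOn_near_zero_of_shell
    (U := unitPolydisc n) hU hk hr0 hr1 hf hfb
  choose! g hgd hgb hgf using hext
  obtain ⟨F, hF, hFg⟩ := exists_differentiableOn_of_dense_extension hU hdense hε hG hGb
    hgd hgb fun s hs => hGg s (hS hs) (g s) (hgd s hs) (hgf s hs)
  refine ⟨F, hF, fun s hs w hrw hw => ?_⟩
  have hs' : s ∈ unitPolydisc n := hs
  have hw' : w ∈ unitPolydisc k := mem_unitPolydisc_of_norm_lt_one hw
  have hf' : DifferentiableOn ℂ f {p | p.1 ∈ unitPolydisc n ∧ r < ‖p.2‖ ∧ ‖p.2‖ < 1} := hf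
  have hcF : ContinuousAt F (s, w) := (hF.differentiableAt
    ((hU.prod (isOpen_unitPolydisc k)).mem_nhds (mk_mem_prod hs' hw'))).continuousAt
  have hcf : ContinuousAt f (s, w) :=
    (hf'.differentiableAt
      ((isOpen_setOf_mem_and_norm_mem_Ioo hU r).mem_nhds
        (show (s, w).1 ∈ unitPolydisc n ∧ _ from ⟨hs', hrw, hw⟩))).continuousAt
  have hcont : ContinuousAt (fun t => F (t, w) - f (t, w)) s :=
    (hcF.sub hcf).comp (f := fun t => (t, w)) (by fun_prop)
  have hmem := hcont.continuousWithinAt.mem_closure (hdense hs') (t := {0}) fun t ht => by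
    simp [hFg t ht w hw', hgf t ht w hrw hw]
  rw [closure_singleton] at hmem
  exact sub_eq_zero.1 hmem
end
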